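/- arXiv:1601.01766 — 4 statements merged into one kernel-verified Lean document; each statement's English description precedes it below -/
import Mathlib

section
/- Energy estimate for the truncated bubble (inequality (3.1), case distinction): Let Ω ⊂ ℝⁿ be a bounded open set containing 0, A a continuous map from the closure of Ω to symmetric positive definite n×n matrices with A(0) = I_n, and suppose there are constants C₀ > 0, σ > 0 and r₁ > 0 such that A(x) ≤ I_n + C₀|x|^σ I_n in the sense of bilinear forms for all x ∈ Ω with |x| < r₁. Let φ: [0,∞) → [0,1] be a smooth nonincreasing function with φ(t) = 1 for 0 ≤ t ≤ 1/2 and φ(t) = 0 for t ≥ 1, let 0 < r < r₁ be such that the ball B(0,r) is contained in Ω, and set φ_r(x,y) = φ(√(|x|² + y²)/r). Then there exist constants C > 0 and ε₀ > 0 such that for all 0 < ε < ε₀: c_s ∫_Ω ∫_0^∞ y^{1−2s} (∇(φ_r w_ε))ᵀ B(x) ∇(φ_r w_ε) dy dx ≤ c_s ∫_{ℝⁿ} ∫_0^∞ y^{1−2s} |∇w_ε(x,y)|² dy dx + E(ε), where B(x) = diag(A(x),1) and E(ε) = C(ε^σ + ε^{n−2s}) if σ < n−2s, E(ε) = C(ε^σ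 log(1/ε) + ε^{n−2s}) if σ = n−2s, and E(ε) = C ε^{n−2s} if σ > n−2s. -/
open MeasureTheory Filter Set Topology

noncomputable section

abbrev Euc (n : ℕ) := EuclideanSpace ℝ (Fin n)

/-- Partial derivative of `w` in the `i`-th horizontal direction. -/
noncomputable def pdX (n : ℕ) (w : Euc n → ℝ → ℝ) (i : Fin n) (x : Euc n) (y : ℝ) : ℝ :=
  fderiv ℝ (fun x' => w x' y) x (EuclideanSpace.single i 1)

/-- Partial derivative of `w` in the vertical direction. -/
noncomputable def pdY (n : ℕ) (w : Euc n → ℝ → ℝ) (x : Euc n) (y : ℝ) : ℝ :=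
  deriv (fun y' => w x y') y

/-- `(∇ₓ w)ᵀ M (∇ₓ w)`. -/
noncomputable def quadA (n : ℕ) (M : Matrix (Fin n) (Fin n) ℝ) (w : Euc n → ℝ → ℝ)
    (x : Euc n) (y : ℝ) : ℝ :=
  ∑ i, ∑ j, M i j * pdX n w i x y * pdX n w j x y

/-- `(∇ w)ᵀ diag(M,1) (∇ w)`. -/
noncomputable def quadB (n : ℕ) (M : Matrix (Fin n) (Fin n) ℝ) (w : Euc n → ℝ → ℝ)
    (x : Euc n) (y : ℝ) : ℝ :=
  quadA n M w x y + (pdY n w x y) ^ 2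

/-- The standard bubble `u₁`. -/
noncomputable def u1 (n : ℕ) (s : ℝ) (ξ : Euc n) : ℝ :=
  (1 + ‖ξ‖ ^ 2) ^ (-(((n:ℝ) - 2*s) / 2))

/-- The `s`-harmonic extension `w₁` of `u₁`. -/
noncomputable def w1 (n : ℕ) (s cns : ℝ) (x : Euc n) (y : ℝ) : ℝ :=
  cns * y ^ (2*s) *
    ∫ ξ : Euc n, u1 n s ξ * (‖x - ξ‖ ^ 2 + y ^ 2) ^ (-(((n:ℝ) + 2*s) / 2))

/-- The rescaled bubble extension `w_ε`. -/
noncomputable def wEps (n : ℕ) (s cns ε : ℝ) (x : Euc n) (y : ℝ) : ℝ :=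
  ε ^ ((2*s - (n:ℝ)) / 2) * w1 n s cns (ε⁻¹ • x) (y / ε)


def Jint (p q : ℝ) : ℝ := ∫ τ in Ioi (0:ℝ), τ ^ (p-1) * (1 + τ) ^ (-q)

def cnk (n : ℕ) (k : ℝ) : ℝ := ∫ x : Euc n, (1 + ‖x‖^2) ^ (-k)

lemma base_int {p q : ℝ} (hp : 0 < p) (hpq : p < q) :
    IntegrableOn (fun τ : ℝ => τ ^ (p-1) * (1 + τ) ^ (-q)) (Ioi 0) := by
  rw [← Ioc_union_Ioi_eq_Ioi (zero_le_one : (0:ℝ) ≤ 1)]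
  have hm : Measurable (fun τ : ℝ => τ ^ (p-1) * (1 + τ) ^ (-q)) := by fun_prop
  refine IntegrableOn.union ?_ ?_
  · have h1 : IntegrableOn (fun τ : ℝ => τ ^ (p-1)) (Ioc 0 1) := by
      rw [← intervalIntegrable_iff_integrableOn_Ioc_of_le zero_le_one]
      exact intervalIntegral.intervalIntegrable_rpow' (by linarith)
    refine Integrable.mono' h1 hm.aestronglyMeasurable ?_
    filter_upwards [ae_restrict_mem measurableSet_Ioc] with τ hτ
    have h0 : 0 < τ := hτ.1
    rw [Real.norm_of_nonneg (by positivity)]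
    have : (1 + τ) ^ (-q) ≤ 1 := Real.rpow_le_one_of_one_le_of_nonpos (by linarith) (by linarith)
    exact mul_le_of_le_one_right (by positivity) this
  · have h1 : IntegrableOn (fun τ : ℝ => τ ^ (p-1-q)) (Ioi 1) :=
      integrableOn_Ioi_rpow_of_lt (by linarith) one_pos
    refine Integrable.mono' h1 hm.aestronglyMeasurable ?_
    filter_upwards [ae_restrict_mem measurableSet_Ioi] with τ hτ
    have h0 : 0 < τ := lt_trans one_pos hτ
    rw [Real.norm_of_nonneg (by positivity)]
    rw [sub_eq_add_neg (p-1) q, Real.rpow_add h0]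
    refine mul_le_mul_of_nonneg_left ?_ (by positivity)
    exact Real.rpow_le_rpow_of_nonpos h0 (le_add_of_nonneg_left zero_le_one) (by linarith)

lemma Jint_pos {p q : ℝ} (hp : 0 < p) (hpq : p < q) : 0 < Jint p q := by
  unfold Jint
  rw [setIntegral_pos_iff_support_of_nonneg_ae]
  · have : (Function.support (fun τ : ℝ => τ ^ (p-1) * (1 + τ) ^ (-q)) ∩ Ioi 0) = Ioi 0 := by
      apply inter_eq_right.2
      intro τ hτ
      have h0 : 0 < τ := hτ
      have : 0 < τ ^ (p-1) * (1 + τ) ^ (-q) := by positivity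
      exact this.ne'
    rw [this]; simp
  · filter_upwards [ae_restrict_mem measurableSet_Ioi] with τ hτ
    have h0 : 0 < τ := hτ
    simp only [Pi.zero_apply]
    positivity
  · exact base_int hp hpq

lemma base_scale {p q R : ℝ} (hp : 0 < p) (hpq : p < q) (hR : 0 < R) :
    IntegrableOn (fun τ : ℝ => τ ^ (p-1) * (1 + R * τ) ^ (-q)) (Ioi 0) ∧
    ∫ τ in Ioi (0:ℝ), τ ^ (p-1) * (1 + R * τ) ^ (-q) = R ^ (-p) * Jint p q := by
  have h1 := (integrableOn_Ioi_comp_mul_left_iff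
    (fun τ : ℝ => τ ^ (p-1) * (1 + τ) ^ (-q)) 0 hR).2 (by simpa using base_int hp hpq)
  have h2 := integral_comp_mul_left_Ioi
    (fun τ : ℝ => τ ^ (p-1) * (1 + τ) ^ (-q)) 0 hR
  have he : ∀ τ ∈ Ioi (0:ℝ), R ^ (1-p) * ((R * τ) ^ (p-1) * (1 + R * τ) ^ (-q)) =
      τ ^ (p-1) * (1 + R * τ) ^ (-q) := by
    intro τ hτ
    have h0 : 0 < τ := hτ
    rw [Real.mul_rpow hR.le h0.le]
    have : R ^ (1-p) * R ^ (p-1) = 1 := by rw [← Real.rpow_add hR]; simp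
    calc _ = (R ^ (1-p) * R ^ (p-1)) * (τ ^ (p-1) * (1 + R * τ) ^ (-q)) := by ring
      _ = _ := by rw [this, one_mul]
  constructor
  · exact IntegrableOn.congr_fun (h1.const_mul (R ^ (1-p))) he measurableSet_Ioi
  · rw [← setIntegral_congr_fun measurableSet_Ioi he, integral_const_mul, h2]
    simp only [mul_zero, smul_eq_mul]
    rw [← mul_assoc, ← Real.rpow_neg_one R, ← Real.rpow_add hR]
    unfold Jint
    congr 2; ring

lemma base_lint {p q A B : ℝ} (hp : 0 < p) (hpq : p < q) (hA : 0 < A) (hB : 0 < B) :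
    ∫⁻ τ in Ioi (0:ℝ), ENNReal.ofReal (τ ^ (p-1) * (A * τ + B) ^ (-q)) =
      ENNReal.ofReal (A ^ (-p) * B ^ (p-q) * Jint p q) := by
  obtain ⟨h1, h2⟩ := base_scale hp hpq (div_pos hA hB)
  have he : ∀ τ ∈ Ioi (0:ℝ), B ^ (-q) * (τ ^ (p-1) * (1 + A / B * τ) ^ (-q)) =
      τ ^ (p-1) * (A * τ + B) ^ (-q) := by
    intro τ hτ
    have h0 : 0 < τ := hτ
    have : A * τ + B = B * (1 + A / B * τ) := by field_simp; ring
    rw [this, Real.mul_rpow hB.le (by positivity)]; ring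
  rw [← ofReal_integral_eq_lintegral_ofReal]
  · rw [← setIntegral_congr_fun measurableSet_Ioi he, integral_const_mul, h2]
    congr 1
    rw [Real.div_rpow hA.le hB.le, sub_eq_add_neg p q, Real.rpow_add hB, Real.rpow_neg hB.le p]
    field_simp
  · exact IntegrableOn.congr_fun (h1.const_mul (B ^ (-q))) he measurableSet_Ioi
  · filter_upwards [ae_restrict_mem measurableSet_Ioi] with τ hτ
    have h0 : 0 < τ := hτ
    simp only [Pi.zero_apply]
    positivity

lemma x_lint (n : ℕ) {k A M : ℝ} (hk : (n:ℝ)/2 < k) (hA : 0 < A) (hM : 0 < M) (v : Euc n) :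
    ∫⁻ x : Euc n, ENNReal.ofReal ((A * ‖x - v‖^2 + M) ^ (-k)) =
      ENNReal.ofReal (A ^ (-((n:ℝ)/2)) * M ^ ((n:ℝ)/2 - k) * cnk n k) := by
  rw [lintegral_sub_right_eq_self (fun x : Euc n => ENNReal.ofReal ((A * ‖x‖^2 + M) ^ (-k))) v]
  have hi : Integrable (fun x : Euc n => (1 + ‖x‖^2) ^ (-k)) := by
    have := integrable_rpow_neg_one_add_norm_sq (E := Euc n) (μ := volume) (r := 2*k)
      (by simp; linarith)
    convert this using 3; ring
  set S := Real.sqrt (A / M) with hS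
  have hSp : 0 < S := Real.sqrt_pos.2 (div_pos hA hM)
  have hS2 : S ^ 2 = A / M := Real.sq_sqrt (div_pos hA hM).le
  have he : (fun x : Euc n => (A * ‖x‖^2 + M) ^ (-k)) =
      fun x : Euc n => M ^ (-k) * (1 + ‖S • x‖^2) ^ (-k) := by
    ext x
    rw [norm_smul, mul_pow, Real.norm_of_nonneg hSp.le, hS2, ← Real.mul_rpow hM.le (by positivity)]
    congr 1; field_simp; ring
  have hi2 := (integrable_comp_smul_iff volume (fun x : Euc n => (1 + ‖x‖^2) ^ (-k)) hSp.ne').2 hi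
  have hI := Measure.integral_comp_smul volume (fun x : Euc n => (1 + ‖x‖^2) ^ (-k)) S
  rw [← ofReal_integral_eq_lintegral_ofReal]
  · rw [he, integral_const_mul, hI]
    congr 1
    have h3 : |(S ^ Module.finrank ℝ (Euc n))⁻¹| = A ^ (-((n:ℝ)/2)) * M ^ ((n:ℝ)/2) := by
      rw [abs_of_pos (by positivity)]
      simp only [finrank_euclideanSpace, Fintype.card_fin]
      rw [hS, Real.sqrt_eq_rpow, ← Real.rpow_natCast, ← Real.rpow_mul (div_pos hA hM).le,
        Real.div_rpow hA.le hM.le, Real.rpow_neg hA.le, inv_div]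
      rw [show (1/2 : ℝ) * n = n/2 by ring]
      field_simp
    rw [h3, smul_eq_mul, sub_eq_add_neg, Real.rpow_add hM]
    unfold cnk
    ring
  · rw [he]; exact hi2.const_mul _
  · refine Eventually.of_forall fun x => ?_
    simp only [Pi.zero_apply]
    positivity


def GG (τ a b : ℝ) : ℝ := 1 + τ * (1 + a) + b * (τ + τ^2)

lemma sq_complete (n : ℕ) (x ξ : Euc n) (y τ : ℝ) (hτ : 0 < τ) :
    y^2 * (1 + ‖ξ‖^2) * τ + (‖x - ξ‖^2 + y^2) =
      (1 + τ * y^2) * ‖ξ - (1 + τ * y^2)⁻¹ • x‖^2 +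
        (y^2 * GG τ (‖x‖^2) (y^2) / (1 + τ * y^2)) := by
  have hA : 0 < 1 + τ * y^2 := by positivity
  rw [norm_sub_sq_real, norm_sub_sq_real, inner_smul_right, norm_smul, Real.norm_of_nonneg
    (by positivity), real_inner_comm x ξ]
  unfold GG
  field_simp
  ring

lemma w1_rep (n : ℕ) (hn : 1 ≤ n) (s : ℝ) (hs : s ∈ Ioo (0:ℝ) 1) (hns : 2 * s < (n:ℝ))
    (cns : ℝ) (x : Euc n) (y : ℝ) (hy : 0 < y) :
    w1 n s cns x y = (cns * cnk n n / Jint ((n - 2*s)/2) n) *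
      ∫ τ in Ioi (0:ℝ), τ ^ (((n:ℝ) - 2*s)/2 - 1) * (GG τ (‖x‖^2) (y^2)) ^ (-((n:ℝ)/2)) := by
  have hn' : (1:ℝ) ≤ n := by exact_mod_cast hn
  obtain ⟨hs0, hs1⟩ := hs
  set α : ℝ := ((n:ℝ) - 2*s)/2 with hα
  have hα0 : 0 < α := by rw [hα]; linarith
  have hJ : 0 < Jint α n := Jint_pos hα0 (by rw [hα]; linarith)
  have hcn : 0 ≤ cnk n n := integral_nonneg fun x => by positivity
  have hG : ∀ τ ∈ Ioi (0:ℝ), 0 < GG τ (‖x‖^2) (y^2) := by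
    intro τ hτ
    have h0 : 0 < τ := hτ
    unfold GG; positivity
  set I := ∫ ξ : Euc n, u1 n s ξ * (‖x - ξ‖ ^ 2 + y ^ 2) ^ (-(((n:ℝ) + 2*s) / 2)) with hI
  set T := ∫ τ in Ioi (0:ℝ), τ ^ (α - 1) * (GG τ (‖x‖^2) (y^2)) ^ (-((n:ℝ)/2)) with hT
  have hlin : ∫⁻ ξ : Euc n, ENNReal.ofReal (((y^2) ^ (-α) * Jint α n) *
      (u1 n s ξ * (‖x - ξ‖ ^ 2 + y ^ 2) ^ (-(((n:ℝ) + 2*s) / 2)))) =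
      ∫⁻ τ in Ioi (0:ℝ), ENNReal.ofReal ((cnk n n * (y^2) ^ (-((n:ℝ)/2))) *
        (τ ^ (α - 1) * (GG τ (‖x‖^2) (y^2)) ^ (-((n:ℝ)/2)))) := by
    have e1 : ∀ ξ : Euc n, ENNReal.ofReal (((y^2) ^ (-α) * Jint α n) *
      (u1 n s ξ * (‖x - ξ‖ ^ 2 + y ^ 2) ^ (-(((n:ℝ) + 2*s) / 2)))) =
      ∫⁻ τ in Ioi (0:ℝ), ENNReal.ofReal (τ ^ (α-1) *
        (y^2 * (1 + ‖ξ‖^2) * τ + (‖x - ξ‖^2 + y^2)) ^ (-(n:ℝ))) := by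
      intro ξ
      rw [base_lint hα0 (by rw [hα]; linarith) (by positivity) (by positivity)]
      congr 1
      rw [Real.mul_rpow (by positivity) (by positivity)]
      unfold u1
      rw [show α - n = -(((n:ℝ) + 2*s) / 2) by rw [hα]; ring]
      ring
    simp_rw [e1]
    rw [lintegral_lintegral_swap]
    · refine setLIntegral_congr_fun measurableSet_Ioi ?_
      intro τ hτ
      have h0 : 0 < τ := hτ
      have hA : 0 < 1 + τ * y^2 := by positivity
      have hM : 0 < y^2 * GG τ (‖x‖^2) (y^2) / (1 + τ * y^2) := by
        have := hG τ hτ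
        positivity
      have hGp := hG τ hτ
      simp only []
      have : ∀ ξ : Euc n, ENNReal.ofReal (τ ^ (α-1) *
        (y^2 * (1 + ‖ξ‖^2) * τ + (‖x - ξ‖^2 + y^2)) ^ (-(n:ℝ))) = ENNReal.ofReal (τ ^ (α-1)) *
        ENNReal.ofReal (((1 + τ * y^2) * ‖ξ - (1 + τ * y^2)⁻¹ • x‖^2 +
        (y^2 * GG τ (‖x‖^2) (y^2) / (1 + τ * y^2))) ^ (-(n:ℝ))) := by
        intro ξ
        rw [sq_complete n x ξ y τ h0, ENNReal.ofReal_mul (by positivity)]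
      simp_rw [this]
      rw [lintegral_const_mul' _ _ ENNReal.ofReal_ne_top,
        x_lint n (by linarith) hA hM, ← ENNReal.ofReal_mul (by positivity)]
      congr 1
      rw [show (n:ℝ)/2 - n = -((n:ℝ)/2) by ring, Real.div_rpow (by positivity) hA.le,
        Real.mul_rpow (by positivity) hGp.le]
      have : (1 + τ * y^2) ^ (-((n:ℝ)/2)) ≠ 0 := by positivity
      field_simp
    · apply Measurable.aemeasurable
      simp only [Function.uncurry_def]
      fun_prop
  have e2 := congrArg ENNReal.toReal hlin
  rw [← integral_eq_lintegral_of_nonneg_ae, ← integral_eq_lintegral_of_nonneg_ae,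
    integral_const_mul, integral_const_mul, ← hI, ← hT] at e2
  rotate_left
  · filter_upwards [ae_restrict_mem measurableSet_Ioi] with τ hτ
    have h0 : 0 < τ := hτ
    have := hG τ hτ
    simp only [Pi.zero_apply]
    positivity
  · apply Measurable.aestronglyMeasurable
    unfold GG; fun_prop
  · refine Eventually.of_forall fun ξ => ?_
    simp only [Pi.zero_apply]
    unfold u1; positivity
  · apply Measurable.aestronglyMeasurable
    unfold u1; fun_prop
  have hw : w1 n s cns x y = cns * y ^ (2*s) * I := rfl
  rw [hw]
  have hy2 : (y^2) ^ (-((n:ℝ)/2)) * y ^ (2*s) = (y^2) ^ (-α) := by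
    rw [← Real.rpow_natCast, ← Real.rpow_mul hy.le, ← Real.rpow_mul hy.le, ← Real.rpow_add hy]
    congr 1; rw [hα]; push_cast; ring
  have hp : 0 < (y^2) ^ (-α) := by positivity
  have key : (y^2) ^ (-α) * (Jint α n * (y ^ (2*s) * I)) = (y^2) ^ (-α) * (cnk n n * T) := by
    calc _ = y ^ (2*s) * ((y^2) ^ (-α) * Jint α n * I) := by ring
      _ = _ := by rw [e2, ← hy2]; ring
  have key2 := mul_left_cancel₀ hp.ne' key
  field_simp
  linear_combination cns * key2


def FF (m α a b : ℝ) : ℝ := ∫ τ in Ioi (0:ℝ), τ ^ (α - 1) * (GG τ a b) ^ (-m)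
def FA (m α a b : ℝ) : ℝ := ∫ τ in Ioi (0:ℝ), τ ^ (α - 1) * (τ * (GG τ a b) ^ (-m-1))
def FB (m α a b : ℝ) : ℝ := ∫ τ in Ioi (0:ℝ), τ ^ (α - 1) * ((τ + τ^2) * (GG τ a b) ^ (-m-1))

lemma GG_ge {τ a b R : ℝ} (hτ : 0 < τ) (hR : R ≤ 1 + a + b) (hb : 0 ≤ b) :
    1 + R * τ ≤ GG τ a b := by
  unfold GG
  have : R * τ ≤ (1 + a + b) * τ := mul_le_mul_of_nonneg_right hR hτ.le
  have : 0 ≤ b * τ^2 := by positivity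
  nlinarith

lemma GG_ge2 {τ a b c : ℝ} (hτ : 0 < τ) (ha : 0 ≤ a) (hb : c ≤ b) :
    (1 + τ) * (1 + c * τ) ≤ GG τ a b := by
  unfold GG
  have : 0 ≤ τ * a := by positivity
  have : c * (τ + τ^2) ≤ b * (τ + τ^2) := mul_le_mul_of_nonneg_right hb (by positivity)
  nlinarith

lemma F_pt {m α τ a b R : ℝ} (hm : 0 < m) (hτ : 0 < τ) (hR0 : 0 < R) (hR : R ≤ 1 + a + b)
    (hb : 0 ≤ b) :
    τ ^ (α - 1) * (GG τ a b) ^ (-m) ≤ τ ^ (α - 1) * (1 + R * τ) ^ (-m) :=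
  mul_le_mul_of_nonneg_left
    (Real.rpow_le_rpow_of_nonpos (by positivity) (GG_ge hτ hR hb) (by linarith)) (by positivity)

lemma FA_pt {m α τ a b R : ℝ} (hm : 0 < m) (hτ : 0 < τ) (hR0 : 0 < R) (hR : R ≤ 1 + a + b)
    (hb : 0 ≤ b) :
    τ ^ (α - 1) * (τ * (GG τ a b) ^ (-m-1)) ≤ τ ^ ((α + 1) - 1) * (1 + R * τ) ^ (-(m+1)) := by
  have e : τ ^ (α - 1) * τ = τ ^ ((α + 1) - 1) := by
    rw [← Real.rpow_add_one hτ.ne']; congr 1; ring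
  rw [← mul_assoc, e, show -m-1 = -(m+1) by ring]
  exact mul_le_mul_of_nonneg_left
    (Real.rpow_le_rpow_of_nonpos (by positivity) (GG_ge hτ hR hb) (by linarith)) (by positivity)

lemma FB_pt {m α τ a b c R : ℝ} (hm : 0 < m) (hτ : 0 < τ) (hR0 : 0 < R) (hR : R ≤ 1 + a + b)
    (ha : 0 ≤ a) (hc : 0 < c) (hb : c ≤ b) :
    τ ^ (α - 1) * ((τ + τ^2) * (GG τ a b) ^ (-m-1)) ≤
      R ^ (-m) * (τ ^ ((α + 1 - m) - 1) * (1 + c * τ) ^ (-(1:ℝ))) := by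
  have hb0 : 0 ≤ b := by linarith
  have h1 : R * τ ≤ GG τ a b := by linarith [GG_ge hτ hR hb0]
  have hG : 0 < GG τ a b := lt_of_lt_of_le (by positivity) h1
  have h2 := GG_ge2 hτ ha hb
  have h3 : (GG τ a b) ^ (-m) ≤ (R * τ) ^ (-m) :=
    Real.rpow_le_rpow_of_nonpos (by positivity) h1 (by linarith)
  have h4 : (GG τ a b) ^ (-(1:ℝ)) ≤ ((1 + τ) * (1 + c * τ)) ^ (-(1:ℝ)) :=
    Real.rpow_le_rpow_of_nonpos (by positivity) h2 (by norm_num)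
  have h5 : (GG τ a b) ^ (-m-1) ≤ (R * τ) ^ (-m) * ((1 + τ) * (1 + c * τ)) ^ (-(1:ℝ)) := by
    rw [sub_eq_add_neg, Real.rpow_add hG]
    exact mul_le_mul h3 h4 (by positivity) (by positivity)
  calc _ ≤ τ ^ (α - 1) * ((τ + τ^2) * ((R * τ) ^ (-m) * ((1 + τ) * (1 + c * τ)) ^ (-(1:ℝ)))) := by
        gcongr
    _ = _ := by
      rw [Real.mul_rpow hR0.le hτ.le, Real.rpow_neg_one, Real.rpow_neg_one,
        show α + 1 - m - 1 = (α - 1) + 1 + (-m) by ring, Real.rpow_add hτ, Real.rpow_add_one hτ.ne']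
      have : 1 + c * τ ≠ 0 := by positivity
      field_simp

lemma FF_int {m α a b : ℝ} (hm : 0 < m) (hα : 0 < α) (hαm : α < m) (ha : 0 ≤ a) (hb : 0 < b) :
    IntegrableOn (fun τ => τ ^ (α - 1) * (GG τ a b) ^ (-m)) (Ioi 0) := by
  refine Integrable.mono' (base_scale (R := 1 + a + b) hα hαm (by positivity)).1
    (Measurable.aestronglyMeasurable (by unfold GG; fun_prop)) ?_
  filter_upwards [ae_restrict_mem measurableSet_Ioi] with τ hτ
  have h0 : 0 < τ := hτ
  have hG : 0 < GG τ a b := by unfold GG; positivity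
  rw [Real.norm_of_nonneg (by positivity)]
  exact F_pt hm h0 (by positivity) le_rfl hb.le

lemma FF_bd {m α a b : ℝ} (hm : 0 < m) (hα : 0 < α) (hαm : α < m) (ha : 0 ≤ a) (hb : 0 < b) :
    0 ≤ FF m α a b ∧ FF m α a b ≤ Jint α m * (1 + a + b) ^ (-α) := by
  constructor
  · refine setIntegral_nonneg measurableSet_Ioi fun τ hτ => ?_
    have h0 : 0 < τ := hτ
    have hG : 0 < GG τ a b := by unfold GG; positivity
    positivity
  · have := base_scale (R := 1 + a + b) hα hαm (by positivity)
    rw [mul_comm, ← this.2]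
    exact setIntegral_mono_on (FF_int hm hα hαm ha hb) this.1 measurableSet_Ioi
      fun τ hτ => F_pt hm hτ (by positivity) le_rfl hb.le

lemma FF_da {m α a b : ℝ} (hm : 0 < m) (hα : 0 < α) (hαm : α < m) (ha : 0 ≤ a) (hb : 0 < b) :
    HasDerivAt (fun a' => FF m α a' b) (-m * FA m α a b) a ∧
    0 ≤ FA m α a b ∧ FA m α a b ≤ Jint (α+1) (m+1) * (1 + a + b) ^ (-(α+1)) := by
  have key := hasDerivAt_integral_of_dominated_loc_of_deriv_le (μ := volume.restrict (Ioi (0:ℝ)))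
    (F := fun a' τ => τ ^ (α - 1) * (GG τ a' b) ^ (-m)) (x₀ := a) (s := Ioi (-(1/2)))
    (F' := fun a' τ => (-m) * (τ ^ (α - 1) * (τ * (GG τ a' b) ^ (-m-1))))
    (bound := fun τ => m * (τ ^ ((α + 1) - 1) * (1 + (1/2) * τ) ^ (-(m+1))))
    (Ioi_mem_nhds (by linarith))
    (Eventually.of_forall fun a' => Measurable.aestronglyMeasurable (by unfold GG; fun_prop))
    (FF_int hm hα hαm ha hb)
    (Measurable.aestronglyMeasurable (by unfold GG; fun_prop))
    (by
      filter_upwards [ae_restrict_mem measurableSet_Ioi] with τ hτ a' ha'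
      have h0 : 0 < τ := hτ
      have ha2 : -(1/2) < a' := ha'
      have hG : 0 < GG τ a' b :=
        lt_of_lt_of_le (by positivity) (GG_ge (R := 1/2) h0 (by linarith) hb.le)
      rw [norm_mul, norm_neg, Real.norm_of_nonneg hm.le, Real.norm_of_nonneg (by positivity)]
      exact mul_le_mul_of_nonneg_left (FA_pt hm h0 (by norm_num) (by linarith) hb.le) hm.le)
    ((base_scale (by linarith) (by linarith) (by norm_num)).1.const_mul m)
    (by
      filter_upwards [ae_restrict_mem measurableSet_Ioi] with τ hτ a' ha'
      have h0 : 0 < τ := hτ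
      have ha2 : -(1/2) < a' := ha'
      have hG : 0 < GG τ a' b :=
        lt_of_lt_of_le (by positivity) (GG_ge (R := 1/2) h0 (by linarith) hb.le)
      have hd : HasDerivAt (fun a' => GG τ a' b) τ a' := by
        unfold GG
        have := ((((hasDerivAt_id a').const_add 1).const_mul τ).const_add 1).add_const
          (b * (τ + τ^2))
        simpa using this
      have := (hd.rpow_const (p := -m) (Or.inl hG.ne')).const_mul (τ ^ (α - 1))
      exact this.congr_deriv (by ring))
  refine ⟨?_, ?_, ?_⟩
  · have := key.2
    rw [integral_const_mul] at this
    exact this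
  · refine setIntegral_nonneg measurableSet_Ioi fun τ hτ => ?_
    have h0 : 0 < τ := hτ
    have hG : 0 < GG τ a b := by unfold GG; positivity
    positivity
  · have := base_scale (p := α+1) (q := m+1) (R := 1 + a + b) (by linarith) (by linarith)
      (by positivity)
    rw [mul_comm, ← this.2]
    have hI : IntegrableOn (fun τ => τ ^ (α - 1) * (τ * (GG τ a b) ^ (-m-1))) (Ioi 0) := by
      have h := key.1.const_mul ((-m)⁻¹)
      refine h.congr (Eventually.of_forall fun τ => ?_)
      simp only []
      field_simp
    exact setIntegral_mono_on hI this.1 measurableSet_Ioi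
      fun τ hτ => FA_pt hm hτ (by positivity) le_rfl hb.le

lemma FF_db {m α a b : ℝ} (hm : 0 < m) (hα : 0 < α) (hαm : α < m) (hαm1 : m < α + 1)
    (ha : 0 ≤ a) (hb : 0 < b) :
    HasDerivAt (fun b' => FF m α a b') (-m * FB m α a b) b ∧
    0 ≤ FB m α a b ∧ FB m α a b ≤ Jint (α+1-m) 1 * ((1 + a + b) ^ (-m) * b ^ (-(α+1-m))) := by
  have key := hasDerivAt_integral_of_dominated_loc_of_deriv_le (μ := volume.restrict (Ioi (0:ℝ)))
    (F := fun b' τ => τ ^ (α - 1) * (GG τ a b') ^ (-m)) (x₀ := b) (s := Ioi (b/2))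
    (F' := fun b' τ => (-m) * (τ ^ (α - 1) * ((τ + τ^2) * (GG τ a b') ^ (-m-1))))
    (bound := fun τ => m * ((1:ℝ) ^ (-m) *
      (τ ^ ((α + 1 - m) - 1) * (1 + (b/2) * τ) ^ (-(1:ℝ)))))
    (Ioi_mem_nhds (by linarith))
    (Eventually.of_forall fun a' => Measurable.aestronglyMeasurable (by unfold GG; fun_prop))
    (FF_int hm hα hαm ha hb)
    (Measurable.aestronglyMeasurable (by unfold GG; fun_prop))
    (by
      filter_upwards [ae_restrict_mem measurableSet_Ioi] with τ hτ b' hb'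
      have h0 : 0 < τ := hτ
      have hb2 : b/2 < b' := hb'
      have hb3 : 0 < b' := by linarith
      have hG : 0 < GG τ a b' := by unfold GG; positivity
      rw [norm_mul, norm_neg, Real.norm_of_nonneg hm.le, Real.norm_of_nonneg (by positivity)]
      exact mul_le_mul_of_nonneg_left (FB_pt hm h0 (by norm_num) (by linarith) ha (by linarith)
        hb2.le) hm.le)
    (((base_scale (by linarith) (by linarith) (by linarith)).1.const_mul _).const_mul m)
    (by
      filter_upwards [ae_restrict_mem measurableSet_Ioi] with τ hτ b' hb'
      have h0 : 0 < τ := hτ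
      have hb2 : b/2 < b' := hb'
      have hb3 : 0 < b' := by linarith
      have hG : 0 < GG τ a b' := by unfold GG; positivity
      have hd : HasDerivAt (fun b' => GG τ a b') (τ + τ^2) b' := by
        unfold GG
        have := ((hasDerivAt_id b').mul_const (τ + τ^2)).const_add (1 + τ * (1 + a))
        simpa using this
      have := (hd.rpow_const (p := -m) (Or.inl hG.ne')).const_mul (τ ^ (α - 1))
      exact this.congr_deriv (by ring))
  refine ⟨?_, ?_, ?_⟩
  · have := key.2
    rw [integral_const_mul] at this
    exact this
  · refine setIntegral_nonneg measurableSet_Ioi fun τ hτ => ?_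
    have h0 : 0 < τ := hτ
    have hG : 0 < GG τ a b := by unfold GG; positivity
    positivity
  · have := base_scale (p := α+1-m) (q := 1) (R := b) (by linarith) (by linarith) hb
    have e : Jint (α+1-m) 1 * ((1 + a + b) ^ (-m) * b ^ (-(α+1-m))) =
      (1 + a + b) ^ (-m) * (b ^ (-(α+1-m)) * Jint (α+1-m) 1) := by ring
    rw [e, ← this.2, ← integral_const_mul]
    have hI : IntegrableOn (fun τ => τ ^ (α - 1) * ((τ + τ^2) * (GG τ a b) ^ (-m-1))) (Ioi 0) := by
      have h := key.1.const_mul ((-m)⁻¹)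
      refine h.congr (Eventually.of_forall fun τ => ?_)
      simp only []
      field_simp
    exact setIntegral_mono_on hI (this.1.const_mul _) measurableSet_Ioi
      fun τ hτ => FB_pt hm hτ (by positivity) le_rfl ha hb le_rfl


lemma wEps_rep (n : ℕ) (hn : 1 ≤ n) (s : ℝ) (hs : s ∈ Ioo (0:ℝ) 1) (hns : 2 * s < (n:ℝ))
    (cns ε : ℝ) (hε : 0 < ε) (x : Euc n) (y : ℝ) (hy : 0 < y) :
    wEps n s cns ε x y = (cns * cnk n n / Jint ((n - 2*s)/2) n) * ε ^ (-(((n:ℝ) - 2*s)/2)) *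
      FF ((n:ℝ)/2) (((n:ℝ) - 2*s)/2) (‖x‖^2 / ε^2) (y^2 / ε^2) := by
  unfold wEps
  rw [w1_rep n hn s hs hns cns _ _ (div_pos hy hε)]
  unfold FF
  rw [norm_smul, Real.norm_of_nonneg (by positivity), mul_pow, inv_pow, div_pow,
    show (2 * s - (n:ℝ)) / 2 = -(((n:ℝ) - 2*s)/2) by ring,
    show (ε^2)⁻¹ * ‖x‖^2 = ‖x‖^2 / ε^2 by ring]
  ring

lemma eps_pow (ε Q e a : ℝ) (hε : 0 < ε) (hQ : 0 < Q) :
    (1 + (a / ε^2) + (Q - ε^2 - a) / ε^2) ^ (-e) = ε ^ (2 * e) * Q ^ (-e) := by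
  have : 1 + (a / ε^2) + (Q - ε^2 - a) / ε^2 = Q / ε^2 := by field_simp; ring
  rw [this, Real.div_rpow hQ.le (by positivity), Real.rpow_neg (by positivity : (0:ℝ) ≤ ε^2),
    ← Real.rpow_natCast, ← Real.rpow_mul hε.le]
  push_cast
  field_simp

lemma wEps_data (n : ℕ) (hn : 1 ≤ n) (s : ℝ) (hs : s ∈ Ioo (0:ℝ) 1) (hns : 2 * s < (n:ℝ))
    (cns : ℝ) : ∃ C > (0:ℝ), ∀ ε : ℝ, 0 < ε → ∀ (x : Euc n) (y : ℝ), 0 < y →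
    ∃ g h : ℝ, HasFDerivAt (fun x' => wEps n s cns ε x' y) ((-g) • innerSL ℝ x) x ∧
      HasDerivAt (fun y' => wEps n s cns ε x y') h y ∧
      |wEps n s cns ε x y| ≤ C * (ε ^ (((n:ℝ) - 2*s)/2) * (ε^2 + ‖x‖^2 + y^2) ^ (-(((n:ℝ) - 2*s)/2))) ∧
      |g| ≤ C * (ε ^ (((n:ℝ) - 2*s)/2) * (ε^2 + ‖x‖^2 + y^2) ^ (-(((n:ℝ) - 2*s)/2 + 1))) ∧
      |h| ≤ C * (ε ^ (((n:ℝ) - 2*s)/2) * (y ^ (2*s-1) * (ε^2 + ‖x‖^2 + y^2) ^ (-((n:ℝ)/2)))) := by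
  have hn' : (1:ℝ) ≤ n := by exact_mod_cast hn
  have hrep := fun ε hε x y hy => wEps_rep n hn s hs hns cns ε hε x y hy
  obtain ⟨hs0, hs1⟩ := hs
  set κ := (cns * cnk n n / Jint ((n - 2*s)/2) n) with hκ
  set α : ℝ := ((n:ℝ) - 2*s)/2 with hα
  set m : ℝ := (n:ℝ)/2 with hm
  have hm0 : 0 < m := by rw [hm]; linarith
  have hα0 : 0 < α := by rw [hα]; linarith
  have hαm : α < m := by rw [hα, hm]; linarith
  have hαm1 : m < α + 1 := by rw [hα, hm]; linarith
  have j1 := Jint_pos hα0 hαm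
  have j2 := Jint_pos (p := α+1) (q := m+1) (by linarith) (by linarith)
  have j3 := Jint_pos (p := α+1-m) (q := 1) (by linarith) (by linarith)
  set J1 := Jint α m
  set J2 := Jint (α+1) (m+1)
  set J3 := Jint (α+1-m) 1
  refine ⟨|κ| * (J1 + 2 * m * J2 + 2 * m * J3) + 1, by positivity, ?_⟩
  intro ε hε x y hy
  set a := ‖x‖^2 / ε^2 with ha
  set b := y^2 / ε^2 with hb
  set Q := ε^2 + ‖x‖^2 + y^2 with hQ
  have ha0 : 0 ≤ a := by positivity
  have hb0 : 0 < b := by positivity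
  have hQ0 : 0 < Q := by positivity
  have hpow : ∀ e : ℝ, (1 + a + b) ^ (-e) = ε ^ (2*e) * Q ^ (-e) := by
    intro e
    rw [← eps_pow ε Q e (‖x‖^2) hε hQ0, hb, show Q - ε^2 - ‖x‖^2 = y^2 by rw [hQ]; ring]
  obtain ⟨f0, f1⟩ := FF_bd hm0 hα0 hαm ha0 hb0
  obtain ⟨d1, g0, g1⟩ := FF_da hm0 hα0 hαm ha0 hb0
  obtain ⟨d2, h0, h1⟩ := FF_db hm0 hα0 hαm hαm1 ha0 hb0
  rw [hpow] at f1 g1 h1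
  refine ⟨2 * κ * ε ^ (-α) * m * FA m α a b / ε^2, -(2 * κ * ε ^ (-α) * m * FB m α a b * y / ε^2),
    ?_, ?_, ?_, ?_, ?_⟩
  · have e : (fun x' : Euc n => wEps n s cns ε x' y) = fun x' : Euc n =>
      (κ * ε ^ (-α)) * FF m α (‖x'‖^2 / ε^2) b := by
      ext x'; rw [hrep ε hε x' y hy]
    rw [e]
    have hnorm : HasFDerivAt (fun x' : Euc n => ‖x'‖^2 / ε^2) ((ε^2)⁻¹ • (2 • innerSL ℝ x)) x := by
      have := (hasStrictFDerivAt_norm_sq x).hasFDerivAt.const_mul ((ε^2)⁻¹)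
      refine this.congr_of_eventuallyEq (Eventually.of_forall fun z => ?_)
      simp only []; ring
    have := (d1.comp_hasFDerivAt x hnorm).const_mul (κ * ε ^ (-α))
    refine this.congr_fderiv ?_
    ext v
    simp
    field_simp
  · have e : (fun y' : ℝ => wEps n s cns ε x y') =ᶠ[𝓝 y] fun y' : ℝ =>
      (κ * ε ^ (-α)) * FF m α a (y'^2 / ε^2) := by
      filter_upwards [Ioi_mem_nhds hy] with y' hy'
      rw [hrep ε hε x y' hy']
    have hsq : HasDerivAt (fun y' : ℝ => y'^2 / ε^2) (2 * y / ε^2) y := by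
      have := (hasDerivAt_pow 2 y).div_const (ε^2)
      simpa using this
    have := (d2.comp y hsq).const_mul (κ * ε ^ (-α))
    refine (this.congr_of_eventuallyEq e).congr_deriv ?_
    ring
  · rw [hrep ε hε x y hy, abs_mul, abs_mul, abs_of_nonneg f0, abs_of_pos (by positivity : 0 < ε ^ (-α))]
    have e : ε ^ (-α) * ε ^ (2 * α) = ε ^ α := by rw [← Real.rpow_add hε]; congr 1; ring
    calc |κ| * ε ^ (-α) * FF m α a b ≤ |κ| * ε ^ (-α) * (J1 * (ε ^ (2 * α) * Q ^ (-α))) := by gcongr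
      _ = (|κ| * J1) * ((ε ^ (-α) * ε ^ (2 * α)) * Q ^ (-α)) := by ring
      _ ≤ _ := by
        rw [e]
        refine mul_le_mul_of_nonneg_right ?_ (by positivity)
        have : 0 ≤ |κ| * (2 * m * J2 + 2 * m * J3) := by positivity
        linarith
  · rw [abs_div, abs_mul, abs_mul, abs_mul, abs_mul, abs_of_nonneg g0, abs_of_pos (by positivity : 0 < ε ^ (-α)),
      abs_of_pos hm0, abs_of_pos (by positivity : 0 < ε^2), abs_two]
    have e : ε ^ (-α) * ε ^ (2 * (α + 1)) / ε^2 = ε ^ α := by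
      rw [← Real.rpow_add hε, ← Real.rpow_natCast ε 2, ← Real.rpow_sub hε]; congr 1; push_cast; ring
    calc 2 * |κ| * ε ^ (-α) * m * FA m α a b / ε^2
        ≤ 2 * |κ| * ε ^ (-α) * m * (J2 * (ε ^ (2 * (α+1)) * Q ^ (-(α+1)))) / ε^2 := by gcongr
      _ = (|κ| * (2 * m * J2)) * ((ε ^ (-α) * ε ^ (2 * (α+1)) / ε^2) * Q ^ (-(α+1))) := by ring
      _ ≤ _ := by
        rw [e]
        refine mul_le_mul_of_nonneg_right ?_ (by positivity)
        have : 0 ≤ |κ| * (J1 + 2 * m * J3) := by positivity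
        linarith
  · rw [abs_neg, abs_div, abs_mul, abs_mul, abs_mul, abs_mul, abs_mul, abs_of_nonneg h0, abs_of_pos (by positivity : 0 < ε ^ (-α)),
      abs_of_pos hm0, abs_of_pos (by positivity : 0 < ε^2), abs_two, abs_of_pos hy]
    have e : ε ^ (-α) * ε ^ (2 * m) * (b ^ (-(α+1-m)) * y) / ε^2 = ε ^ α * y ^ (2*s-1) := by
      have : b ^ (-(α+1-m)) = y ^ (2*s-2) * ε ^ (2 - 2*s) := by
        rw [hb, ← div_pow, ← Real.rpow_natCast, ← Real.rpow_mul (by positivity),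
          Real.div_rpow hy.le hε.le, div_eq_mul_inv, ← Real.rpow_neg hε.le]
        congr 2 <;> (rw [hα, hm]; push_cast; ring)
      rw [this, show 2*s-1 = (2*s-2) + 1 by ring, Real.rpow_add_one hy.ne']
      have e3 : ε ^ (-α) * ε ^ (2 * m) * ε ^ (2-2*s) / ε^2 = ε ^ α := by
        rw [← Real.rpow_add hε, ← Real.rpow_add hε, ← Real.rpow_natCast ε 2, ← Real.rpow_sub hε]
        congr 1; rw [hα, hm]; push_cast; ring
      rw [← e3]; ring
    calc 2 * |κ| * ε ^ (-α) * m * FB m α a b * y / ε^2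
        ≤ 2 * |κ| * ε ^ (-α) * m * (J3 * (ε ^ (2 * m) * Q ^ (-m) * b ^ (-(α+1-m)))) * y / ε^2 := by gcongr
      _ = (|κ| * (2 * m * J3)) * ((ε ^ (-α) * ε ^ (2 * m) * (b ^ (-(α+1-m)) * y) / ε^2) * Q ^ (-m)) := by ring
      _ ≤ _ := by
        rw [e]
        have : 0 ≤ |κ| * (J1 + 2 * m * J2) := by positivity
        rw [mul_assoc (ε ^ α)]
        refine mul_le_mul_of_nonneg_right ?_ (by positivity)
        linarith


lemma cut_data (n : ℕ) (φ : ℝ → ℝ) (hφsm : ContDiff ℝ (⊤ : ℕ∞) φ)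
    (hφrange : ∀ t ≥ (0:ℝ), φ t ∈ Icc (0:ℝ) 1)
    (hφ1 : ∀ t ∈ Icc (0:ℝ) (1/2), φ t = 1) (hφ0 : ∀ t ≥ (1:ℝ), φ t = 0)
    (r : ℝ) (hr : 0 < r) :
    ∃ KD > (0:ℝ), ∀ (x : Euc n) (y : ℝ), 0 < y → ∃ D P : ℝ,
      P = φ (Real.sqrt (‖x‖ ^ 2 + y ^ 2) / r) ∧ 0 ≤ P ∧ P ≤ 1 ∧
      HasFDerivAt (fun x' : Euc n => φ (Real.sqrt (‖x'‖ ^ 2 + y ^ 2) / r)) (D • innerSL ℝ x) x ∧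
      HasDerivAt (fun y' : ℝ => φ (Real.sqrt (‖x‖ ^ 2 + y' ^ 2) / r)) (D * y) y ∧
      |D| ≤ KD ∧ (‖x‖^2 + y^2 < r^2/4 → D = 0) ∧ (r^2 ≤ ‖x‖^2 + y^2 → D = 0 ∧ P = 0) := by
  have hcd : Continuous (deriv φ) := hφsm.continuous_deriv (by simp)
  obtain ⟨B, hB⟩ := isCompact_Icc.exists_bound_of_continuousOn (s := Icc (0:ℝ) 1) hcd.continuousOn
  refine ⟨2 * |B| / r^2 + 1, by positivity, ?_⟩
  intro x y hy
  set q := ‖x‖^2 + y^2 with hq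
  have hq0 : 0 < q := by positivity
  set z := Real.sqrt q with hz
  have hz0 : 0 < z := Real.sqrt_pos.2 hq0
  have hz2 : z^2 = q := Real.sq_sqrt hq0.le
  have hdφ : HasDerivAt φ (deriv φ (z / r)) (z / r) :=
    (hφsm.differentiable (by simp) _).hasDerivAt
  have hsmall : q < r^2/4 → deriv φ (z/r) = 0 := by
    intro h
    have h1 : z < r/2 := by nlinarith
    have h2 : z / r < 1/2 := by rw [div_lt_iff₀ hr]; linarith
    have : φ =ᶠ[𝓝 (z/r)] fun _ => (1:ℝ) := by
      filter_upwards [Ioo_mem_nhds (div_pos hz0 hr) h2] with t ht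
      exact hφ1 t ⟨ht.1.le, ht.2.le⟩
    rw [this.deriv_eq]; simp
  have hbig : r^2 ≤ q → 1 ≤ z / r := by
    intro h
    rw [le_div_iff₀ hr]; nlinarith
  have hbig' : r^2 ≤ q → deriv φ (z/r) = 0 := by
    intro h
    have h1 := hbig h
    have : IsLocalMin φ (z/r) := by
      filter_upwards [Ioi_mem_nhds (div_pos hz0 hr)] with t ht
      rw [hφ0 _ h1]
      exact (hφrange t (le_of_lt ht)).1
    exact this.deriv_eq_zero
  have hP := hφrange (z/r) (by positivity)
  refine ⟨deriv φ (z/r) / (r * z), φ (z/r), rfl, hP.1, hP.2, ?_, ?_, ?_, ?_, ?_⟩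
  · have h1 : HasFDerivAt (fun x' : Euc n => ‖x'‖^2 + y^2) (2 • innerSL ℝ x) x :=
      (hasStrictFDerivAt_norm_sq x).hasFDerivAt.add_const _
    have h2 := (h1.sqrt hq0.ne').const_mul (r⁻¹)
    have h3 : HasFDerivAt (fun x' : Euc n => Real.sqrt (‖x'‖^2 + y^2) / r)
        (r⁻¹ • (1 / (2 * z)) • 2 • innerSL ℝ x) x := by
      refine h2.congr_of_eventuallyEq (Eventually.of_forall fun t => ?_)
      simp only []; ring
    have h4 := hdφ.comp_hasFDerivAt x h3
    refine h4.congr_fderiv ?_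
    ext v
    simp
    field_simp
  · have h1 : HasDerivAt (fun y' : ℝ => ‖x‖^2 + y'^2) (2 * y) y := by
      simpa using (hasDerivAt_pow 2 y).const_add (‖x‖^2)
    have h2 := (h1.sqrt hq0.ne').div_const r
    have h4 := hdφ.comp y h2
    refine h4.congr_deriv ?_
    rw [← hq, ← hz]
    field_simp
  · by_cases h1 : q < r^2/4
    · rw [hsmall h1]; simp; positivity
    by_cases h2 : r^2 ≤ q
    · rw [hbig' h2]; simp; positivity
    push Not at h1 h2
    have hz1 : r/2 ≤ z := by nlinarith
    have hz3 : z / r ≤ 1 := by rw [div_le_one hr]; nlinarith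
    have h5 : |deriv φ (z/r)| ≤ |B| := (hB _ ⟨by positivity, hz3⟩).trans (le_abs_self _)
    rw [abs_div, abs_of_pos (by positivity : 0 < r * z)]
    have : |deriv φ (z/r)| / (r * z) ≤ |B| / (r * (r/2)) := by gcongr
    have e : |B| / (r * (r/2)) = 2 * |B| / r^2 := by field_simp
    linarith
  · intro h; rw [hsmall h]; simp
  · intro h; rw [hbig' h]; exact ⟨by simp, hφ0 _ (hbig h)⟩

lemma pure_ineq {P w g h D X y C0s W : ℝ} (hP0 : 0 ≤ P) (hP1 : P ≤ 1) (hX : 0 ≤ X) (hy : 0 ≤ y)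
    (hC : 0 ≤ C0s) (hW : W = |w * D|) :
    (w * D - P * g)^2 * X^2 + C0s * ((w * D - P * g)^2 * X^2) + (P * h + w * D * y)^2 ≤
      g^2 * X^2 + h^2 + (2 * C0s * (g^2 * X^2) + X^2 * (2 * (W * |g|) + W^2) + 2 * C0s * X^2 * W^2
        + 2 * (W * |h|) * y + W^2 * y^2) := by
  have hW2 : W^2 = (w*D)^2 := by rw [hW, sq_abs]
  have hW0 : 0 ≤ W := by rw [hW]; positivity
  have hPg : (P * g)^2 ≤ g^2 := by
    rw [mul_pow]; exact mul_le_of_le_one_left (by positivity) (by nlinarith)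
  have hPh : (P * h)^2 ≤ h^2 := by
    rw [mul_pow]; exact mul_le_of_le_one_left (by positivity) (by nlinarith)
  have h1 : -(w * D * (P * g)) ≤ W * |g| := by
    refine (neg_le_abs _).trans ?_
    rw [abs_mul, ← hW, abs_mul, abs_of_nonneg hP0]
    exact mul_le_mul_of_nonneg_left (mul_le_of_le_one_left (abs_nonneg _) hP1) hW0
  have h2 : w * D * (P * h) ≤ W * |h| := by
    refine (le_abs_self _).trans ?_
    rw [abs_mul, ← hW, abs_mul, abs_of_nonneg hP0]
    exact mul_le_mul_of_nonneg_left (mul_le_of_le_one_left (abs_nonneg _) hP1) hW0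
  have a1 : (w * D - P * g)^2 ≤ g^2 + (2 * (W * |g|) + W^2) := by
    nlinarith
  have a2 : (w * D - P * g)^2 ≤ 2 * g^2 + 2 * W^2 := by
    nlinarith [sq_nonneg (w * D + P * g)]
  have a3 : (P * h + w * D * y)^2 ≤ h^2 + (2 * (W * |h|) * y + W^2 * y^2) := by
    have := mul_le_mul_of_nonneg_right h2 hy
    nlinarith
  have b1 := mul_le_mul_of_nonneg_right a1 (sq_nonneg X)
  have b2 := mul_le_mul_of_nonneg_left (mul_le_mul_of_nonneg_right a2 (sq_nonneg X)) hC
  linarith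


set_option maxHeartbeats 1000000 in
lemma pt_main
    (n : ℕ) (hn : 1 ≤ n) (s : ℝ) (hs : s ∈ Ioo (0:ℝ) 1) (hns : 2 * s < (n:ℝ))
    (cns : ℝ) (Ω : Set (Euc n))
    (A : Euc n → Matrix (Fin n) (Fin n) ℝ)
    (C₀ σ r₁ : ℝ) (hC₀ : 0 < C₀) (hσ : 0 < σ)
    (hA_ub : ∀ x ∈ Ω, ‖x‖ < r₁ → ∀ v : Euc n,
      (∑ i, ∑ j, A x i j * v i * v j) ≤ ‖v‖ ^ 2 + C₀ * ‖x‖ ^ σ * ‖v‖ ^ 2)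
    (φ : ℝ → ℝ) (hφsm : ContDiff ℝ (⊤ : ℕ∞) φ)
    (hφrange : ∀ t ≥ (0:ℝ), φ t ∈ Icc (0:ℝ) 1)
    (hφ1 : ∀ t ∈ Icc (0:ℝ) (1/2), φ t = 1) (hφ0 : ∀ t ≥ (1:ℝ), φ t = 0)
    (r : ℝ) (hr : 0 < r) (hrr₁ : r < r₁) (σ' : ℝ) (hσ' : σ' ≤ σ) :
    ∃ K > (0:ℝ), ∀ ε : ℝ, 0 < ε → ε < r → ∀ x ∈ Ω, ∀ y : ℝ, 0 < y →
      (r^2 ≤ ‖x‖^2 + y^2 → quadB n (A x)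
              (fun x y => φ (Real.sqrt (‖x‖ ^ 2 + y ^ 2) / r) * wEps n s cns ε x y) x y = 0) ∧
      (‖x‖^2 + y^2 < r^2 → y ^ (1 - 2*s) * quadB n (A x)
              (fun x y => φ (Real.sqrt (‖x‖ ^ 2 + y ^ 2) / r) * wEps n s cns ε x y) x y ≤
          y ^ (1 - 2*s) * ((∑ i, (pdX n (wEps n s cns ε) i x y) ^ 2)
                + (pdY n (wEps n s cns ε) x y) ^ 2) +
          K * ε ^ ((n:ℝ) - 2*s) *
            (y ^ (1 - 2*s) * (ε^2 + ‖x‖^2 + y^2) ^ (-((n:ℝ) - 2*s + 1 - σ'/2)) +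
              (y ^ (1 - 2*s) + 1))) := by
  obtain ⟨C, hC, hw⟩ := wEps_data n hn s hs hns cns
  obtain ⟨KD, hKD, hcut⟩ := cut_data n φ hφsm hφrange hφ1 hφ0 r hr
  obtain ⟨hs0, hs1⟩ := hs
  set α : ℝ := ((n:ℝ) - 2*s)/2 with hα
  set m : ℝ := (n:ℝ)/2 with hm
  have hm0 : 0 < m := by rw [hm]; linarith
  have hα0 : 0 < α := by rw [hα]; linarith
  set c : ℝ := r^2/4 with hc
  have hc0 : 0 < c := by positivity
  set C1 := C * KD * c ^ (-α) with hC1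
  set K2 := C1 * (C * c ^ (-(α+1))) with hK2
  set K3 := C1 * (C * c ^ (-m)) with hK3
  have hC10 : 0 < C1 := by positivity
  have hK20 : 0 < K2 := by positivity
  have hK30 : 0 < K3 := by positivity
  set Lc : ℝ := (3 * r^2) ^ ((σ - σ')/2) with hLc
  have hL0 : 0 < Lc := by positivity
  set k1 := 2 * C₀ * C^2 * Lc with hk1
  set k2 := r^2 * (2 * K2 + C1^2) + 2 * C₀ * r ^ σ * r^2 * C1^2 + C1^2 * r^2 with hk2
  set k3 := 2 * K3 * r with hk3
  have hk10 : 0 < k1 := by positivity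
  have hk20 : 0 < k2 := by positivity
  have hk30 : 0 < k3 := by positivity
  refine ⟨k1 + k2 + k3, by positivity, ?_⟩
  intro ε hε hεr x hx y hy
  obtain ⟨g, h, hg1, hh1, bw, bg, bh⟩ := hw ε hε x y hy
  obtain ⟨D, P, hPdef, hP0, hP1, hD1, hD2, hDb, hDs, hDl⟩ := hcut x y hy
  set w := wEps n s cns ε x y with hwdef
  -- partial derivatives
  have hpx : ∀ i, pdX n (wEps n s cns ε) i x y = (-g) * x i := by
    intro i
    unfold pdX
    rw [hg1.fderiv]
    simp [EuclideanSpace.inner_single_right]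
  have hpy : pdY n (wEps n s cns ε) x y = h := hh1.deriv
  have hUx : ∀ i, pdX n (fun x y => φ (Real.sqrt (‖x‖ ^ 2 + y ^ 2) / r) * wEps n s cns ε x y) i x y
      = (w * D - P * g) * x i := by
    intro i
    unfold pdX
    have := (hD1.mul hg1).fderiv
    simp only [] at this ⊢
    erw [this]
    simp [EuclideanSpace.inner_single_right, ← hPdef, ← hwdef]
    ring
  have hUy : pdY n (fun x y => φ (Real.sqrt (‖x‖ ^ 2 + y ^ 2) / r) * wEps n s cns ε x y) x y
      = P * h + w * D * y := by
    have := (hD2.mul hh1).deriv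
    unfold pdY
    simp only [] at this ⊢
    erw [this]
    simp only [← hPdef, ← hwdef]
    ring
  constructor
  · intro hbig
    obtain ⟨h1, h2⟩ := hDl hbig
    unfold quadB quadA
    simp [hUx, hUy, h1, h2]
  · intro hlt
    set X := ‖x‖ with hX
    have hX0 : 0 ≤ X := norm_nonneg x
    have hXlt : X < r := lt_of_pow_lt_pow_left₀ 2 hr.le (by linarith [sq_nonneg y])
    have hyr : y ≤ r := (lt_of_pow_lt_pow_left₀ 2 hr.le (by linarith [sq_nonneg X])).le
    have hXr : X ≤ r := hXlt.le
    set Q := ε^2 + X^2 + y^2 with hQ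
    have hQ0 : 0 < Q := by positivity
    set E := ε ^ α with hE
    have hE0 : 0 < E := by positivity
    have hS : ε ^ ((n:ℝ) - 2*s) = E * E := by
      rw [hE, ← Real.rpow_add hε]; congr 1; rw [hα]; ring
    set Y := y ^ (1 - 2*s) with hY
    have hY0 : 0 < Y := by positivity
    have hYy : Y * y ^ (2*s-1) = 1 := by
      rw [hY, ← Real.rpow_add hy, show 1 - 2*s + (2*s-1) = 0 by ring, Real.rpow_zero]
    have hsum : ∑ i, (x i)^2 = X^2 := by rw [hX, EuclideanSpace.real_norm_sq_eq]
    -- quadB bound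
    have hqB : quadB n (A x)
              (fun x y => φ (Real.sqrt (‖x‖ ^ 2 + y ^ 2) / r) * wEps n s cns ε x y) x y ≤
        (w * D - P * g)^2 * X^2 + C₀ * X ^ σ * ((w * D - P * g)^2 * X^2) +
          (P * h + w * D * y)^2 := by
      unfold quadB quadA
      simp only [hUx, hUy]
      have := hA_ub x hx (by linarith) ((w * D - P * g) • x)
      rw [norm_smul, mul_pow, Real.norm_eq_abs, sq_abs] at this
      simpa using this
    have hgr : (∑ i, (pdX n (wEps n s cns ε) i x y) ^ 2) + (pdY n (wEps n s cns ε) x y) ^ 2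
        = g^2 * X^2 + h^2 := by
      simp only [hpx, hpy, mul_pow, neg_sq, ← Finset.mul_sum, hsum]
    rw [hgr]
    set W := |w * D| with hW
    have hpure := pure_ineq (P := P) (w := w) (g := g) (h := h) (D := D) (X := X) (y := y)
      (C0s := C₀ * X ^ σ) hP0 hP1 hX0 hy.le (by positivity) hW
    have hWb : W ≤ C1 * E ∧ W * |g| ≤ K2 * (E * E) ∧ W * |h| ≤ K3 * (E * E) * y ^ (2*s-1) := by
      by_cases hsm : X^2 + y^2 < r^2/4
      · have : W = 0 := by rw [hW, hDs hsm]; simp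
        rw [this]
        refine ⟨by positivity, ?_, ?_⟩ <;> (rw [zero_mul]; positivity)
      · push Not at hsm
        have hcQ : c ≤ Q := by rw [hc, hQ]; linarith [sq_nonneg ε]
        have q1 : ∀ e : ℝ, 0 ≤ e → Q ^ (-e) ≤ c ^ (-e) := fun e he =>
          Real.rpow_le_rpow_of_nonpos hc0 hcQ (by linarith)
        have w1 : W ≤ C1 * E := by
          rw [hW, abs_mul]
          calc |w| * |D| ≤ (C * (E * c ^ (-α))) * KD := by
                refine mul_le_mul (bw.trans ?_) hDb (abs_nonneg _) (by positivity)
                have := q1 α hα0.le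
                gcongr
            _ = C1 * E := by rw [hC1]; ring
        have g1 : |g| ≤ C * c ^ (-(α+1)) * E := by
          have := q1 (α+1) (by linarith)
          calc |g| ≤ _ := bg
            _ ≤ C * (E * c ^ (-(α+1))) := by gcongr
            _ = _ := by ring
        have h1 : |h| ≤ C * c ^ (-m) * E * y ^ (2*s-1) := by
          have := q1 m hm0.le
          calc |h| ≤ _ := bh
            _ ≤ C * (E * (y ^ (2*s-1) * c ^ (-m))) := by gcongr
            _ = _ := by ring
        refine ⟨w1, ?_, ?_⟩
        · calc W * |g| ≤ (C1 * E) * (C * c ^ (-(α+1)) * E) :=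
                mul_le_mul w1 g1 (abs_nonneg _) (by positivity)
            _ = _ := by rw [hK2]; ring
        · calc W * |h| ≤ (C1 * E) * (C * c ^ (-m) * E * y ^ (2*s-1)) :=
                mul_le_mul w1 h1 (abs_nonneg _) (by positivity)
            _ = _ := by rw [hK3]; ring
    obtain ⟨hW1, hW2, hW3⟩ := hWb
    have hW0 : 0 ≤ W := abs_nonneg _
    have hWsq : W^2 ≤ C1^2 * (E * E) := by
      calc W^2 ≤ (C1 * E)^2 := by gcongr
        _ = _ := by ring
    -- main term
    have hmain : X ^ σ * (g^2 * X^2) ≤ C^2 * Lc * ((E * E) * Q ^ (-((n:ℝ) - 2*s + 1 - σ'/2))) := by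
      have x1 : X^2 ≤ Q := by rw [hQ]; linarith [sq_nonneg ε, sq_nonneg y]
      have x2 : X ^ σ ≤ Q ^ (σ'/2) * Lc := by
        have e1 : X ^ σ = (X^2) ^ (σ/2) := by
          rw [← Real.rpow_natCast, ← Real.rpow_mul hX0]; congr 1; push_cast; ring
        have e2 : Q ^ (σ/2) = Q ^ (σ'/2) * Q ^ ((σ - σ')/2) := by
          rw [← Real.rpow_add hQ0]; congr 1; ring
        have hQ3 : Q ≤ 3 * r^2 := by
          have := pow_le_pow_left₀ hε.le hεr.le 2
          have := pow_pos hr 2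
          rw [hQ]; linarith
        rw [e1]
        calc (X^2) ^ (σ/2) ≤ Q ^ (σ/2) := Real.rpow_le_rpow (by positivity) x1 (by linarith)
          _ = _ := e2
          _ ≤ _ := by
            refine mul_le_mul_of_nonneg_left ?_ (by positivity)
            exact Real.rpow_le_rpow hQ0.le hQ3 (by linarith)
      have x3 : g^2 ≤ C^2 * (E * E) * (Q ^ (-(α+1)) * Q ^ (-(α+1))) := by
        rw [← sq_abs]
        calc |g|^2 ≤ (C * (E * Q ^ (-(α+1))))^2 := by gcongr
          _ = _ := by ring
      have e3 : Q ^ (-((n:ℝ) - 2*s + 1 - σ'/2)) =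
          Q ^ (σ'/2) * (Q ^ (-(α+1)) * Q ^ (-(α+1))) * Q := by
        rw [← Real.rpow_add hQ0, ← Real.rpow_add hQ0, ← Real.rpow_add_one hQ0.ne']
        congr 1; rw [hα]; ring
      rw [e3]
      calc X ^ σ * (g^2 * X^2) ≤ (Q ^ (σ'/2) * Lc) *
            ((C^2 * (E * E) * (Q ^ (-(α+1)) * Q ^ (-(α+1)))) * Q) := by gcongr
        _ = _ := by ring
    set QQ := Q ^ (-((n:ℝ) - 2*s + 1 - σ'/2)) with hQQ
    have hQQ0 : 0 < QQ := by positivity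
    have hXσ : X ^ σ ≤ r ^ σ := Real.rpow_le_rpow hX0 hXr hσ.le
    have t1 : 2 * (C₀ * X ^ σ) * (g^2 * X^2) ≤ k1 * ((E * E) * QQ) := by
      calc 2 * (C₀ * X ^ σ) * (g^2 * X^2) = 2 * C₀ * (X ^ σ * (g^2 * X^2)) := by ring
        _ ≤ 2 * C₀ * (C^2 * Lc * ((E * E) * QQ)) := by gcongr
        _ = _ := by rw [hk1]; ring
    have t2 : X^2 * (2 * (W * |g|) + W^2) ≤ r^2 * (2 * K2 + C1^2) * (E * E) := by
      calc X^2 * (2 * (W * |g|) + W^2) ≤ r^2 * (2 * (K2 * (E * E)) + C1^2 * (E * E)) := by gcongr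
        _ = _ := by ring
    have t3 : 2 * (C₀ * X ^ σ) * X^2 * W^2 ≤ 2 * C₀ * r ^ σ * r^2 * C1^2 * (E * E) := by
      calc 2 * (C₀ * X ^ σ) * X^2 * W^2 ≤ 2 * (C₀ * r ^ σ) * r^2 * (C1^2 * (E * E)) := by gcongr
        _ = _ := by ring
    have t4 : 2 * (W * |h|) * y ≤ k3 * (E * E) * y ^ (2*s-1) := by
      calc 2 * (W * |h|) * y ≤ 2 * (K3 * (E * E) * y ^ (2*s-1)) * r := by gcongr
        _ = _ := by rw [hk3]; ring
    have t5 : W^2 * y^2 ≤ C1^2 * r^2 * (E * E) := by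
      calc W^2 * y^2 ≤ (C1^2 * (E * E)) * r^2 := by gcongr
        _ = _ := by ring
    have htot : quadB n (A x)
              (fun x y => φ (Real.sqrt (‖x‖ ^ 2 + y ^ 2) / r) * wEps n s cns ε x y) x y ≤
        g^2 * X^2 + h^2 + (k1 * ((E * E) * QQ) + k2 * (E * E) + k3 * (E * E) * y ^ (2*s-1)) := by
      rw [hk2]
      linarith
    rw [hS]
    calc _ ≤ Y * (g^2 * X^2 + h^2 +
          (k1 * ((E * E) * QQ) + k2 * (E * E) + k3 * (E * E) * y ^ (2*s-1))) :=
          mul_le_mul_of_nonneg_left htot hY0.le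
      _ = Y * (g^2 * X^2 + h^2) + (k1 * (E * E) * (Y * QQ) + k2 * (E * E) * Y +
          k3 * (E * E) * (Y * y ^ (2*s-1))) := by ring
      _ ≤ _ := by
        rw [hYy]
        have p1 : 0 ≤ (k2 + k3) * (E * E) * (Y * QQ) := by positivity
        have p2 : 0 ≤ (k1 + k3) * (E * E) * Y := by positivity
        have p3 : 0 ≤ (k1 + k2) * (E * E) := by positivity
        linarith


def TT (s δ r ε : ℝ) : ℝ := ε ^ δ / (2 - 2*s) + ∫ y in ε..r, y ^ (δ - 1)

def EE (σ d ε : ℝ) : ℝ := if σ < d then ε ^ σ + ε ^ d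
               else if σ = d then ε ^ σ * Real.log (1/ε) + ε ^ d
               else ε ^ d

lemma EE_ge {σ d ε : ℝ} (hε : 0 < ε) (hε1 : ε < 1) : ε ^ d ≤ EE σ d ε := by
  unfold EE
  have h1 : 0 < ε ^ σ := by positivity
  have h2 : 0 ≤ Real.log (1/ε) := Real.log_nonneg (by rw [le_div_iff₀ hε]; linarith)
  split_ifs
  · linarith
  · have := mul_nonneg h1.le h2; linarith
  · exact le_rfl

lemma TT_nonneg {s δ r ε : ℝ} (hs : s < 1) (hε : 0 < ε) (hεr : ε < r) : 0 ≤ TT s δ r ε := by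
  unfold TT
  have h1 : 0 ≤ ∫ y in ε..r, y ^ (δ - 1) :=
    intervalIntegral.integral_nonneg hεr.le fun y hy => Real.rpow_nonneg (by linarith [hy.1]) _
  have : 0 < 2 - 2*s := by linarith
  positivity

lemma TT_EE (s σ d r : ℝ) (hs : s < 1) (hr : 0 < r) :
    ∃ C > (0:ℝ), ∀ ε : ℝ, 0 < ε → ε < 1 → ε < r →
      ε ^ d * TT s (min (σ - d) (1 - s)) r ε ≤ C * EE σ d ε := by
  have h2s : 0 < 2 - 2*s := by linarith
  rcases lt_trichotomy σ d with h | h | h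
  · have hδ : min (σ - d) (1 - s) = σ - d := min_eq_left (by linarith)
    have hdσ : 0 < d - σ := by linarith
    refine ⟨1/(2-2*s) + 1/(d - σ), by positivity, ?_⟩
    intro ε hε hε1 hεr
    rw [hδ]
    unfold TT
    rw [integral_rpow (Or.inr ⟨by intro h'; linarith, by
      rw [uIcc_of_le hεr.le]; intro h'; linarith [h'.1]⟩), show σ - d - 1 + 1 = σ - d by ring]
    unfold EE
    rw [if_pos h]
    have e : ε ^ d * ε ^ (σ - d) = ε ^ σ := by rw [← Real.rpow_add hε]; congr 1; ring
    have hr' : 0 < r ^ (σ - d) := by positivity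
    have e2 : (r ^ (σ - d) - ε ^ (σ - d)) / (σ - d) ≤ ε ^ (σ - d) / (d - σ) := by
      rw [← neg_div_neg_eq, neg_sub, neg_sub]
      gcongr; linarith
    have hd : 0 < ε ^ d := by positivity
    have hd' : 0 < ε ^ σ := by positivity
    calc _ ≤ ε ^ d * (ε ^ (σ - d) / (2 - 2*s) + ε ^ (σ - d) / (d - σ)) := by gcongr
      _ = (1/(2-2*s) + 1/(d - σ)) * (ε ^ d * ε ^ (σ - d)) := by ring
      _ ≤ _ := by rw [e]; gcongr; linarith
  · have hδ : min (σ - d) (1 - s) = 0 := by rw [h, sub_self]; exact min_eq_left (by linarith)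
    refine ⟨1/(2-2*s) + |Real.log r| + 1, by positivity, ?_⟩
    intro ε hε hε1 hεr
    rw [hδ]
    unfold TT EE
    rw [if_neg (by linarith), if_pos h]
    have e : ∫ y in ε..r, y ^ ((0:ℝ) - 1) = Real.log r + Real.log (1/ε) := by
      have : ∀ y : ℝ, y ^ ((0:ℝ) - 1) = y⁻¹ := by
        intro y; rw [zero_sub, Real.rpow_neg_one]
      simp_rw [this]
      rw [integral_inv_of_pos hε hr, Real.log_div hr.ne' hε.ne', one_div, Real.log_inv]; ring
    rw [e, h, Real.rpow_zero]
    have h2 : 0 ≤ Real.log (1/ε) := Real.log_nonneg (by rw [le_div_iff₀ hε]; linarith)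
    have h3 := le_abs_self (Real.log r)
    have hd : 0 < ε ^ d := by positivity
    have : 1 / (2 - 2*s) + (Real.log r + Real.log (1/ε)) ≤
        (1/(2-2*s) + |Real.log r| + 1) * (Real.log (1/ε) + 1) := by
      have h4 : 0 ≤ (1/(2-2*s) + |Real.log r|) * Real.log (1/ε) := by positivity
      linarith
    calc _ ≤ ε ^ d * ((1/(2-2*s) + |Real.log r| + 1) * (Real.log (1/ε) + 1)) := by gcongr
      _ = _ := by ring
  · set δ := min (σ - d) (1 - s) with hδ
    have hδ0 : 0 < δ := lt_min (by linarith) (by linarith)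
    refine ⟨1/(2-2*s) + r ^ δ / δ, by positivity, ?_⟩
    intro ε hε hε1 hεr
    unfold TT EE
    rw [if_neg (by linarith), if_neg (by linarith), integral_rpow (Or.inl (by linarith)),
      show δ - 1 + 1 = δ by ring]
    have h1 : ε ^ δ ≤ 1 := Real.rpow_le_one hε.le hε1.le hδ0.le
    have h2 : 0 < ε ^ δ := by positivity
    have hd : 0 < ε ^ d := by positivity
    rw [mul_comm]
    gcongr
    linarith

lemma y_lint (s δ r ε : ℝ) (hs : s ∈ Ioo (0:ℝ) 1) (hδ : δ ≤ 1 - s) (hε : 0 < ε) (hεr : ε < r) :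
    ∫⁻ y in Ioc 0 r, ENNReal.ofReal (y ^ (1 - 2*s) * (ε^2 + y^2) ^ (s - 1 + δ/2)) ≤
      ENNReal.ofReal (TT s δ r ε) := by
  obtain ⟨hs0, hs1⟩ := hs
  have he : s - 1 + δ/2 ≤ 0 := by linarith
  rw [← Ioc_union_Ioc_eq_Ioc hε.le hεr.le]
  refine (lintegral_union_le _ _ _).trans ?_
  unfold TT
  have h2s : 0 < 2 - 2*s := by linarith
  have hin : 0 ≤ ∫ y in ε..r, y ^ (δ - 1) :=
    intervalIntegral.integral_nonneg hεr.le fun y hy => Real.rpow_nonneg (by linarith [hy.1]) _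
  rw [ENNReal.ofReal_add (by positivity) hin]
  gcongr
  · have hI : IntervalIntegrable (fun y : ℝ => y ^ (1-2*s)) volume 0 ε :=
      intervalIntegral.intervalIntegrable_rpow' (by linarith)
    have hI2 := (intervalIntegrable_iff_integrableOn_Ioc_of_le hε.le).1 hI
    have e : ε ^ δ / (2-2*s) = ∫ y in Ioc 0 ε, y ^ (1-2*s) * (ε^2) ^ (s - 1 + δ/2) := by
      rw [integral_mul_const, ← intervalIntegral.integral_of_le hε.le,
        integral_rpow (Or.inl (by linarith)), Real.zero_rpow (by linarith), sub_zero,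
        show 1 - 2*s + 1 = 2 - 2*s by ring, div_mul_eq_mul_div, ← Real.rpow_natCast,
        ← Real.rpow_mul hε.le, ← Real.rpow_add hε]
      congr 2; push_cast; ring
    rw [e, ofReal_integral_eq_lintegral_ofReal]
    · refine setLIntegral_mono' measurableSet_Ioc fun y hy => ENNReal.ofReal_le_ofReal ?_
      have hy0 : 0 < y := hy.1
      refine mul_le_mul_of_nonneg_left ?_ (by positivity)
      exact Real.rpow_le_rpow_of_nonpos (by positivity) (by linarith [sq_nonneg y]) he
    · exact hI2.mul_const _
    · filter_upwards [ae_restrict_mem measurableSet_Ioc] with y hy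
      have hy0 : 0 < y := hy.1
      simp only [Pi.zero_apply]
      positivity
  · have hI : IntervalIntegrable (fun y : ℝ => y ^ (δ - 1)) volume ε r :=
      intervalIntegral.intervalIntegrable_rpow (Or.inr (by
        rw [uIcc_of_le hεr.le]; intro h'; linarith [h'.1]))
    have hI2 := (intervalIntegrable_iff_integrableOn_Ioc_of_le hεr.le).1 hI
    rw [intervalIntegral.integral_of_le hεr.le, ofReal_integral_eq_lintegral_ofReal]
    · refine setLIntegral_mono' measurableSet_Ioc fun y hy => ENNReal.ofReal_le_ofReal ?_
      have hy0 : 0 < y := hε.trans hy.1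
      have e : y ^ (δ - 1) = y ^ (1-2*s) * (y^2) ^ (s - 1 + δ/2) := by
        rw [← Real.rpow_natCast, ← Real.rpow_mul hy0.le, ← Real.rpow_add hy0]
        congr 1; push_cast; ring
      rw [e]
      refine mul_le_mul_of_nonneg_left ?_ (by positivity)
      exact Real.rpow_le_rpow_of_nonpos (by positivity) (by linarith [sq_nonneg ε]) he
    · exact hI2
    · filter_upwards [ae_restrict_mem measurableSet_Ioc] with y hy
      have hy0 : 0 < y := hε.trans hy.1
      simp only [Pi.zero_apply]
      positivity

lemma xy_lint (n : ℕ) (s δ r ε : ℝ) (hs : s ∈ Ioo (0:ℝ) 1) (hδ : δ ≤ 1 - s) (hε : 0 < ε)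
    (hεr : ε < r) (k : ℝ) (hk : k = (n:ℝ)/2 - (s - 1 + δ/2)) :
    ∫⁻ p in (univ : Set (Euc n)) ×ˢ Ioc (0:ℝ) r,
      ENNReal.ofReal (p.2 ^ (1 - 2*s) * (ε^2 + ‖p.1‖^2 + p.2^2) ^ (-k)) ≤
      ENNReal.ofReal (cnk n k * TT s δ r ε) := by
  have hcn : 0 ≤ cnk n k := integral_nonneg fun x => by positivity
  rw [Measure.volume_eq_prod, ← Measure.prod_restrict, Measure.restrict_univ,
    lintegral_prod_symm]
  · have : ∀ y ∈ Ioc (0:ℝ) r, ∫⁻ x : Euc n,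
        ENNReal.ofReal (y ^ (1 - 2*s) * (ε^2 + ‖x‖^2 + y^2) ^ (-k)) =
        ENNReal.ofReal (cnk n k) *
          ENNReal.ofReal (y ^ (1 - 2*s) * (ε^2 + y^2) ^ (s - 1 + δ/2)) := by
      intro y hy
      have hy0 : 0 < y := hy.1
      have e : ∀ x : Euc n, ENNReal.ofReal (y ^ (1 - 2*s) * (ε^2 + ‖x‖^2 + y^2) ^ (-k)) =
          ENNReal.ofReal (y ^ (1 - 2*s)) *
            ENNReal.ofReal ((1 * ‖x - 0‖^2 + (ε^2 + y^2)) ^ (-k)) := by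
        intro x
        rw [← ENNReal.ofReal_mul (by positivity), sub_zero]
        congr 3; ring
      simp_rw [e]
      rw [lintegral_const_mul' _ _ ENNReal.ofReal_ne_top,
        x_lint n (by rw [hk]; linarith [hs.2]) one_pos (by positivity),
        ← ENNReal.ofReal_mul (by positivity), ← ENNReal.ofReal_mul hcn, Real.one_rpow,
        show (n:ℝ)/2 - k = s - 1 + δ/2 by rw [hk]; ring]
      congr 1; ring
    rw [setLIntegral_congr_fun measurableSet_Ioc this, lintegral_const_mul' _ _
      ENNReal.ofReal_ne_top, ENNReal.ofReal_mul hcn]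
    gcongr
    exact y_lint s δ r ε hs hδ hε hεr
  · apply Measurable.aemeasurable; fun_prop

lemma box_lint (n : ℕ) (s r : ℝ) (hs : s ∈ Ioo (0:ℝ) 1) (hr : 0 < r) :
    ∫⁻ p in (Metric.closedBall (0 : Euc n) r) ×ˢ Ioc (0:ℝ) r,
      ENNReal.ofReal (p.2 ^ (1 - 2*s) + 1) < ⊤ := by
  rw [Measure.volume_eq_prod, ← Measure.prod_restrict]
  have := lintegral_prod_mul (μ := volume.restrict (Metric.closedBall (0 : Euc n) r))
    (ν := volume.restrict (Ioc (0:ℝ) r)) (f := fun _ => 1)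
    (g := fun y => ENNReal.ofReal (y ^ (1-2*s) + 1)) (by fun_prop)
    (Measurable.aemeasurable (by fun_prop))
  simp only [one_mul] at this
  rw [this]
  refine ENNReal.mul_lt_top ?_ ?_
  · simp only [lintegral_one, Measure.restrict_apply_univ]
    exact measure_closedBall_lt_top
  · have hI : IntervalIntegrable (fun y : ℝ => y ^ (1-2*s)) volume 0 r :=
      intervalIntegral.intervalIntegrable_rpow' (by linarith [hs.2])
    have hI2 := ((intervalIntegrable_iff_integrableOn_Ioc_of_le hr.le).1
      (hI.add (intervalIntegrable_const (c := (1:ℝ)))))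
    exact hI2.lintegral_lt_top


/-- Energy estimate for the truncated bubble (inequality (3.1)). -/
theorem truncated_bubble_energy
    (n : ℕ) (hn : 1 ≤ n) (s : ℝ) (hs : s ∈ Ioo (0:ℝ) 1) (hns : 2 * s < (n:ℝ))
    (cs : ℝ) (hcs : 0 < cs)
    (cns : ℝ) (hcns : 0 < cns)
    (hnorm : ∀ y : ℝ, 0 < y →
      cns * (∫ x : Euc n, y ^ (2*s) * (‖x‖ ^ 2 + y ^ 2) ^ (-(((n:ℝ) + 2*s) / 2))) = 1)
    (Ω : Set (Euc n)) (hΩo : IsOpen Ω) (hΩb : Bornology.IsBounded Ω)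
    (h0 : (0 : Euc n) ∈ Ω)
    (A : Euc n → Matrix (Fin n) (Fin n) ℝ)
    (hAc : ∀ i j, ContinuousOn (fun x => A x i j) (closure Ω))
    (hAsym : ∀ x ∈ closure Ω, (A x).IsSymm)
    (hApos : ∀ x ∈ closure Ω, (A x).PosDef)
    (hA0 : A 0 = 1)
    (C₀ σ r₁ : ℝ) (hC₀ : 0 < C₀) (hσ : 0 < σ) (hr₁ : 0 < r₁)
    (hA_ub : ∀ x ∈ Ω, ‖x‖ < r₁ → ∀ v : Euc n,
      (∑ i, ∑ j, A x i j * v i * v j) ≤ ‖v‖ ^ 2 + C₀ * ‖x‖ ^ σ * ‖v‖ ^ 2)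
    (φ : ℝ → ℝ) (hφsm : ContDiff ℝ (⊤ : ℕ∞) φ) (hφmono : AntitoneOn φ (Ici (0:ℝ)))
    (hφrange : ∀ t ≥ (0:ℝ), φ t ∈ Icc (0:ℝ) 1)
    (hφ1 : ∀ t ∈ Icc (0:ℝ) (1/2), φ t = 1) (hφ0 : ∀ t ≥ (1:ℝ), φ t = 0)
    (r : ℝ) (hr : 0 < r) (hrr₁ : r < r₁) (hball : Metric.ball (0 : Euc n) r ⊆ Ω) :
    ∃ C > (0:ℝ), ∃ ε₀ > (0:ℝ), ∀ ε : ℝ, 0 < ε → ε < ε₀ →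
      ENNReal.ofReal cs *
          (∫⁻ p in Ω ×ˢ Ioi (0:ℝ), ENNReal.ofReal (p.2 ^ (1 - 2*s) *
            quadB n (A p.1)
              (fun x y => φ (Real.sqrt (‖x‖ ^ 2 + y ^ 2) / r) * wEps n s cns ε x y)
              p.1 p.2))
        ≤ ENNReal.ofReal cs *
            (∫⁻ p in (univ : Set (Euc n)) ×ˢ Ioi (0:ℝ), ENNReal.ofReal (p.2 ^ (1 - 2*s) *
              ((∑ i, (pdX n (wEps n s cns ε) i p.1 p.2) ^ 2)
                + (pdY n (wEps n s cns ε) p.1 p.2) ^ 2)))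
          + ENNReal.ofReal (C *
              (if σ < (n:ℝ) - 2*s then ε ^ σ + ε ^ ((n:ℝ) - 2*s)
               else if σ = (n:ℝ) - 2*s then ε ^ σ * Real.log (1/ε) + ε ^ ((n:ℝ) - 2*s)
               else ε ^ ((n:ℝ) - 2*s))) := by
  obtain ⟨V, hV⟩ : ∃ V : ℝ, V = (∫⁻ p in (Metric.closedBall (0 : Euc n) r) ×ˢ Ioc (0:ℝ) r,
      ENNReal.ofReal (p.2 ^ (1 - 2*s) + 1)).toReal := ⟨_, rfl⟩
  have hV0 : 0 ≤ V := by rw [hV]; exact ENNReal.toReal_nonneg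
  have hVe : ∫⁻ p in (Metric.closedBall (0 : Euc n) r) ×ˢ Ioc (0:ℝ) r,
      ENNReal.ofReal (p.2 ^ (1 - 2*s) + 1) = ENNReal.ofReal V := by
    rw [hV, ENNReal.ofReal_toReal (box_lint n s r hs hr).ne]
  obtain ⟨d, hd⟩ : ∃ d : ℝ, d = (n:ℝ) - 2*s := ⟨_, rfl⟩
  obtain ⟨δ, hδ⟩ : ∃ δ : ℝ, δ = min (σ - d) (1 - s) := ⟨_, rfl⟩
  have hδσ : δ ≤ σ - d := by rw [hδ]; exact min_le_left _ _
  have hδs : δ ≤ 1 - s := by rw [hδ]; exact min_le_right _ _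
  obtain ⟨K, hK, hpt⟩ := pt_main n hn s hs hns cns Ω A C₀ σ r₁ hC₀ hσ hA_ub φ hφsm hφrange
    hφ1 hφ0 r hr hrr₁ (d + δ) (by linarith)
  obtain ⟨Ct, hCt, hTT⟩ := TT_EE s σ d r hs.2 hr
  rw [← hδ] at hTT
  rw [← hd] at hpt ⊢
  obtain ⟨k, hk⟩ : ∃ k : ℝ, k = d + 1 - (d + δ)/2 := ⟨_, rfl⟩
  rw [← hk] at hpt
  have hcn : 0 ≤ cnk n k := integral_nonneg fun x => by positivity
  refine ⟨cs * K * (cnk n k * Ct + V) + 1, by positivity, min 1 r, lt_min one_pos hr, ?_⟩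
  intro ε hε hε0
  have hε1 : ε < 1 := hε0.trans_le (min_le_left _ _)
  have hεr : ε < r := hε0.trans_le (min_le_right _ _)
  change _ ≤ _ + ENNReal.ofReal ((cs * K * (cnk n k * Ct + V) + 1) * EE σ d ε)
  have hEd : ε ^ d ≤ EE σ d ε := EE_ge hε hε1
  have hd0 : 0 < ε ^ d := by positivity
  have hT0 : 0 ≤ TT s δ r ε := TT_nonneg hs.2 hε hεr
  set S : Set (Euc n × ℝ) := (Metric.closedBall (0 : Euc n) r) ×ˢ Ioc (0:ℝ) r with hS
  have hSm : MeasurableSet S := Metric.isClosed_closedBall.measurableSet.prod measurableSet_Ioc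
  set f : Euc n × ℝ → ENNReal := fun p => ENNReal.ofReal (K * ε ^ d *
    (p.2 ^ (1 - 2*s) * (ε^2 + ‖p.1‖^2 + p.2^2) ^ (-k) + (p.2 ^ (1 - 2*s) + 1))) with hf
  have hfm : Measurable f := by rw [hf]; fun_prop
  have hErr : ∫⁻ p, S.indicator f p ≤ ENNReal.ofReal (K * ε ^ d * (cnk n k * TT s δ r ε + V)) := by
    rw [lintegral_indicator hSm]
    have e : ∀ p ∈ S, f p = ENNReal.ofReal (K * ε ^ d) *
        (ENNReal.ofReal (p.2 ^ (1 - 2*s) * (ε^2 + ‖p.1‖^2 + p.2^2) ^ (-k)) +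
          ENNReal.ofReal (p.2 ^ (1 - 2*s) + 1)) := by
      intro p hp
      have hp0 : 0 < p.2 := hp.2.1
      rw [hf, ← ENNReal.ofReal_add (by positivity) (by positivity),
        ← ENNReal.ofReal_mul (by positivity)]
    rw [setLIntegral_congr_fun hSm e, lintegral_const_mul' _ _ ENNReal.ofReal_ne_top,
      lintegral_add_right _ (by fun_prop), hVe,
      ENNReal.ofReal_mul (p := K * ε ^ d) (by positivity),
      ENNReal.ofReal_add (by positivity) hV0]
    gcongr
    refine (lintegral_mono_set (t := univ ×ˢ Ioc (0:ℝ) r) ?_).trans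
      (xy_lint n s δ r ε hs hδs hε hεr k (by rw [hk, hd]; ring))
    exact prod_mono (subset_univ _) subset_rfl
  have hmain : ∫⁻ p in Ω ×ˢ Ioi (0:ℝ), ENNReal.ofReal (p.2 ^ (1 - 2*s) *
            quadB n (A p.1)
              (fun x y => φ (Real.sqrt (‖x‖ ^ 2 + y ^ 2) / r) * wEps n s cns ε x y)
              p.1 p.2) ≤
      (∫⁻ p in (univ : Set (Euc n)) ×ˢ Ioi (0:ℝ), ENNReal.ofReal (p.2 ^ (1 - 2*s) *
              ((∑ i, (pdX n (wEps n s cns ε) i p.1 p.2) ^ 2)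
                + (pdY n (wEps n s cns ε) p.1 p.2) ^ 2))) +
      ENNReal.ofReal (K * ε ^ d * (cnk n k * TT s δ r ε + V)) := by
    have h1 : ∀ p ∈ Ω ×ˢ Ioi (0:ℝ), ENNReal.ofReal (p.2 ^ (1 - 2*s) *
            quadB n (A p.1)
              (fun x y => φ (Real.sqrt (‖x‖ ^ 2 + y ^ 2) / r) * wEps n s cns ε x y)
              p.1 p.2) ≤ ENNReal.ofReal (p.2 ^ (1 - 2*s) *
              ((∑ i, (pdX n (wEps n s cns ε) i p.1 p.2) ^ 2)
                + (pdY n (wEps n s cns ε) p.1 p.2) ^ 2)) + S.indicator f p := by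
      rintro ⟨x, y⟩ ⟨hx, hy⟩
      have hy0 : 0 < y := hy
      obtain ⟨ha, hb⟩ := hpt ε hε hεr x hx y hy0
      rcases le_or_gt (r^2) (‖x‖^2 + y^2) with h | h
      · have := ha h
        simp only
        rw [this, mul_zero, ENNReal.ofReal_zero]
        exact zero_le
      · have hmem : ((x, y) : Euc n × ℝ) ∈ S := by
          refine ⟨?_, hy0, ?_⟩
          · rw [mem_closedBall_zero_iff]
            exact (lt_of_pow_lt_pow_left₀ 2 hr.le (by nlinarith [sq_nonneg y])).le
          · exact (lt_of_pow_lt_pow_left₀ 2 hr.le (by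
              have := sq_nonneg ‖x‖
              simp only; linarith)).le
        rw [indicator_of_mem hmem]
        exact (ENNReal.ofReal_le_ofReal (hb h)).trans ENNReal.ofReal_add_le
    refine (setLIntegral_mono' (hΩo.measurableSet.prod measurableSet_Ioi) h1).trans ?_
    refine (lintegral_mono_set (t := univ ×ˢ Ioi (0:ℝ))
      (prod_mono (subset_univ _) subset_rfl)).trans ?_
    rw [lintegral_add_right _ (hfm.indicator hSm)]
    gcongr
    exact (setLIntegral_le_lintegral _ _).trans hErr
  refine (mul_le_mul_right hmain _).trans ?_
  rw [mul_add, ← ENNReal.ofReal_mul hcs.le]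
  refine add_le_add le_rfl (ENNReal.ofReal_le_ofReal ?_)
  have h2 := hTT ε hε hε1 hεr
  have h3 : ε ^ d * (cnk n k * TT s δ r ε + V) ≤ (cnk n k * Ct + V) * EE σ d ε := by
    have h4 := mul_le_mul_of_nonneg_left h2 hcn
    have h5 := mul_le_mul_of_nonneg_left hEd hV0
    linarith
  have h6 := mul_le_mul_of_nonneg_left h3 (mul_pos hcs hK).le
  have h7 : 0 ≤ EE σ d ε := hd0.le.trans hEd
  linarith
end
end

section
/- Weighted estimate for the bubble near the origin (inequality (3.4)): Let σ > 0 and r > 0. There exist constants C > 0 and ε₀ > 0 such that for all 0 < ε < ε₀: ∫∫_{{(x,y): x ∈ ℝⁿ, y > 0, |x|² + y² ≤ r²}} y^{1−2s} |x|^σ |∇_x w_ε(x,y)|² dx dy ≤ C ε^σ if σ < n−2s, ≤ C ε^σ log(1/ε) if σ = n−2s, and ≤ C ε^{n−2s} if σ > n−2s, where ∇_x denotes the gradient in the x variables only. -/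
open MeasureTheory Filter Set Topology

noncomputable section

lemma rpow_half_sqrt (q p : ℝ) (hq : 0 ≤ q) : q ^ (-(p / 2)) = (√q) ^ (-p) := by
  rw [Real.sqrt_eq_rpow, ← Real.rpow_mul hq]
  congr 1
  ring

lemma sqrt_lip (a b y : ℝ) : |√(a ^ 2 + y ^ 2) - √(b ^ 2 + y ^ 2)| ≤ |a - b| := by
  have key : ∀ a b : ℝ, √(a ^ 2 + y ^ 2) ≤ √(b ^ 2 + y ^ 2) + |a - b| := by
    intro a b
    apply Real.sqrt_le_iff.2
    have h0 := Real.sqrt_nonneg (b ^ 2 + y ^ 2)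
    refine ⟨by positivity, ?_⟩
    have h1 : √(b ^ 2 + y ^ 2) ^ 2 = b ^ 2 + y ^ 2 := Real.sq_sqrt (by positivity)
    have h2 : |b| ≤ √(b ^ 2 + y ^ 2) := Real.abs_le_sqrt (by nlinarith [sq_nonneg y])
    have h3 : b * (a - b) ≤ |b| * |a - b| := by
      rw [← abs_mul]; exact le_abs_self _
    have h4 : |b| * |a - b| ≤ √(b ^ 2 + y ^ 2) * |a - b| :=
      mul_le_mul_of_nonneg_right h2 (abs_nonneg _)
    have h5 : |a - b| ^ 2 = (a - b) ^ 2 := sq_abs _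
    nlinarith
  rw [abs_le]
  constructor
  · have := key b a
    rw [abs_sub_comm] at this
    linarith
  · have := key a b
    linarith

lemma rpow_neg_lip (p τ a b : ℝ) (hp : 0 ≤ p) (hτ : 0 < τ) (ha : τ ≤ a) (hb : τ ≤ b) :
    |a ^ (-p) - b ^ (-p)| ≤ p * τ ^ (-(p + 1)) * |a - b| := by
  have := Convex.norm_image_sub_le_of_norm_hasDerivWithin_le (s := Ici τ) (x := b) (y := a)
    (f := fun t : ℝ => t ^ (-p)) (f' := fun t => -p * t ^ (-p - 1)) (C := p * τ ^ (-(p + 1)))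
    (fun x hx => (Real.hasDerivAt_rpow_const
      (Or.inl (ne_of_gt (lt_of_lt_of_le hτ hx)))).hasDerivWithinAt)
    (fun x hx => by
      have hx0 : 0 < x := lt_of_lt_of_le hτ hx
      rw [norm_mul, norm_neg, Real.norm_of_nonneg hp,
        Real.norm_of_nonneg (Real.rpow_nonneg hx0.le _)]
      rw [show -p - 1 = -(p + 1) by ring]
      exact mul_le_mul_of_nonneg_left
        (Real.rpow_le_rpow_of_nonpos hτ hx (by linarith)) hp)
    (convex_Ici τ) hb ha
  simpa [Real.norm_eq_abs] using this

lemma radial_bound (n : ℕ) (hn : 1 ≤ n) (ρ : ℝ) (f φ : ℝ → ℝ)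
    (hf : Measurable f) (hφ : IntegrableOn φ (Ioo 0 ρ))
    (h0 : ∀ t ∈ Ioo 0 ρ, 0 ≤ f t) (h1 : ∀ t ∈ Ioo 0 ρ, t ^ (n - 1) * f t ≤ φ t) :
    IntegrableOn (fun x : Euc n => f ‖x‖) (Metric.ball 0 ρ) ∧
    ∫ x in Metric.ball (0 : Euc n) ρ, f ‖x‖ ≤
      n * (volume.real (Metric.ball (0 : Euc n) 1)) * ∫ t in Ioo 0 ρ, φ t := by
  have : Nonempty (Fin n) := ⟨⟨0, hn⟩⟩
  have : Nontrivial (Euc n) := inferInstance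
  have hdim : Module.finrank ℝ (Euc n) = n := by simp
  have hI : IntegrableOn (fun t => t ^ (n - 1) * f t) (Ioo 0 ρ) := by
    refine Integrable.mono' hφ (by fun_prop) ?_
    filter_upwards [ae_restrict_mem measurableSet_Ioo] with t ht
    rw [Real.norm_of_nonneg (mul_nonneg (pow_nonneg ht.1.le _) (h0 t ht))]
    exact h1 t ht
  have hI2 : IntegrableOn (fun x : Euc n => f ‖x‖) (Metric.ball 0 ρ) := by
    rw [integrableOn_fun_norm_addHaar volume (f := f), hdim]
    simpa using hI
  refine ⟨hI2, ?_⟩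
  have e1 : ∫ x in Metric.ball (0 : Euc n) ρ, f ‖x‖
      = ∫ x : Euc n, (Iio ρ).indicator f ‖x‖ := by
    rw [← integral_indicator measurableSet_ball]
    congr 1
    ext x
    by_cases hx : ‖x‖ < ρ <;> simp [indicator, hx]
  rw [e1, integral_fun_norm_addHaar volume ((Iio ρ).indicator f), hdim]
  have e2 : ∫ y in Ioi (0:ℝ), y ^ (n - 1) • (Iio ρ).indicator f y
      = ∫ t in Ioo 0 ρ, t ^ (n - 1) * f t := by
    rw [← integral_indicator measurableSet_Ioi, ← integral_indicator measurableSet_Ioo]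
    congr 1
    ext t
    by_cases h1 : 0 < t <;> by_cases h2 : t < ρ <;> simp [indicator, h1, h2]
  rw [e2]
  simp only [nsmul_eq_mul, smul_eq_mul]
  rw [← mul_assoc]
  refine mul_le_mul_of_nonneg_left ?_ (by positivity)
  exact setIntegral_mono_on hI hφ measurableSet_Ioo h1

lemma w1_lip (n : ℕ) (s : ℝ) (hs : 0 < s) (hns : 2 * s < (n:ℝ)) (cns : ℝ) (hcns : 0 < cns)
    (x0 : Euc n) (y : ℝ) (hy : 0 < y)
    (hK : Integrable (fun v : Euc n => (‖v‖ ^ 2 + y ^ 2) ^ (-(((n:ℝ) + 2*s) / 2))))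
    (k : ℝ) (B : Euc n → ℝ) (hB : Integrable B)
    (hle : ∀ ξ, |u1 n s ξ - k| * (√(‖x0 - ξ‖ ^ 2 + y ^ 2)) ^ (-((n:ℝ) + 2*s + 1)) ≤ B ξ)
    (x : Euc n) (hx : ‖x - x0‖ ≤ y / 2) :
    |w1 n s cns x y - w1 n s cns x0 y| ≤
      (((n:ℝ) + 2*s) * 2 ^ ((n:ℝ) + 2*s + 1)) * (cns * y ^ (2*s) * ∫ ξ, B ξ) * ‖x - x0‖ := by
  set K : Euc n → ℝ := fun v => (‖v‖ ^ 2 + y ^ 2) ^ (-(((n:ℝ) + 2*s) / 2)) with hKdef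
  have hKx : ∀ z : Euc n, Integrable (fun ξ => K (z - ξ)) := fun z => hK.comp_sub_left z
  have hKint : ∀ z : Euc n, ∫ ξ, K (z - ξ) = ∫ ξ, K ξ := fun z => integral_sub_left_eq_self K volume z
  have hum : Measurable (u1 n s) := by unfold u1; fun_prop
  have hub : ∀ ξ, ‖u1 n s ξ‖ ≤ 1 := by
    intro ξ
    unfold u1
    rw [Real.norm_of_nonneg (by positivity)]
    exact Real.rpow_le_one_of_one_le_of_nonpos (by nlinarith [sq_nonneg ‖ξ‖]) (by linarith)
  have huK : ∀ z : Euc n, Integrable (fun ξ => u1 n s ξ * K (z - ξ)) := fun z =>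
    (hKx z).bdd_mul hum.aestronglyMeasurable (Eventually.of_forall hub)
  set A : ℝ := ((n:ℝ) + 2*s) * 2 ^ ((n:ℝ) + 2*s + 1) with hA
  have hA0 : 0 ≤ A := by positivity
  have hdiff : w1 n s cns x y - w1 n s cns x0 y
      = cns * y ^ (2*s) * ∫ ξ, (u1 n s ξ - k) * (K (x - ξ) - K (x0 - ξ)) := by
    have e : ∀ ξ, (u1 n s ξ - k) * (K (x - ξ) - K (x0 - ξ))
      = (u1 n s ξ * K (x - ξ) - u1 n s ξ * K (x0 - ξ)) - (k * K (x - ξ) - k * K (x0 - ξ)) := by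
      intro ξ; ring
    simp_rw [e]
    have i1 : Integrable (fun ξ => u1 n s ξ * K (x - ξ) - u1 n s ξ * K (x0 - ξ)) :=
      (huK x).sub (huK x0)
    have i2 : Integrable (fun ξ => k * K (x - ξ) - k * K (x0 - ξ)) :=
      ((hKx x).const_mul k).sub ((hKx x0).const_mul k)
    rw [integral_sub i1 i2,
      integral_sub (huK x) (huK x0), integral_sub ((hKx x).const_mul k) ((hKx x0).const_mul k),
      integral_const_mul, integral_const_mul, hKint, hKint]
    unfold w1
    simp only [hKdef]
    ring
  have hpt : ∀ ξ, ‖(u1 n s ξ - k) * (K (x - ξ) - K (x0 - ξ))‖ ≤ A * ‖x - x0‖ * B ξ := by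
    intro ξ
    set ρ := √(‖x - ξ‖ ^ 2 + y ^ 2) with hρ
    set ρ0 := √(‖x0 - ξ‖ ^ 2 + y ^ 2) with hρ0
    have h1 : |ρ - ρ0| ≤ ‖x - x0‖ := by
      refine (sqrt_lip _ _ y).trans ?_
      refine (abs_norm_sub_norm_le _ _).trans ?_
      rw [sub_sub_sub_cancel_right]
    have h2 : y ≤ ρ0 := Real.le_sqrt_of_sq_le (by nlinarith [sq_nonneg ‖x0 - ξ‖])
    have h3 : ρ0 / 2 ≤ ρ := by
      have := (abs_le.1 h1).1
      linarith
    have hρ00 : 0 < ρ0 := hy.trans_le h2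
    have h4 := rpow_neg_lip ((n:ℝ) + 2*s) (ρ0 / 2) ρ ρ0 (by positivity) (by linarith) h3 (by linarith)
    have e1 : K (x - ξ) = ρ ^ (-((n:ℝ) + 2*s)) := rpow_half_sqrt _ _ (by positivity)
    have e2 : K (x0 - ξ) = ρ0 ^ (-((n:ℝ) + 2*s)) := rpow_half_sqrt _ _ (by positivity)
    rw [norm_mul, Real.norm_eq_abs, Real.norm_eq_abs, e1, e2]
    have e3 : (ρ0 / 2) ^ (-((n:ℝ) + 2*s + 1)) = 2 ^ ((n:ℝ) + 2*s + 1) * ρ0 ^ (-((n:ℝ) + 2*s + 1)) := by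
      rw [Real.div_rpow hρ00.le (by norm_num), Real.rpow_neg (by norm_num : (0:ℝ) ≤ 2)]
      field_simp
    rw [e3] at h4
    have hQ : 0 ≤ ρ0 ^ (-((n:ℝ) + 2*s + 1)) := by positivity
    calc |u1 n s ξ - k| * |ρ ^ (-((n:ℝ) + 2*s)) - ρ0 ^ (-((n:ℝ) + 2*s))|
        ≤ |u1 n s ξ - k| * (A * ρ0 ^ (-((n:ℝ) + 2*s + 1)) * ‖x - x0‖) := by
          refine mul_le_mul_of_nonneg_left (h4.trans ?_) (abs_nonneg _)
          rw [← mul_assoc, ← hA]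
          exact mul_le_mul_of_nonneg_left h1 (by positivity)
      _ = A * ‖x - x0‖ * (|u1 n s ξ - k| * ρ0 ^ (-((n:ℝ) + 2*s + 1))) := by ring
      _ ≤ _ := mul_le_mul_of_nonneg_left (hle ξ) (by positivity)
  have hI := norm_integral_le_of_norm_le (hB.const_mul (A * ‖x - x0‖)) (Eventually.of_forall hpt)
  rw [integral_const_mul, Real.norm_eq_abs] at hI
  rw [hdiff, abs_mul, abs_of_nonneg (by positivity : 0 ≤ cns * y ^ (2*s))]
  calc _ ≤ cns * y ^ (2*s) * (A * ‖x - x0‖ * ∫ ξ, B ξ) :=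
        mul_le_mul_of_nonneg_left hI (by positivity)
    _ = _ := by ring

lemma tri_sqrt {n : ℕ} (x ξ : Euc n) (y : ℝ) :
    |‖ξ‖ - √(‖x‖ ^ 2 + y ^ 2)| ≤ √(‖x - ξ‖ ^ 2 + y ^ 2) := by
  have h0 := Real.sqrt_nonneg (‖x - ξ‖ ^ 2 + y ^ 2)
  have h1 : √(‖x - ξ‖ ^ 2 + y ^ 2) ^ 2 = ‖x - ξ‖ ^ 2 + y ^ 2 := Real.sq_sqrt (by positivity)
  have h2 : ‖x - ξ‖ ≤ √(‖x - ξ‖ ^ 2 + y ^ 2) := Real.le_sqrt_of_sq_le (by nlinarith [sq_nonneg y])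
  have h3 : ‖x‖ ≤ √(‖x‖ ^ 2 + y ^ 2) := Real.le_sqrt_of_sq_le (by nlinarith [sq_nonneg y])
  have h4 : ‖ξ‖ ≤ ‖x‖ + ‖x - ξ‖ := by
    have := norm_sub_le x (x - ξ)
    simpa using this
  have h5 : ‖x‖ ≤ ‖ξ‖ + ‖x - ξ‖ := by
    have := norm_add_le ξ (x - ξ)
    simpa using this
  rw [abs_le]
  constructor
  · have : √(‖x‖ ^ 2 + y ^ 2) ≤ ‖ξ‖ + √(‖x - ξ‖ ^ 2 + y ^ 2) := by
      apply Real.sqrt_le_iff.2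
      refine ⟨by positivity, ?_⟩
      have h6 : ‖x‖ ^ 2 ≤ (‖ξ‖ + ‖x - ξ‖) ^ 2 := pow_le_pow_left₀ (norm_nonneg _) h5 2
      have h7 : ‖ξ‖ * ‖x - ξ‖ ≤ ‖ξ‖ * √(‖x - ξ‖ ^ 2 + y ^ 2) :=
        mul_le_mul_of_nonneg_left h2 (norm_nonneg _)
      nlinarith
    linarith
  · linarith

lemma w1_bound (n : ℕ) (hn : 1 ≤ n) (s : ℝ) (hs : 0 < s) (hns : 2 * s < (n:ℝ))
    (cns : ℝ) (hcns : 0 < cns)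
    (hnorm : ∀ y : ℝ, 0 < y →
      cns * (∫ x : Euc n, y ^ (2*s) * (‖x‖ ^ 2 + y ^ 2) ^ (-(((n:ℝ) + 2*s) / 2))) = 1) :
    ∃ C > (0:ℝ), ∀ (x0 : Euc n) (y : ℝ), 0 < y → ∀ x : Euc n, ‖x - x0‖ ≤ y / 2 →
      |w1 n s cns x y - w1 n s cns x0 y| ≤
        C * (1 + ‖x0‖ + y) ^ (-((n:ℝ) - 2*s + 1)) * ‖x - x0‖ := by
  set p : ℝ := (n:ℝ) - 2*s with hp
  have hp0 : 0 < p := by rw [hp]; linarith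
  set V : ℝ := n * (volume.real (Metric.ball (0 : Euc n) 1)) with hV
  have hV0 : 0 ≤ V := by positivity
  set c2 : ℝ := cns * V * 2 ^ (2*s) / (2*s) with hc2
  have hc20 : 0 ≤ c2 := by positivity
  set A : ℝ := ((n:ℝ) + 2*s) * 2 ^ ((n:ℝ) + 2*s + 1) with hA
  have hA0 : 0 < A := by positivity
  refine ⟨A * (8 ^ (p + 1) * (p + c2)), by positivity, ?_⟩
  intro x0 y hy x hx
  set R : ℝ := √(‖x0‖ ^ 2 + y ^ 2) with hR
  have hR2 : R ^ 2 = ‖x0‖ ^ 2 + y ^ 2 := Real.sq_sqrt (by positivity)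
  have hyR : y ≤ R := Real.le_sqrt_of_sq_le (by nlinarith [sq_nonneg ‖x0‖])
  have hxR : ‖x0‖ ≤ R := Real.le_sqrt_of_sq_le (by nlinarith [sq_nonneg y])
  have hR0 : 0 < R := hy.trans_le hyR
  have hy2s : 0 < y ^ (2*s) := Real.rpow_pos_of_pos hy _
  -- integrability of the kernel
  have hN := hnorm y hy
  have hK : Integrable (fun v : Euc n => (‖v‖ ^ 2 + y ^ 2) ^ (-(((n:ℝ) + 2*s) / 2))) := by
    by_contra hcon
    rw [integral_const_mul, integral_undef hcon] at hN
    simp at hN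
  rw [integral_const_mul, ← mul_assoc] at hN
  have hKx : Integrable (fun ξ : Euc n => (‖x0 - ξ‖ ^ 2 + y ^ 2) ^ (-(((n:ℝ) + 2*s) / 2))) :=
    hK.comp_sub_left x0
  have hKint : ∫ ξ : Euc n, (‖x0 - ξ‖ ^ 2 + y ^ 2) ^ (-(((n:ℝ) + 2*s) / 2))
      = ∫ v : Euc n, (‖v‖ ^ 2 + y ^ 2) ^ (-(((n:ℝ) + 2*s) / 2)) :=
    integral_sub_left_eq_self (fun v : Euc n => (‖v‖ ^ 2 + y ^ 2) ^ (-(((n:ℝ) + 2*s) / 2))) volume x0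
  rw [← hKint] at hN
  set k : ℝ := (√(R ^ 2 + 1 ^ 2)) ^ (-p) with hk
  have hu : ∀ ξ : Euc n, u1 n s ξ = (√(‖ξ‖ ^ 2 + 1 ^ 2)) ^ (-p) := by
    intro ξ
    unfold u1
    rw [rpow_half_sqrt _ _ (by positivity)]
    congr 2
    ring
  have hdiff : ∀ ξ : Euc n, ∀ τ : ℝ, 0 < τ → τ ≤ √(‖ξ‖ ^ 2 + 1 ^ 2) → τ ≤ √(R ^ 2 + 1 ^ 2) →
      |u1 n s ξ - k| * (√(‖x0 - ξ‖ ^ 2 + y ^ 2)) ^ (-((n:ℝ) + 2*s + 1)) ≤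
        p * τ ^ (-(p + 1)) * (‖x0 - ξ‖ ^ 2 + y ^ 2) ^ (-(((n:ℝ) + 2*s) / 2)) := by
    intro ξ τ hτ h1 h2
    have h3 := rpow_neg_lip p τ _ _ hp0.le hτ h1 h2
    rw [← hu, ← hk] at h3
    have h4 := (sqrt_lip ‖ξ‖ R 1).trans (tri_sqrt x0 ξ y)
    have hρ : 0 < √(‖x0 - ξ‖ ^ 2 + y ^ 2) := Real.sqrt_pos.2 (by positivity)
    rw [rpow_half_sqrt _ _ (by positivity)]
    set ρ := √(‖x0 - ξ‖ ^ 2 + y ^ 2)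
    have e : ρ ^ (-((n:ℝ) + 2*s)) = ρ * ρ ^ (-((n:ℝ) + 2*s + 1)) := by
      nth_rewrite 2 [← Real.rpow_one ρ]
      rw [← Real.rpow_add hρ]
      congr 1
      ring
    rw [e, ← mul_assoc]
    refine mul_le_mul_of_nonneg_right (h3.trans ?_) (by positivity)
    exact mul_le_mul_of_nonneg_left h4 (by positivity)
  have hM : 0 < 1 + ‖x0‖ + y := by positivity
  have hmono : ∀ τ : ℝ, 0 < τ → 1 + ‖x0‖ + y ≤ 8 * τ →
      τ ^ (-(p + 1)) ≤ 8 ^ (p + 1) * (1 + ‖x0‖ + y) ^ (-(p + 1)) := by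
    intro τ hτ h
    have h1 : (8 * τ) ^ (-(p + 1)) ≤ (1 + ‖x0‖ + y) ^ (-(p + 1)) :=
      Real.rpow_le_rpow_of_nonpos hM h (by linarith)
    rw [Real.mul_rpow (by norm_num) hτ.le, Real.rpow_neg (by norm_num : (0:ℝ) ≤ 8)] at h1
    have h8 : (0:ℝ) < 8 ^ (p + 1) := by positivity
    calc τ ^ (-(p + 1)) = 8 ^ (p + 1) * ((8 ^ (p + 1))⁻¹ * τ ^ (-(p + 1))) := by
          field_simp
      _ ≤ _ := mul_le_mul_of_nonneg_left h1 h8.le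
  -- it suffices to find a suitable dominating function
  suffices hS : ∃ B : Euc n → ℝ, Integrable B ∧
      (∀ ξ, |u1 n s ξ - k| * (√(‖x0 - ξ‖ ^ 2 + y ^ 2)) ^ (-((n:ℝ) + 2*s + 1)) ≤ B ξ) ∧
      cns * y ^ (2*s) * ∫ ξ, B ξ ≤ 8 ^ (p + 1) * (p + c2) * (1 + ‖x0‖ + y) ^ (-(p + 1)) by
    obtain ⟨B, hB, hle, hBi⟩ := hS
    refine (w1_lip n s hs hns cns hcns x0 y hy hK k B hB hle x hx).trans ?_
    refine mul_le_mul_of_nonneg_right ?_ (norm_nonneg _)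
    rw [← hA, mul_assoc A]
    exact mul_le_mul_of_nonneg_left hBi hA0.le
  have hMp : 0 < (1 + ‖x0‖ + y) ^ (-(p + 1)) := by positivity
  rcases le_total R 1 with hR1 | hR1
  · refine ⟨fun ξ => p * (1:ℝ) ^ (-(p + 1)) * (‖x0 - ξ‖ ^ 2 + y ^ 2) ^ (-(((n:ℝ) + 2*s) / 2)),
      hKx.const_mul _, fun ξ => hdiff ξ 1 one_pos ?_ ?_, ?_⟩
    · exact Real.le_sqrt_of_sq_le (by nlinarith [sq_nonneg ‖ξ‖])
    · exact Real.le_sqrt_of_sq_le (by nlinarith [sq_nonneg R])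
    · have h1 := hmono 1 one_pos (by linarith)
      rw [integral_const_mul]
      calc _ = p * (1:ℝ) ^ (-(p + 1)) * (cns * y ^ (2*s) *
            ∫ ξ : Euc n, (‖x0 - ξ‖ ^ 2 + y ^ 2) ^ (-(((n:ℝ) + 2*s) / 2))) := by ring
        _ = p * (1:ℝ) ^ (-(p + 1)) := by rw [hN, mul_one]
        _ ≤ (p + c2) * (8 ^ (p + 1) * (1 + ‖x0‖ + y) ^ (-(p + 1))) :=
            mul_le_mul (by linarith) h1 (by positivity) (by positivity)
        _ = _ := by ring
  · set H : ℝ := R / 2 with hH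
    have hH0 : 0 < H := by rw [hH]; linarith
    have hrad := radial_bound n hn H (fun t => (√(t ^ 2 + 1 ^ 2)) ^ (-p)) (fun t => t ^ (2*s - 1))
      (by fun_prop)
      ((intervalIntegral.intervalIntegrable_rpow' (by linarith : -1 < 2*s - 1) (a := 0)
        (b := H)).1.mono_set Ioo_subset_Ioc_self)
      (fun t ht => by positivity)
      (fun t ht => by
        have ht0 : 0 < t := ht.1
        have h1 : t ≤ √(t ^ 2 + 1 ^ 2) := Real.le_sqrt_of_sq_le (by nlinarith)
        have h2 : (√(t ^ 2 + 1 ^ 2)) ^ (-p) ≤ t ^ (-p) :=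
          Real.rpow_le_rpow_of_nonpos ht0 h1 (by linarith)
        calc _ ≤ t ^ (n - 1) * t ^ (-p) := mul_le_mul_of_nonneg_left h2 (by positivity)
          _ = t ^ (2*s - 1) := by
            rw [← Real.rpow_natCast, ← Real.rpow_add ht0]
            congr 1
            push_cast [hn]
            rw [hp]; ring)
    rw [← hV] at hrad
    have hint : ∫ t in Ioo 0 H, t ^ (2*s - 1) = H ^ (2*s) / (2*s) := by
      rw [← integral_Ioc_eq_integral_Ioo, ← intervalIntegral.integral_of_le hH0.le,
        integral_rpow (Or.inl (by linarith))]
      rw [sub_add_cancel, Real.zero_rpow (by linarith), sub_zero]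
    rw [hint] at hrad
    obtain ⟨hr1, hr2⟩ := hrad
    simp only [← hu] at hr1 hr2
    set Q : ℝ := (n:ℝ) + 2*s + 1 with hQ
    refine ⟨fun ξ => p * H ^ (-(p + 1)) * (‖x0 - ξ‖ ^ 2 + y ^ 2) ^ (-(((n:ℝ) + 2*s) / 2)) +
      H ^ (-Q) * (Metric.ball (0 : Euc n) H).indicator (u1 n s) ξ,
      (hKx.const_mul _).add ((hr1.integrable_indicator measurableSet_ball).const_mul _), ?_, ?_⟩
    · intro ξ
      have hu0 : 0 ≤ u1 n s ξ := by rw [hu]; positivity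
      by_cases hξ : ‖ξ‖ < H
      · have hmem : ξ ∈ Metric.ball (0 : Euc n) H := by simpa using hξ
        beta_reduce
        rw [indicator_of_mem hmem]
        have hk0 : 0 ≤ k := by positivity
        have hku : k ≤ u1 n s ξ := by
          rw [hu, hk]
          refine Real.rpow_le_rpow_of_nonpos (by positivity) ?_ (by linarith)
          apply Real.sqrt_le_sqrt
          have : ‖ξ‖ ≤ R := by linarith
          have := pow_le_pow_left₀ (norm_nonneg _) this 2
          linarith
        have h1 : |u1 n s ξ - k| ≤ u1 n s ξ := by
          rw [abs_of_nonneg (by linarith)]; linarith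
        have h2 : H ≤ √(‖x0 - ξ‖ ^ 2 + y ^ 2) := by
          have := (abs_le.1 (tri_sqrt x0 ξ y)).1
          rw [← hR] at this
          linarith
        have h3 : (√(‖x0 - ξ‖ ^ 2 + y ^ 2)) ^ (-Q) ≤ H ^ (-Q) :=
          Real.rpow_le_rpow_of_nonpos hH0 h2 (by rw [hQ]; linarith)
        have h4 := mul_le_mul h1 h3 (by positivity) hu0
        have h5 : 0 ≤ p * H ^ (-(p + 1)) *
          (‖x0 - ξ‖ ^ 2 + y ^ 2) ^ (-(((n:ℝ) + 2*s) / 2)) := by positivity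
        linarith
      · have hmem : ξ ∉ Metric.ball (0 : Euc n) H := by simpa using hξ
        beta_reduce
        rw [indicator_of_notMem hmem]
        have := hdiff ξ H hH0 (Real.le_sqrt_of_sq_le (by
            have := pow_le_pow_left₀ hH0.le (not_lt.1 hξ) 2
            linarith))
          (Real.le_sqrt_of_sq_le (by
            have := pow_le_pow_left₀ hH0.le (by linarith : H ≤ R) 2
            linarith))
        simpa using this
    · rw [integral_add (hKx.const_mul _)
        ((hr1.integrable_indicator measurableSet_ball).const_mul _), integral_const_mul,
        integral_const_mul, integral_indicator measurableSet_ball]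
      have hy2 : y ^ (2*s) ≤ 2 ^ (2*s) * H ^ (2*s) := by
        rw [← Real.mul_rpow (by norm_num) hH0.le]
        exact Real.rpow_le_rpow hy.le (by linarith) (by linarith)
      have hI0 : 0 ≤ ∫ x in Metric.ball (0 : Euc n) H, u1 n s x :=
        integral_nonneg fun ξ => by rw [hu]; positivity
      have e1 : H ^ (2*s) * H ^ (-Q) * H ^ (2*s) = H ^ (-(p + 1)) := by
        rw [← Real.rpow_add hH0, ← Real.rpow_add hH0]
        congr 1
        rw [hQ, hp]; ring
      have hHm := hmono H hH0 (by linarith)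
      calc _ = p * H ^ (-(p + 1)) * (cns * y ^ (2*s) *
            ∫ ξ : Euc n, (‖x0 - ξ‖ ^ 2 + y ^ 2) ^ (-(((n:ℝ) + 2*s) / 2))) +
            cns * H ^ (-Q) * (y ^ (2*s) * ∫ x in Metric.ball (0 : Euc n) H, u1 n s x) := by ring
        _ ≤ p * H ^ (-(p + 1)) + cns * H ^ (-Q) *
            ((2 ^ (2*s) * H ^ (2*s)) * (V * (H ^ (2*s) / (2*s)))) := by
            rw [hN, mul_one]
            gcongr
        _ = (p + c2) * H ^ (-(p + 1)) := by
            rw [← e1, hc2]; ring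
        _ ≤ (p + c2) * (8 ^ (p + 1) * (1 + ‖x0‖ + y) ^ (-(p + 1))) :=
            mul_le_mul_of_nonneg_left hHm (by positivity)
        _ = _ := by ring

lemma grad_bound (n : ℕ) (s cns C : ℝ) (hC : 0 < C)
    (hw : ∀ (x0 : Euc n) (y : ℝ), 0 < y → ∀ x : Euc n, ‖x - x0‖ ≤ y / 2 →
      |w1 n s cns x y - w1 n s cns x0 y| ≤
        C * (1 + ‖x0‖ + y) ^ (-((n:ℝ) - 2*s + 1)) * ‖x - x0‖)
    (ε : ℝ) (hε : 0 < ε) (x0 : Euc n) (y : ℝ) (hy : 0 < y) :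
    ∑ i, (pdX n (wEps n s cns ε) i x0 y) ^ 2 ≤
      n * C ^ 2 * ε ^ ((n:ℝ) - 2*s) * (ε + ‖x0‖ + y) ^ (-(2 * ((n:ℝ) - 2*s) + 2)) := by
  set p : ℝ := (n:ℝ) - 2*s with hp
  set D : ℝ := C * ε ^ (p / 2) * (ε + ‖x0‖ + y) ^ (-(p + 1)) with hD
  have hpos : 0 < ε + ‖x0‖ + y := by positivity
  have hD0 : 0 ≤ D := by positivity
  have hconst : ε ^ ((2*s - (n:ℝ)) / 2) * (C * (1 + ‖ε⁻¹ • x0‖ + y / ε) ^ (-(p + 1)) * ε⁻¹) = D := by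
    have e1 : 1 + ‖ε⁻¹ • x0‖ + y / ε = ε⁻¹ * (ε + ‖x0‖ + y) := by
      rw [norm_smul, Real.norm_of_nonneg (by positivity)]
      field_simp
    rw [e1, Real.mul_rpow (by positivity) hpos.le, Real.inv_rpow hε.le, ← Real.rpow_neg hε.le,
      neg_neg, ← Real.rpow_neg_one ε, hD]
    have e2 : ε ^ (p / 2) = ε ^ ((2*s - (n:ℝ)) / 2) * ε ^ (p + 1) * ε ^ (-1:ℝ) := by
      rw [← Real.rpow_add hε, ← Real.rpow_add hε]
      congr 1
      rw [hp]; ring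
    rw [e2]; ring
  have hf : ‖fderiv ℝ (fun x' => wEps n s cns ε x' y) x0‖ ≤ D := by
    apply norm_fderiv_le_of_lip' ℝ hD0
    filter_upwards [Metric.closedBall_mem_nhds x0 (half_pos hy)] with x hx
    rw [mem_closedBall_iff_norm] at hx
    have hnn : ‖ε⁻¹ • x - ε⁻¹ • x0‖ = ε⁻¹ * ‖x - x0‖ := by
      rw [← smul_sub, norm_smul, Real.norm_of_nonneg (by positivity)]
    have h := hw (ε⁻¹ • x0) (y / ε) (by positivity) (ε⁻¹ • x) (by
      rw [hnn]
      calc ε⁻¹ * ‖x - x0‖ ≤ ε⁻¹ * (y / 2) := mul_le_mul_of_nonneg_left hx (by positivity)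
        _ = y / ε / 2 := by ring)
    unfold wEps
    rw [← mul_sub, norm_mul, Real.norm_of_nonneg (by positivity), Real.norm_eq_abs, ← hconst]
    rw [hnn] at h
    calc _ ≤ ε ^ ((2*s - (n:ℝ)) / 2) * _ := mul_le_mul_of_nonneg_left h (by positivity)
      _ = _ := by ring
  have hi : ∀ i : Fin n, (pdX n (wEps n s cns ε) i x0 y) ^ 2 ≤ D ^ 2 := by
    intro i
    unfold pdX
    rw [← sq_abs]
    refine pow_le_pow_left₀ (abs_nonneg _) ?_ 2
    rw [← Real.norm_eq_abs]
    refine (ContinuousLinearMap.le_opNorm _ _).trans ?_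
    simpa using hf
  refine (Finset.sum_le_sum fun i _ => hi i).trans (le_of_eq ?_)
  rw [Finset.sum_const, Finset.card_univ, Fintype.card_fin, nsmul_eq_mul, hD]
  have e3 : ε ^ p = (ε ^ (p / 2)) ^ 2 := by
    rw [← Real.rpow_natCast, ← Real.rpow_mul hε.le]
    congr 1
    push_cast; ring
  have e4 : (ε + ‖x0‖ + y) ^ (-(2 * p + 2)) = ((ε + ‖x0‖ + y) ^ (-(p + 1))) ^ 2 := by
    rw [← Real.rpow_natCast, ← Real.rpow_mul hpos.le]
    congr 1
    push_cast; ring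
  rw [e3, e4]; ring

lemma y_integral (s q a : ℝ) (hs : s < 1) (hq : 2 - 2*s < q) (ha : 0 < a) :
    ∫⁻ y in Ioi (0:ℝ), ENNReal.ofReal (y ^ (1 - 2*s) * (a + y) ^ (-q)) ≤
      ENNReal.ofReal ((1 / (2 - 2*s) + 1 / (q - (2 - 2*s))) * a ^ (2 - 2*s - q)) := by
  have hq0 : 0 < q := by linarith
  rw [← Ioc_union_Ioi_eq_Ioi ha.le]
  refine (lintegral_union_le _ _ _).trans ?_
  rw [add_mul, ENNReal.ofReal_add (by
      have : 0 < 2 - 2*s := by linarith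
      positivity) (by
      have : 0 < q - (2 - 2*s) := by linarith
      positivity)]
  refine add_le_add ?_ ?_
  · have hi : IntegrableOn (fun y : ℝ => a ^ (-q) * y ^ (1 - 2*s)) (Ioc 0 a) :=
      ((intervalIntegral.intervalIntegrable_rpow' (by linarith : -1 < 1 - 2*s) (a := 0)
        (b := a)).1).const_mul _
    calc _ ≤ ∫⁻ y in Ioc 0 a, ENNReal.ofReal (a ^ (-q) * y ^ (1 - 2*s)) := by
          refine setLIntegral_mono' measurableSet_Ioc fun y hy => ENNReal.ofReal_le_ofReal ?_
          have hy0 : 0 < y := hy.1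
          rw [mul_comm]
          exact mul_le_mul_of_nonneg_right
            (Real.rpow_le_rpow_of_nonpos ha (by linarith) (by linarith)) (by positivity)
      _ = ENNReal.ofReal (∫ y in Ioc 0 a, a ^ (-q) * y ^ (1 - 2*s)) := by
          rw [ofReal_integral_eq_lintegral_ofReal hi]
          filter_upwards [ae_restrict_mem measurableSet_Ioc] with y hy
          have hy0 : 0 < y := hy.1
          simp only [Pi.zero_apply]
          positivity
      _ ≤ _ := by
          refine ENNReal.ofReal_le_ofReal (le_of_eq ?_)
          rw [integral_const_mul, ← intervalIntegral.integral_of_le ha.le,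
            integral_rpow (Or.inl (by linarith)), show 1 - 2*s + 1 = 2 - 2*s by ring,
            Real.zero_rpow (by linarith), sub_zero,
            show 2 - 2*s - q = -q + (2 - 2*s) by ring, Real.rpow_add ha]
          ring
  · have hi : IntegrableOn (fun y : ℝ => y ^ (1 - 2*s - q)) (Ioi a) :=
      integrableOn_Ioi_rpow_of_lt (by linarith) ha
    calc _ ≤ ∫⁻ y in Ioi a, ENNReal.ofReal (y ^ (1 - 2*s - q)) := by
          refine setLIntegral_mono' measurableSet_Ioi fun y hy => ENNReal.ofReal_le_ofReal ?_
          have hy0 : 0 < y := ha.trans hy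
          rw [sub_eq_add_neg (1 - 2*s), Real.rpow_add hy0]
          exact mul_le_mul_of_nonneg_left
            (Real.rpow_le_rpow_of_nonpos hy0 (by linarith) (by linarith)) (by positivity)
      _ = ENNReal.ofReal (∫ y in Ioi a, y ^ (1 - 2*s - q)) := by
          rw [ofReal_integral_eq_lintegral_ofReal hi]
          filter_upwards [ae_restrict_mem measurableSet_Ioi] with y hy
          have hy0 : 0 < y := ha.trans hy
          simp only [Pi.zero_apply]
          positivity
      _ ≤ _ := by
          refine ENNReal.ofReal_le_ofReal (le_of_eq ?_)
          rw [integral_Ioi_rpow_of_lt (by linarith) ha,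
            show 1 - 2*s - q + 1 = 2 - 2*s - q by ring]
          rw [show q - (2 - 2*s) = -(2 - 2*s - q) by ring, one_div, inv_neg]
          ring

lemma t_integral (p σ T : ℝ) (hT : 0 < T) :
    ∃ C > (0:ℝ), ∀ ε : ℝ, 0 < ε → ε < 1 / 2 →
      IntegrableOn (fun t : ℝ => (ε + t) ^ (σ - p - 1)) (Ioo 0 T) ∧
      0 ≤ (if σ < p then ε ^ σ else if σ = p then ε ^ σ * Real.log (1/ε) else ε ^ p) ∧
      ε ^ p * ∫ t in Ioo 0 T, (ε + t) ^ (σ - p - 1) ≤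
        C * (if σ < p then ε ^ σ else if σ = p then ε ^ σ * Real.log (1/ε) else ε ^ p) := by
  have hl2 : 0 < Real.log 2 := Real.log_pos (by norm_num)
  have hlog : ∀ ε : ℝ, 0 < ε → ε < 1 / 2 → Real.log 2 ≤ Real.log (1 / ε) := by
    intro ε hε h
    apply Real.log_le_log (by norm_num)
    rw [le_div_iff₀ hε]; linarith
  have hint : ∀ ε : ℝ, 0 < ε → IntegrableOn (fun t : ℝ => (ε + t) ^ (σ - p - 1)) (Ioo 0 T) := by
    intro ε hε
    have : ContinuousOn (fun t : ℝ => (ε + t) ^ (σ - p - 1)) (Icc 0 T) := by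
      intro t ht
      refine ContinuousAt.continuousWithinAt ?_
      refine ContinuousAt.rpow_const (by fun_prop) (Or.inl ?_)
      have := ht.1
      linarith
    exact this.integrableOn_Icc.mono_set Ioo_subset_Icc_self
  have heq : ∀ ε : ℝ, ∫ t in Ioo 0 T, (ε + t) ^ (σ - p - 1)
      = ∫ t in ε..(ε + T), t ^ (σ - p - 1) := by
    intro ε
    rw [← integral_Ioc_eq_integral_Ioo, ← intervalIntegral.integral_of_le hT.le,
      intervalIntegral.integral_comp_add_left (fun t : ℝ => t ^ (σ - p - 1)), add_zero]
  have hnz : ∀ ε : ℝ, 0 < ε → (0:ℝ) ∉ uIcc ε (ε + T) := by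
    intro ε hε h
    rw [uIcc_of_le (by linarith)] at h
    linarith [h.1]
  rcases lt_trichotomy σ p with h | h | h
  · refine ⟨1 / (p - σ), by
      have : 0 < p - σ := by linarith
      positivity, fun ε hε hε2 => ⟨hint ε hε, ?_, ?_⟩⟩
    · rw [if_pos h]; positivity
    · rw [if_pos h, heq, integral_rpow (Or.inr ⟨by intro h'; linarith, hnz ε hε⟩),
        sub_add_cancel]
      have h1 : 0 ≤ (ε + T) ^ (σ - p) := by positivity
      have h2 : ε ^ p * ε ^ (σ - p) = ε ^ σ := by
        rw [← Real.rpow_add hε]; congr 1; ring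
      have h3 : 0 < p - σ := by linarith
      have h4 : ((ε + T) ^ (σ - p) - ε ^ (σ - p)) / (σ - p) ≤ ε ^ (σ - p) / (p - σ) := by
        rw [← neg_div_neg_eq, neg_sub, neg_sub]
        gcongr
        linarith
      calc _ ≤ ε ^ p * (ε ^ (σ - p) / (p - σ)) := mul_le_mul_of_nonneg_left h4 (by positivity)
        _ = 1 / (p - σ) * ε ^ σ := by rw [← h2]; ring
  · refine ⟨1 + |Real.log (T + 1)| / Real.log 2, by positivity,
      fun ε hε hε2 => ⟨hint ε hε, ?_, ?_⟩⟩
    · rw [if_neg (by linarith), if_pos h]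
      have := hlog ε hε hε2
      have : 0 ≤ Real.log (1 / ε) := by linarith
      positivity
    · rw [if_neg (by linarith), if_pos h, heq]
      subst h
      have e1 : ∫ t in ε..(ε + T), t ^ (σ - σ - 1) = Real.log ((ε + T) / ε) := by
        rw [← integral_inv (hnz ε hε)]
        congr 1
        ext t
        rw [show σ - σ - 1 = (-1:ℝ) by ring, Real.rpow_neg_one]
      rw [e1]
      have h1 := hlog ε hε hε2
      have h2 : Real.log ((ε + T) / ε) = Real.log (ε + T) + Real.log (1 / ε) := by
        rw [← Real.log_mul (by positivity) (by positivity)]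
        congr 1; ring
      have h3 : Real.log (ε + T) ≤ |Real.log (T + 1)| :=
        (Real.log_le_log (by linarith) (by linarith)).trans (le_abs_self _)
      have h4 : |Real.log (T + 1)| ≤ |Real.log (T + 1)| / Real.log 2 * Real.log (1 / ε) := by
        rw [div_mul_eq_mul_div, le_div_iff₀ hl2]
        exact mul_le_mul_of_nonneg_left h1 (abs_nonneg _)
      calc _ ≤ ε ^ σ * ((1 + |Real.log (T + 1)| / Real.log 2) * Real.log (1 / ε)) := by
            refine mul_le_mul_of_nonneg_left ?_ (by positivity)
            rw [h2]; linarith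
        _ = _ := by ring
  · have h3 : 0 < σ - p := by linarith
    refine ⟨(T + 1) ^ (σ - p) / (σ - p), by positivity, fun ε hε hε2 => ⟨hint ε hε, ?_, ?_⟩⟩
    · rw [if_neg (by linarith), if_neg (by linarith)]; positivity
    · rw [if_neg (by linarith), if_neg (by linarith), heq,
        integral_rpow (Or.inl (by linarith)), sub_add_cancel, mul_comm]
      refine mul_le_mul_of_nonneg_right ?_ (by positivity)
      have h1 : 0 ≤ ε ^ (σ - p) := by positivity
      have h2 : (ε + T) ^ (σ - p) ≤ (T + 1) ^ (σ - p) :=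
        Real.rpow_le_rpow (by linarith) (by linarith) h3.le
      gcongr
      linarith

/-- Weighted estimate for the bubble near the origin (inequality (3.4)). -/
theorem bubble_weighted_estimate_near_origin
    (n : ℕ) (hn : 1 ≤ n) (s : ℝ) (hs : s ∈ Ioo (0:ℝ) 1) (hns : 2 * s < (n:ℝ))
    (cns : ℝ) (hcns : 0 < cns)
    (hnorm : ∀ y : ℝ, 0 < y →
      cns * (∫ x : Euc n, y ^ (2*s) * (‖x‖ ^ 2 + y ^ 2) ^ (-(((n:ℝ) + 2*s) / 2))) = 1)
    (σ r : ℝ) (hσ : 0 < σ) (hr : 0 < r) :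
    ∃ C > (0:ℝ), ∃ ε₀ > (0:ℝ), ∀ ε : ℝ, 0 < ε → ε < ε₀ →
      (∫⁻ p in {p : Euc n × ℝ | 0 < p.2 ∧ ‖p.1‖ ^ 2 + p.2 ^ 2 ≤ r ^ 2},
          ENNReal.ofReal (p.2 ^ (1 - 2*s) * ‖p.1‖ ^ σ *
            ∑ i, (pdX n (wEps n s cns ε) i p.1 p.2) ^ 2))
        ≤ ENNReal.ofReal (C *
            (if σ < (n:ℝ) - 2*s then ε ^ σ
             else if σ = (n:ℝ) - 2*s then ε ^ σ * Real.log (1/ε)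
             else ε ^ ((n:ℝ) - 2*s))) := by
  set p : ℝ := (n:ℝ) - 2*s with hp
  have hp0 : 0 < p := by rw [hp]; linarith
  obtain ⟨hs0, hs1⟩ := hs
  obtain ⟨C1, hC1, hw⟩ := w1_bound n hn s hs0 hns cns hcns hnorm
  obtain ⟨C2, hC2, ht⟩ := t_integral p σ (r + 1) (by linarith)
  set V : ℝ := n * (volume.real (Metric.ball (0 : Euc n) 1)) with hV
  have hV0 : 0 ≤ V := by positivity
  have hn0 : (0:ℝ) < n := by exact_mod_cast hn
  set q : ℝ := 2 * p + 2 with hq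
  set Cy : ℝ := 1 / (2 - 2*s) + 1 / (q - (2 - 2*s)) with hCy
  have hCy0 : 0 < Cy := by
    have h1 : 0 < 2 - 2*s := by linarith
    have h2 : 0 < q - (2 - 2*s) := by linarith
    positivity
  refine ⟨n * C1 ^ 2 * Cy * (V + 1) * C2, by positivity, 1 / 2, by norm_num, ?_⟩
  intro ε hε hε2
  obtain ⟨hti, hE0, htb⟩ := ht ε hε hε2
  set E : ℝ := (if σ < p then ε ^ σ else if σ = p then ε ^ σ * Real.log (1/ε) else ε ^ p) with hE
  set M : ℝ := n * C1 ^ 2 * ε ^ p with hM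
  have hM0 : 0 ≤ M := by positivity
  -- the radial integral
  have hrad := radial_bound n hn (r + 1) (fun t => (ε + t) ^ (σ - p - n))
    (fun t => (ε + t) ^ (σ - p - 1)) (by fun_prop) hti
    (fun t ht => by
      have := ht.1
      positivity)
    (fun t ht => by
      have ht0 : 0 < t := ht.1
      have hpos : 0 < ε + t := by positivity
      have h1 : t ^ (n - 1) ≤ (ε + t) ^ (n - 1) := pow_le_pow_left₀ ht0.le (by linarith) _
      calc _ ≤ (ε + t) ^ (n - 1) * (ε + t) ^ (σ - p - n) :=
            mul_le_mul_of_nonneg_right h1 (by positivity)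
        _ = _ := by
            rw [← Real.rpow_natCast, ← Real.rpow_add hpos]
            congr 1
            push_cast [hn]
            ring)
  rw [← hV] at hrad
  obtain ⟨hr1, hr2⟩ := hrad
  set G : Euc n × ℝ → ENNReal := fun z =>
    ENNReal.ofReal (M * (ε + ‖z.1‖) ^ σ * (z.2 ^ (1 - 2*s) * (ε + ‖z.1‖ + z.2) ^ (-q))) with hG
  have hGm : Measurable G := by rw [hG]; fun_prop
  have hsub : {z : Euc n × ℝ | 0 < z.2 ∧ ‖z.1‖ ^ 2 + z.2 ^ 2 ≤ r ^ 2} ⊆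
      Metric.ball (0 : Euc n) (r + 1) ×ˢ Ioi (0:ℝ) := by
    rintro ⟨x, y⟩ ⟨h1, h2⟩
    refine ⟨?_, h1⟩
    have : ‖x‖ ≤ r := abs_le_of_sq_le_sq' (by nlinarith [sq_nonneg y]) hr.le |>.2
    simp only [Metric.mem_ball, dist_zero_right]
    linarith
  have hmeas : MeasurableSet (Metric.ball (0 : Euc n) (r + 1) ×ˢ Ioi (0:ℝ)) :=
    measurableSet_ball.prod measurableSet_Ioi
  calc _ ≤ ∫⁻ z in Metric.ball (0 : Euc n) (r + 1) ×ˢ Ioi (0:ℝ),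
          ENNReal.ofReal (z.2 ^ (1 - 2*s) * ‖z.1‖ ^ σ *
            ∑ i, (pdX n (wEps n s cns ε) i z.1 z.2) ^ 2) := lintegral_mono_set hsub
    _ ≤ ∫⁻ z in Metric.ball (0 : Euc n) (r + 1) ×ˢ Ioi (0:ℝ), G z := by
        refine setLIntegral_mono' hmeas ?_
        rintro ⟨x, y⟩ ⟨-, hy⟩
        have hy0 : 0 < y := hy
        refine ENNReal.ofReal_le_ofReal ?_
        have h1 := grad_bound n s cns C1 hC1 hw ε hε x y hy0
        have h2 : ‖x‖ ^ σ ≤ (ε + ‖x‖) ^ σ :=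
          Real.rpow_le_rpow (norm_nonneg _) (by linarith) hσ.le
        calc _ ≤ y ^ (1 - 2*s) * (ε + ‖x‖) ^ σ * (M * (ε + ‖x‖ + y) ^ (-q)) :=
              mul_le_mul (mul_le_mul_of_nonneg_left h2 (by positivity)) h1
                (Finset.sum_nonneg fun i _ => sq_nonneg _) (by positivity)
          _ = _ := by ring
    _ = ∫⁻ x in Metric.ball (0 : Euc n) (r + 1), ∫⁻ y in Ioi (0:ℝ), G (x, y) := by
        rw [Measure.volume_eq_prod, ← Measure.prod_restrict]
        exact lintegral_prod _ hGm.aemeasurable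
    _ ≤ ∫⁻ x in Metric.ball (0 : Euc n) (r + 1),
          ENNReal.ofReal (M * Cy) * ENNReal.ofReal ((ε + ‖x‖) ^ (σ - p - n)) := by
        refine lintegral_mono fun x => ?_
        have hpos : 0 < ε + ‖x‖ := by positivity
        have hA : 0 ≤ M * (ε + ‖x‖) ^ σ := by positivity
        simp only [hG]
        simp_rw [ENNReal.ofReal_mul hA]
        rw [lintegral_const_mul _ (by fun_prop)]
        refine (mul_le_mul_right (y_integral s q (ε + ‖x‖) hs1 (by linarith) hpos) _).trans ?_
        rw [← hCy, ← ENNReal.ofReal_mul hA, ← ENNReal.ofReal_mul (by positivity)]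
        refine ENNReal.ofReal_le_ofReal (le_of_eq ?_)
        have e : (ε + ‖x‖) ^ (σ - p - n) = (ε + ‖x‖) ^ σ * (ε + ‖x‖) ^ (2 - 2*s - q) := by
          rw [← Real.rpow_add hpos]
          congr 1
          rw [hq, hp]; ring
        rw [e]; ring
    _ = ENNReal.ofReal (M * Cy) *
          ENNReal.ofReal (∫ x in Metric.ball (0 : Euc n) (r + 1), (ε + ‖x‖) ^ (σ - p - n)) := by
        rw [lintegral_const_mul _ (by fun_prop), ofReal_integral_eq_lintegral_ofReal hr1]
        exact Eventually.of_forall fun x => by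
          simp only [Pi.zero_apply]
          positivity
    _ ≤ ENNReal.ofReal (n * C1 ^ 2 * Cy * (V + 1) * C2 * E) := by
        rw [← ENNReal.ofReal_mul (by positivity)]
        refine ENNReal.ofReal_le_ofReal ?_
        calc _ ≤ M * Cy * (V * ∫ t in Ioo 0 (r + 1), (ε + t) ^ (σ - p - 1)) :=
              mul_le_mul_of_nonneg_left hr2 (by positivity)
          _ = n * C1 ^ 2 * Cy * V * (ε ^ p * ∫ t in Ioo 0 (r + 1), (ε + t) ^ (σ - p - 1)) := by
              rw [hM]; ring
          _ ≤ n * C1 ^ 2 * Cy * V * (C2 * E) := mul_le_mul_of_nonneg_left htb (by positivity)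
          _ ≤ n * C1 ^ 2 * Cy * (V + 1) * (C2 * E) := by
              refine mul_le_mul_of_nonneg_right ?_ (by positivity)
              refine mul_le_mul_of_nonneg_left (by linarith) (by positivity)
          _ = _ := by ring
end
end

section
/- Weighted gradient integrability of the standard bubble, subcritical weight (inequality (3.6), case σ < n−2s): If 0 < σ < n−2s, then ∫_{{|x| ≥ 1}} ∫_0^∞ y^{1−2s} |x|^σ |∇_x w₁(x,y)|² dy dx < ∞, where ∇_x denotes the gradient in the x variables only. -/
open MeasureTheory Filter Set Topology

noncomputable section

lemma lemA (b c m M t₁ t₂ : ℝ) (hb : 0 < b) (hM : 0 < M) (hm : 0 ≤ m)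
    (h : M ^ 2 ≤ m ^ 2 + c) (hc : 0 ≤ c) (h1 : m ≤ t₁) (h2 : m ≤ t₂) :
    |(t₁ ^ 2 + c) ^ (-b) - (t₂ ^ 2 + c) ^ (-b)| ≤ 2 * b * M ^ (-(2 * b) - 1) * |t₁ - t₂| := by
  have key : ∀ t ∈ Ici m, M ^ 2 ≤ t ^ 2 + c := by
    intro t ht
    have : m ^ 2 ≤ t ^ 2 := pow_le_pow_left₀ hm ht 2
    linarith
  have hM2 : 0 < M ^ 2 := by positivity
  have := (convex_Ici m).norm_image_sub_le_of_norm_hasDerivWithin_le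
    (f := fun t : ℝ => (t ^ 2 + c) ^ (-b))
    (f' := fun t : ℝ => (2 * t) * (-b) * (t ^ 2 + c) ^ (-b - 1))
    (C := 2 * b * M ^ (-(2 * b) - 1)) (x := t₂) (y := t₁) ?_ ?_ h2 h1
  · simpa [Real.norm_eq_abs] using this
  · intro t ht
    have hp : 0 < t ^ 2 + c := lt_of_lt_of_le hM2 (key t ht)
    have h0 : HasDerivAt (fun t : ℝ => t ^ 2 + c) (2 * t) t := by
      simpa using (hasDerivAt_pow 2 t).add_const c
    exact (h0.rpow_const (Or.inl hp.ne')).hasDerivWithinAt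
  · intro t ht
    have hk := key t ht
    have hp : 0 < t ^ 2 + c := lt_of_lt_of_le hM2 hk
    have ht0 : 0 ≤ t := hm.trans ht
    have e1 : t ≤ (t ^ 2 + c) ^ (1 / 2 : ℝ) := by
      rw [← Real.sqrt_eq_rpow]
      exact Real.le_sqrt_of_sq_le (by linarith)
    have e2 : (t ^ 2 + c) ^ (1 / 2 : ℝ) * (t ^ 2 + c) ^ (-b - 1) = (t ^ 2 + c) ^ (-b - 1 / 2) := by
      rw [← Real.rpow_add hp]; congr 1; ring
    have e3 : (t ^ 2 + c) ^ (-b - 1 / 2) ≤ (M ^ 2) ^ (-b - 1 / 2) :=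
      Real.rpow_le_rpow_of_nonpos hM2 hk (by linarith)
    have e4 : (M ^ 2) ^ (-b - 1 / 2) = M ^ (-(2 * b) - 1) := by
      rw [← Real.rpow_natCast, ← Real.rpow_mul hM.le]; congr 1; push_cast; ring
    have hq : 0 ≤ (t ^ 2 + c) ^ (-b - 1) := Real.rpow_nonneg hp.le _
    rw [Real.norm_eq_abs, abs_mul, abs_mul, abs_neg, abs_of_nonneg hb.le, abs_of_nonneg hq,
      abs_of_nonneg (by positivity : 0 ≤ 2 * t)]
    calc 2 * t * b * (t ^ 2 + c) ^ (-b - 1) = 2 * b * (t * (t ^ 2 + c) ^ (-b - 1)) := by ring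
      _ ≤ 2 * b * ((t ^ 2 + c) ^ (1 / 2 : ℝ) * (t ^ 2 + c) ^ (-b - 1)) := by gcongr
      _ ≤ _ := by rw [e2, ← e4]; gcongr

lemma lemB (n : ℕ) (hn : 1 ≤ n) (s : ℝ) (hs : 0 < s) : ∃ C : ℝ, 0 ≤ C ∧ ∀ ρ : ℝ, 0 < ρ →
    Integrable (fun ξ : Euc n => (Iic ρ).indicator (fun t : ℝ => t ^ (2 * s - n)) ‖ξ‖) ∧
    ∫ ξ : Euc n, (Iic ρ).indicator (fun t : ℝ => t ^ (2 * s - n)) ‖ξ‖ ≤ C * ρ ^ (2 * s) := by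
  have : Nonempty (Fin n) := ⟨⟨0, hn⟩⟩
  have hcong : ∀ ρ : ℝ, ∀ y ∈ Ioi (0:ℝ), y ^ (Module.finrank ℝ (Euc n) - 1) •
      (Iic ρ).indicator (fun t : ℝ => t ^ (2 * s - n)) y
      = (Iic ρ).indicator (fun t : ℝ => t ^ (2 * s - 1)) y := by
    intro ρ y hy
    by_cases h : y ∈ Iic ρ
    · simp only [h, indicator_of_mem, finrank_euclideanSpace, Fintype.card_fin, smul_eq_mul]
      rw [← Real.rpow_natCast, ← Real.rpow_add hy]; congr 1
      rw [Nat.cast_sub hn]; push_cast; ring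
    · simp [h]
  refine ⟨n * (volume.real (Metric.ball (0 : Euc n) 1) * (1 / (2 * s))), by positivity, ?_⟩
  intro ρ hρ
  have hint : IntegrableOn (fun t : ℝ => t ^ (2 * s - 1)) (Ioc 0 ρ) := by
    rw [← intervalIntegrable_iff_integrableOn_Ioc_of_le hρ.le]
    exact intervalIntegral.intervalIntegrable_rpow' (by linarith)
  constructor
  · rw [integrable_fun_norm_addHaar (volume : Measure (Euc n))]
    rw [integrableOn_congr_fun (hcong ρ) measurableSet_Ioi, IntegrableOn,
      integrable_indicator_iff measurableSet_Iic, IntegrableOn,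
      Measure.restrict_restrict measurableSet_Iic, inter_comm]
    exact hint
  · rw [integral_fun_norm_addHaar, setIntegral_congr_fun measurableSet_Ioi (hcong ρ),
      setIntegral_indicator measurableSet_Iic, Ioi_inter_Iic,
      ← intervalIntegral.integral_of_le hρ.le, integral_rpow (Or.inl (by linarith))]
    rw [Real.zero_rpow (by linarith)]
    simp only [finrank_euclideanSpace, Fintype.card_fin, smul_eq_mul, nsmul_eq_mul]
    apply le_of_eq
    rw [show 2 * s - 1 + 1 = 2 * s by ring]
    ring

lemma lemC (s δ : ℝ) (hs : s < 1) (hδ : 0 < δ) :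
    IntegrableOn (fun y : ℝ => y ^ (1 - 2 * s) * (max 1 y) ^ (-(2 - 2 * s + δ))) (Ioi 0) := by
  rw [← Ioc_union_Ioi_eq_Ioi (zero_le_one (α := ℝ))]
  apply IntegrableOn.union
  · have : IntegrableOn (fun t : ℝ => t ^ (1 - 2 * s)) (Ioc 0 1) := by
      rw [← intervalIntegrable_iff_integrableOn_Ioc_of_le zero_le_one]
      exact intervalIntegral.intervalIntegrable_rpow' (by linarith)
    refine this.congr_fun ?_ measurableSet_Ioc
    intro y hy
    simp [max_eq_left hy.2]
  · have : IntegrableOn (fun t : ℝ => t ^ (-1 - δ)) (Ioi 1) :=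
      integrableOn_Ioi_rpow_of_lt (by linarith) one_pos
    refine this.congr_fun ?_ measurableSet_Ioi
    intro y hy
    have hy' : (1:ℝ) < y := hy
    simp only [max_eq_right hy'.le]
    rw [← Real.rpow_add (by linarith)]; congr 1; ring


lemma lemK (b y R : ℝ) (n : ℕ) (hb : 0 < b) (hy : 0 < y) (x x₀ ξ : Euc n)
    (hR : R = max ‖x₀‖ y) (hx : ‖x - x₀‖ ≤ R / 4) (hξ : ‖ξ‖ ≤ R / 4) :
    |(‖x - ξ‖ ^ 2 + y ^ 2) ^ (-b) - (‖x₀ - ξ‖ ^ 2 + y ^ 2) ^ (-b)|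
      ≤ 2 * b * (R / 2) ^ (-(2 * b) - 1) * ‖x - x₀‖ := by
  have hRy : y ≤ R := hR ▸ le_max_right _ _
  have hR0 : 0 < R := by linarith
  have hd : |‖x - ξ‖ - ‖x₀ - ξ‖| ≤ ‖x - x₀‖ := by
    have := abs_norm_sub_norm_le (x - ξ) (x₀ - ξ)
    simpa using this
  have hfin : ∀ m : ℝ, 0 ≤ m → (R / 2) ^ 2 ≤ m ^ 2 + y ^ 2 → m ≤ ‖x - ξ‖ → m ≤ ‖x₀ - ξ‖ →
      |(‖x - ξ‖ ^ 2 + y ^ 2) ^ (-b) - (‖x₀ - ξ‖ ^ 2 + y ^ 2) ^ (-b)|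
      ≤ 2 * b * (R / 2) ^ (-(2 * b) - 1) * ‖x - x₀‖ := by
    intro m hm h h1 h2
    refine (lemA b (y ^ 2) m (R / 2) _ _ hb (by positivity) hm h (by positivity) h1 h2).trans ?_
    gcongr
  rcases le_total ‖x₀‖ y with h | h
  · rw [max_eq_right h] at hR
    refine hfin 0 le_rfl ?_ (norm_nonneg _) (norm_nonneg _)
    rw [hR]; nlinarith
  · rw [max_eq_left h] at hR
    have t1 : ‖x₀‖ ≤ ‖x₀ - ξ‖ + ‖ξ‖ := by
      simpa using norm_add_le (x₀ - ξ) ξ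
    have t2 : ‖x₀ - ξ‖ ≤ ‖x - ξ‖ + ‖x - x₀‖ := by
      have := (abs_le.1 hd).1
      linarith
    refine hfin (R / 2) (by positivity) (by nlinarith) (by linarith) (by linarith)

lemma lemW (n : ℕ) (hn : 1 ≤ n) (s : ℝ) (hs : s ∈ Ioo (0:ℝ) 1) (hns : 2 * s < (n:ℝ))
    (cns : ℝ) (hcns : 0 < cns)
    (hnorm : ∀ y : ℝ, 0 < y →
      cns * (∫ x : Euc n, y ^ (2*s) * (‖x‖ ^ 2 + y ^ 2) ^ (-(((n:ℝ) + 2*s) / 2))) = 1) :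
    ∃ D : ℝ, 0 ≤ D ∧ ∀ (x₀ : Euc n) (y : ℝ), 0 < y →
      ‖fderiv ℝ (fun x' => w1 n s cns x' y) x₀‖ ≤ D * (max ‖x₀‖ y) ^ (-((n:ℝ) - 2 * s) - 1) := by
  obtain ⟨C, hC0, hC⟩ := lemB n hn s hs.1
  have hs0 : 0 < s := hs.1
  set a : ℝ := ((n:ℝ) - 2*s) / 2 with ha
  set b : ℝ := ((n:ℝ) + 2*s) / 2 with hb
  have ha0 : 0 < a := by rw [ha]; linarith
  have hb0 : 0 < b := by rw [hb]; linarith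
  refine ⟨cns * (C / 4 ^ (2 * s)) * (2 * b / 2 ^ (-(2 * b) - 1)) + 2 * a / 4 ^ (-(2 * a) - 1),
    by positivity, ?_⟩
  intro x₀ y hy
  set R : ℝ := max ‖x₀‖ y with hR
  have hRy : y ≤ R := hR ▸ le_max_right _ _
  have hR0 : 0 < R := by linarith
  set ρ : ℝ := R / 4 with hρ
  have hρ0 : 0 < ρ := by positivity
  -- kernel
  set K : Euc n → ℝ := fun z => (‖z‖ ^ 2 + y ^ 2) ^ (-b) with hK
  have hK0 : ∀ z, 0 ≤ K z := fun z => by simp only [hK]; positivity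
  have hy2 : 0 < y ^ (2 * s) := by positivity
  have hKn : cns * y ^ (2 * s) * ∫ z, K z = 1 := by
    have := hnorm y hy
    rw [integral_const_mul] at this
    rw [← this]; ring
  have hKi : Integrable K := by
    by_contra hcon
    rw [integral_undef hcon] at hKn
    simp at hKn
  -- decomposition
  set f2 : Euc n → ℝ := fun ξ => ((max ‖ξ‖ ρ) ^ 2 + 1) ^ (-a) with hf2
  set f1 : Euc n → ℝ := fun ξ => u1 n s ξ - f2 ξ with hf1
  have hu : ∀ ξ, u1 n s ξ = (‖ξ‖ ^ 2 + 1) ^ (-a) := by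
    intro ξ; simp only [u1, ← ha]; rw [add_comm]
  have hpos : ∀ t : ℝ, 0 < t ^ 2 + 1 := fun t => by positivity
  have hle1 : ∀ t : ℝ, (t ^ 2 + 1) ^ (-a) ≤ 1 := fun t =>
    Real.rpow_le_one_of_one_le_of_nonpos (by nlinarith [sq_nonneg t]) (by linarith)
  have hf2c : Continuous f2 := by
    simp only [hf2]
    refine Continuous.rpow_const (by fun_prop) (fun ξ => Or.inl (hpos _).ne')
  have huc : Continuous (u1 n s) := by
    have : u1 n s = fun ξ => (‖ξ‖ ^ 2 + 1) ^ (-a) := funext hu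
    rw [this]
    refine Continuous.rpow_const (by fun_prop) (fun ξ => Or.inl (hpos _).ne')
  have hf1c : Continuous f1 := huc.sub hf2c
  have hf2b : ∀ ξ, ‖f2 ξ‖ ≤ 1 := fun ξ => by
    rw [Real.norm_of_nonneg (by simp only [hf2]; positivity)]; exact hle1 _
  have hf2n : ∀ ξ, 0 ≤ f2 ξ := fun ξ => by simp only [hf2]; positivity
  have hf1n : ∀ ξ, 0 ≤ f1 ξ := fun ξ => by
    simp only [hf1, hf2, hu, sub_nonneg]
    refine Real.rpow_le_rpow_of_nonpos (hpos _) ?_ (by linarith)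
    gcongr
    exact le_max_left _ _
  have hf1u : ∀ ξ, f1 ξ ≤ u1 n s ξ := fun ξ => by
    simp only [hf1]; linarith [hf2n ξ]
  have hf1b : ∀ ξ, ‖f1 ξ‖ ≤ 1 := fun ξ => by
    rw [Real.norm_of_nonneg (hf1n ξ)]; exact (hf1u ξ).trans (by rw [hu]; exact hle1 _)
  have hf1z : ∀ ξ, ρ < ‖ξ‖ → f1 ξ = 0 := fun ξ h => by
    simp only [hf1, hf2, hu, max_eq_left h.le, sub_self]
  have hf1G : ∀ ξ, ξ ≠ 0 → f1 ξ ≤ (Iic ρ).indicator (fun t : ℝ => t ^ (2 * s - n)) ‖ξ‖ := by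
    intro ξ hξ
    have hξ0 : 0 < ‖ξ‖ := norm_pos_iff.2 hξ
    by_cases h : ‖ξ‖ ≤ ρ
    · rw [indicator_of_mem (by exact h)]
      refine (hf1u ξ).trans ?_
      rw [hu]
      calc (‖ξ‖ ^ 2 + 1) ^ (-a) ≤ (‖ξ‖ ^ 2) ^ (-a) :=
            Real.rpow_le_rpow_of_nonpos (by positivity) (by linarith) (by linarith)
        _ = _ := by
            rw [← Real.rpow_natCast, ← Real.rpow_mul hξ0.le]; congr 1; rw [ha]; push_cast; ring
    · rw [indicator_of_notMem (by exact h), hf1z ξ (not_le.1 h)]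
  have : Nonempty (Fin n) := ⟨⟨0, hn⟩⟩
  have hae : ∀ᵐ ξ : Euc n, ξ ≠ 0 := by
    simp [ae_iff]
  have hf1i : Integrable f1 := by
    refine (hC ρ hρ0).1.mono' hf1c.aestronglyMeasurable ?_
    filter_upwards [hae] with ξ hξ
    rw [Real.norm_of_nonneg (hf1n ξ)]; exact hf1G ξ hξ
  have hf1int : ∫ ξ, f1 ξ ≤ C * ρ ^ (2 * s) := by
    refine le_trans (integral_mono_ae hf1i (hC ρ hρ0).1 ?_) (hC ρ hρ0).2
    filter_upwards [hae] with ξ hξ using hf1G ξ hξ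
  have hKx : ∀ x, Integrable (fun ξ => K (x - ξ)) := fun x => hKi.comp_sub_left x
  have hf1K : ∀ x, Integrable (fun ξ => f1 ξ * K (x - ξ)) := fun x =>
    (hKx x).bdd_mul hf1c.aestronglyMeasurable (Eventually.of_forall hf1b)
  have hf2K : ∀ x, Integrable (fun ξ => f2 ξ * K (x - ξ)) := fun x =>
    (hKx x).bdd_mul hf2c.aestronglyMeasurable (Eventually.of_forall hf2b)
  have hf2K' : ∀ x, Integrable (fun ξ => f2 (x - ξ) * K ξ) := fun x =>
    hKi.bdd_mul (hf2c.comp (by fun_prop)).aestronglyMeasurable (Eventually.of_forall fun ξ => hf2b _)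
  have hw : ∀ x, w1 n s cns x y = cns * y ^ (2 * s) *
      ((∫ ξ, f1 ξ * K (x - ξ)) + ∫ ξ, f2 (x - ξ) * K ξ) := by
    intro x
    have e : (∫ ξ, f2 (x - ξ) * K ξ) = ∫ ξ, f2 ξ * K (x - ξ) := by
      rw [← integral_sub_left_eq_self (fun ξ => f2 ξ * K (x - ξ)) volume x]
      simp
    rw [e, ← integral_add (hf1K x) (hf2K x)]
    simp only [w1]
    congr 1
    refine integral_congr_ae (Eventually.of_forall fun ξ => ?_)
    simp only [hf1, hK]
    ring
  have hlip2 : ∀ x ξ, ‖f2 (x - ξ) - f2 (x₀ - ξ)‖ ≤ 2 * a * ρ ^ (-(2 * a) - 1) * ‖x - x₀‖ := by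
    intro x ξ
    refine (lemA a 1 ρ ρ _ _ ha0 hρ0 hρ0.le (by linarith) zero_le_one (le_max_right _ _)
      (le_max_right _ _)).trans ?_
    gcongr
    refine (abs_max_sub_max_le_abs _ _ _).trans ?_
    simpa using abs_norm_sub_norm_le (x - ξ) (x₀ - ξ)
  apply norm_fderiv_le_of_lip' ℝ (by positivity)
  have hnear : ∀ᶠ x in 𝓝 x₀, ‖x - x₀‖ ≤ R / 4 := by
    filter_upwards [Metric.ball_mem_nhds x₀ hρ0] with x hx
    rw [Metric.mem_ball, dist_eq_norm] at hx
    exact hx.le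
  filter_upwards [hnear] with x hx
  have hA : ‖(∫ ξ, f1 ξ * K (x - ξ)) - ∫ ξ, f1 ξ * K (x₀ - ξ)‖
      ≤ C * ρ ^ (2 * s) * (2 * b * (R / 2) ^ (-(2 * b) - 1) * ‖x - x₀‖) := by
    rw [← integral_sub (hf1K x) (hf1K x₀)]
    refine (norm_integral_le_of_norm_le (hf1i.mul_const
      (2 * b * (R / 2) ^ (-(2 * b) - 1) * ‖x - x₀‖)) (Eventually.of_forall fun ξ => ?_)).trans ?_
    · rw [← mul_sub, norm_mul, Real.norm_of_nonneg (hf1n ξ)]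
      by_cases h : ‖ξ‖ ≤ ρ
      · exact mul_le_mul_of_nonneg_left (lemK b y R n hb0 hy x x₀ ξ hR hx h) (hf1n ξ)
      · simp [hf1z ξ (not_le.1 h)]
    · rw [integral_mul_const]
      gcongr
  have hB : ‖(∫ ξ, f2 (x - ξ) * K ξ) - ∫ ξ, f2 (x₀ - ξ) * K ξ‖
      ≤ (2 * a * ρ ^ (-(2 * a) - 1) * ‖x - x₀‖) * ∫ ξ, K ξ := by
    rw [← integral_sub (hf2K' x) (hf2K' x₀)]
    refine (norm_integral_le_of_norm_le (hKi.const_mul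
      (2 * a * ρ ^ (-(2 * a) - 1) * ‖x - x₀‖)) (Eventually.of_forall fun ξ => ?_)).trans ?_
    · rw [← sub_mul, norm_mul, Real.norm_of_nonneg (hK0 ξ)]
      exact mul_le_mul_of_nonneg_right (hlip2 x ξ) (hK0 ξ)
    · rw [integral_const_mul]
  have hys : y ^ (2 * s) ≤ R ^ (2 * s) := by gcongr
  have hRR : R ^ (2 * s) * R ^ (2 * s) * R ^ (-(2 * b) - 1) = R ^ (-((n:ℝ) - 2 * s) - 1) := by
    rw [← Real.rpow_add hR0, ← Real.rpow_add hR0]; congr 1; rw [hb]; ring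
  rw [hw x, hw x₀, ← mul_sub, norm_mul, Real.norm_of_nonneg (by positivity)]
  calc cns * y ^ (2 * s) * ‖_‖
      ≤ cns * y ^ (2 * s) * (C * ρ ^ (2 * s) * (2 * b * (R / 2) ^ (-(2 * b) - 1) * ‖x - x₀‖)
        + (2 * a * ρ ^ (-(2 * a) - 1) * ‖x - x₀‖) * ∫ ξ, K ξ) := by
        refine mul_le_mul_of_nonneg_left ?_ (by positivity)
        rw [add_sub_add_comm]
        exact (norm_add_le _ _).trans (add_le_add hA hB)
    _ = y ^ (2 * s) * (cns * (C * ρ ^ (2 * s) * (2 * b * (R / 2) ^ (-(2 * b) - 1) * ‖x - x₀‖)))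
        + (2 * a * ρ ^ (-(2 * a) - 1) * ‖x - x₀‖) * (cns * y ^ (2 * s) * ∫ ξ, K ξ) := by ring
    _ ≤ R ^ (2 * s) * (cns * (C * ρ ^ (2 * s) * (2 * b * (R / 2) ^ (-(2 * b) - 1) * ‖x - x₀‖)))
        + (2 * a * ρ ^ (-(2 * a) - 1) * ‖x - x₀‖) * 1 := by
        rw [hKn]; gcongr
    _ = _ := by
        rw [hρ, Real.div_rpow hR0.le (by norm_num), Real.div_rpow hR0.le (by norm_num),
          Real.div_rpow hR0.le (by norm_num), ← hRR]
        have h2 : R ^ (-(2 * a) - 1) = R ^ (2 * s) * R ^ (2 * s) * R ^ (-(2 * b) - 1) := by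
          rw [hRR]; congr 1; rw [ha]; ring
        rw [h2]
        ring
/-- Weighted gradient integrability of the standard bubble, subcritical weight
(inequality (3.6), case `σ < n - 2s`). -/
theorem bubble_weighted_integrable_subcritical
    (n : ℕ) (hn : 1 ≤ n) (s : ℝ) (hs : s ∈ Ioo (0:ℝ) 1) (hns : 2 * s < (n:ℝ))
    (cns : ℝ) (hcns : 0 < cns)
    (hnorm : ∀ y : ℝ, 0 < y →
      cns * (∫ x : Euc n, y ^ (2*s) * (‖x‖ ^ 2 + y ^ 2) ^ (-(((n:ℝ) + 2*s) / 2))) = 1)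
    (σ : ℝ) (hσ0 : 0 < σ) (hσ : σ < (n:ℝ) - 2*s) :
    (∫⁻ p in {p : Euc n × ℝ | 1 ≤ ‖p.1‖ ∧ 0 < p.2},
        ENNReal.ofReal (p.2 ^ (1 - 2*s) * ‖p.1‖ ^ σ *
          ∑ i, (pdX n (w1 n s cns) i p.1 p.2) ^ 2)) < ⊤ := by

  obtain ⟨D, hD0, hD⟩ := lemW n hn s hs hns cns hcns hnorm
  set δ : ℝ := ((n:ℝ) - 2 * s - σ) / 2 with hδ
  have hδ0 : 0 < δ := by rw [hδ]; linarith
  set A : ℝ := (n:ℝ) + σ + δ with hA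
  set B : ℝ := 2 - 2 * s + δ with hB
  have hA0 : 0 < A := by positivity
  have hB0 : 0 < B := by rw [hB]; linarith [hs.2]
  set F : Euc n → ℝ := fun x => (n * D ^ 2 * 2 ^ ((n:ℝ) + δ)) * (1 + ‖x‖) ^ (-((n:ℝ) + δ)) with hF
  set G : ℝ → ℝ := fun y => y ^ (1 - 2 * s) * (max 1 y) ^ (-B) with hG
  have hFi : Integrable F := by
    refine (integrable_one_add_norm ?_).const_mul _
    simp [hδ0]
  have hGi : IntegrableOn G (Ioi 0) := lemC s δ hs.2 hδ0
  have hFG : Integrable (fun p : Euc n × ℝ => F p.1 * G p.2)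
      ((volume : Measure (Euc n)).prod (volume.restrict (Ioi 0))) := hFi.mul_prod hGi
  have hrest : (volume : Measure (Euc n)).prod (volume.restrict (Ioi (0:ℝ)))
      = (volume : Measure (Euc n × ℝ)).restrict (univ ×ˢ Ioi 0) := by
    rw [Measure.volume_eq_prod, ← Measure.prod_restrict, Measure.restrict_univ]
  rw [hrest] at hFG
  have hms : MeasurableSet {p : Euc n × ℝ | 1 ≤ ‖p.1‖ ∧ 0 < p.2} :=
    ((measurableSet_le measurable_const (measurable_fst.norm) :
        MeasurableSet {p : Euc n × ℝ | 1 ≤ ‖p.1‖})).inter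
      (measurableSet_lt measurable_const measurable_snd :
        MeasurableSet {p : Euc n × ℝ | 0 < p.2})
  have hFG' : IntegrableOn (fun p : Euc n × ℝ => F p.1 * G p.2)
      {p : Euc n × ℝ | 1 ≤ ‖p.1‖ ∧ 0 < p.2} :=
    IntegrableOn.mono_set hFG (fun p hp => ⟨mem_univ _, hp.2⟩)
  have hpt : ∀ p ∈ {p : Euc n × ℝ | 1 ≤ ‖p.1‖ ∧ 0 < p.2},
      ENNReal.ofReal (p.2 ^ (1 - 2*s) * ‖p.1‖ ^ σ *
          ∑ i, (pdX n (w1 n s cns) i p.1 p.2) ^ 2) ≤ ENNReal.ofReal (F p.1 * G p.2) := by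
    rintro ⟨x, y⟩ ⟨hx, hy⟩
    simp only at hx hy ⊢
    apply ENNReal.ofReal_le_ofReal
    set R : ℝ := max ‖x‖ y with hR
    have hx0 : 0 < ‖x‖ := by linarith
    have hRx : ‖x‖ ≤ R := le_max_left _ _
    have hR0 : 0 < R := by linarith
    have hR1 : max 1 y ≤ R := max_le_max_right y hx
    have hpd : ∀ i, (pdX n (w1 n s cns) i x y) ^ 2 ≤ D ^ 2 * R ^ (-(A + B)) := by
      intro i
      have h1 : |pdX n (w1 n s cns) i x y| ≤ D * R ^ (-((n:ℝ) - 2 * s) - 1) := by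
        refine le_trans ?_ (hD x y hy)
        have := (fderiv ℝ (fun x' => w1 n s cns x' y) x).le_opNorm (EuclideanSpace.single i 1)
        simpa [pdX] using this
      rw [← sq_abs]
      refine (pow_le_pow_left₀ (abs_nonneg _) h1 2).trans (le_of_eq ?_)
      rw [mul_pow, ← Real.rpow_natCast (R ^ _), ← Real.rpow_mul hR0.le]
      congr 2
      rw [hA, hB, hδ]; push_cast; ring
    have hsum : ∑ i, (pdX n (w1 n s cns) i x y) ^ 2 ≤ n * (D ^ 2 * R ^ (-(A + B))) := by
      refine (Finset.sum_le_sum fun i _ => hpd i).trans ?_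
      simp
    have hRs : R ^ (-(A + B)) ≤ ‖x‖ ^ (-A) * (max 1 y) ^ (-B) := by
      rw [neg_add, Real.rpow_add hR0]
      have i1 : R ^ (-A) ≤ ‖x‖ ^ (-A) := Real.rpow_le_rpow_of_nonpos hx0 hRx (by linarith)
      have i2 : R ^ (-B) ≤ (max 1 y) ^ (-B) :=
        Real.rpow_le_rpow_of_nonpos (lt_of_lt_of_le one_pos (le_max_left _ _)) hR1 (by linarith)
      gcongr
    have hxF : ‖x‖ ^ σ * ‖x‖ ^ (-A) ≤ 2 ^ ((n:ℝ) + δ) * (1 + ‖x‖) ^ (-((n:ℝ) + δ)) := by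
      rw [← Real.rpow_add hx0, show σ + -A = -((n:ℝ) + δ) by rw [hA]; ring]
      have e : ‖x‖ ^ (-((n:ℝ) + δ)) = 2 ^ ((n:ℝ) + δ) * (2 * ‖x‖) ^ (-((n:ℝ) + δ)) := by
        rw [Real.mul_rpow (by norm_num) hx0.le, ← mul_assoc, ← Real.rpow_add (by norm_num)]
        simp
      rw [e]
      refine mul_le_mul_of_nonneg_left ?_ (by positivity)
      have : 0 ≤ (n:ℝ) := Nat.cast_nonneg n
      exact Real.rpow_le_rpow_of_nonpos (by positivity) (by linarith) (by linarith)
    have hm0 : 0 ≤ (max 1 y) ^ (-B) := by positivity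
    calc y ^ (1 - 2 * s) * ‖x‖ ^ σ * ∑ i, (pdX n (w1 n s cns) i x y) ^ 2
        ≤ y ^ (1 - 2 * s) * ‖x‖ ^ σ * (n * (D ^ 2 * (‖x‖ ^ (-A) * (max 1 y) ^ (-B)))) := by
          refine mul_le_mul_of_nonneg_left (hsum.trans ?_) (by positivity)
          gcongr
      _ = (n * D ^ 2 * (y ^ (1 - 2 * s) * (max 1 y) ^ (-B))) * (‖x‖ ^ σ * ‖x‖ ^ (-A)) := by ring
      _ ≤ (n * D ^ 2 * (y ^ (1 - 2 * s) * (max 1 y) ^ (-B))) *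
          (2 ^ ((n:ℝ) + δ) * (1 + ‖x‖) ^ (-((n:ℝ) + δ))) := by gcongr
      _ = F x * G y := by simp only [hF, hG]; ring
  have hlt : (∫⁻ p in {p : Euc n × ℝ | 1 ≤ ‖p.1‖ ∧ 0 < p.2},
      ENNReal.ofReal (F p.1 * G p.2)) < ⊤ := hFG'.lintegral_lt_top
  have hle := setLIntegral_mono' (μ := (volume : Measure (Euc n × ℝ))) hms hpt
  exact lt_of_le_of_lt hle hlt
end
end

section
/- Weighted gradient integrability of the standard bubble, critical weight (inequality (3.6), case σ = n−2s): Let σ = n−2s. There exists a constant C > 0 such that for every R ≥ 2: ∫∫_{{(x,y): |x| ≥ 1, y > 0, |x|² + y² ≤ R²}} y^{1−2s} |x|^σ |∇_x w₁(x,y)|² dx dy ≤ C log R, where ∇_x denotes the gradient in the x variables only. -/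
open MeasureTheory Filter Set Topology

noncomputable section

lemma gam (α c : ℝ) (hα : 0 < α) (hc : 0 < c) :
    ∫⁻ t in Ioi (0:ℝ), ENNReal.ofReal (t ^ (α - 1) * Real.exp (-(c * t)))
      = ENNReal.ofReal (Real.Gamma α * c ^ (-α)) := by
  have h := Real.integral_rpow_mul_exp_neg_mul_Ioi hα hc
  have hG := Real.Gamma_pos_of_pos hα
  have hi : Integrable (fun t : ℝ => t ^ (α - 1) * Real.exp (-(c * t)))
      (volume.restrict (Ioi 0)) := by
    by_contra hcon
    rw [integral_undef hcon] at h
    have : 0 < (1 / c) ^ α * Real.Gamma α := by positivity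
    linarith
  rw [← ofReal_integral_eq_lintegral_ofReal hi, h]
  · congr 1
    rw [Real.rpow_neg hc.le, one_div, Real.inv_rpow hc.le]; ring
  · filter_upwards [self_mem_ae_restrict measurableSet_Ioi] with t ht
    have : (0:ℝ) < t := ht
    simp only [Pi.zero_apply]; positivity

lemma beta (α β A B : ℝ) (hα : -1 < α) (hβ : α + 1 < β) (hA : 0 < A) (hB : 0 < B) :
    ∫⁻ v in Ioi (0:ℝ), ENNReal.ofReal (v ^ α * (A + v * B) ^ (-β))
      = ENNReal.ofReal (Real.Gamma (α + 1) * Real.Gamma (β - α - 1) / Real.Gamma β *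
          A ^ (α + 1 - β) * B ^ (-α - 1)) := by
  have hG := Real.Gamma_pos_of_pos (show 0 < β by linarith)
  have hG1 := Real.Gamma_pos_of_pos (show 0 < α + 1 by linarith)
  have h1 : ∀ v ∈ Ioi (0:ℝ), ENNReal.ofReal (v ^ α * (A + v * B) ^ (-β)) =
      ∫⁻ τ in Ioi (0:ℝ), ENNReal.ofReal ((Real.Gamma β)⁻¹ * v ^ α * τ ^ (β - 1) *
        Real.exp (-(τ * (A + v * B)))) := by
    intro v hv
    have hv : 0 < v := hv
    have := gam β (A + v * B) (by linarith) (by positivity)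
    calc _ = ENNReal.ofReal ((Real.Gamma β)⁻¹ * v ^ α) *
        ENNReal.ofReal (Real.Gamma β * (A + v * B) ^ (-β)) := by
          rw [← ENNReal.ofReal_mul (by positivity)]
          congr 1; field_simp
      _ = _ := by
          rw [← this, ← lintegral_const_mul' _ _ ENNReal.ofReal_ne_top]
          refine lintegral_congr fun τ => ?_
          rw [← ENNReal.ofReal_mul (by positivity)]
          congr 1
          rw [mul_comm τ]; ring
  rw [setLIntegral_congr_fun measurableSet_Ioi h1, lintegral_lintegral_swap]
  swap
  · apply Measurable.aemeasurable; fun_prop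
  have h2 : ∀ τ ∈ Ioi (0:ℝ), ∫⁻ v in Ioi (0:ℝ),
      ENNReal.ofReal ((Real.Gamma β)⁻¹ * v ^ α * τ ^ (β - 1) *
        Real.exp (-(τ * (A + v * B)))) =
      ENNReal.ofReal ((Real.Gamma β)⁻¹ * Real.Gamma (α + 1) * B ^ (-α-1)) *
       ENNReal.ofReal (τ ^ ((β - α - 1) - 1) * Real.exp (-(A * τ))) := by
    intro τ hτ
    have hτ : 0 < τ := hτ
    have := gam (α+1) (τ * B) (by linarith) (by positivity)
    calc _ = ∫⁻ v in Ioi (0:ℝ), ENNReal.ofReal ((Real.Gamma β)⁻¹ * τ ^ (β - 1) *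
        Real.exp (-(A * τ))) * ENNReal.ofReal (v ^ (α + 1 - 1) * Real.exp (-(τ * B * v))) := by
          refine lintegral_congr fun v => ?_
          rw [← ENNReal.ofReal_mul (by positivity)]
          congr 1
          rw [show -(τ * (A + v * B)) = -(A * τ) + -(τ * B * v) by ring, Real.exp_add,
            show α + 1 - 1 = α by ring]
          ring
      _ = _ := by
          rw [lintegral_const_mul' _ _ ENNReal.ofReal_ne_top, this,
            ← ENNReal.ofReal_mul (by positivity), ← ENNReal.ofReal_mul (by positivity)]
          congr 1
          rw [Real.mul_rpow hτ.le hB.le, show β - α - 1 - 1 = (β - 1) + (-(α + 1)) by ring,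
            Real.rpow_add hτ, show -α-1 = -(α+1) by ring]
          ring
  rw [setLIntegral_congr_fun measurableSet_Ioi h2, lintegral_const_mul' _ _ ENNReal.ofReal_ne_top,
    gam _ _ (by linarith) hA, ← ENNReal.ofReal_mul (by positivity)]
  congr 1
  rw [show -(β - α - 1) = α + 1 - β by ring]
  field_simp

lemma gconv (n : ℕ) (τ v : ℝ) (hτ : 0 < τ) (hv : 0 < v) (x : Euc n) :
    ∫⁻ ξ : Euc n, ENNReal.ofReal (Real.exp (-(τ * (v * ‖ξ‖^2 + ‖x - ξ‖^2))))
      = ENNReal.ofReal ((Real.pi / (τ * (1 + v))) ^ ((n:ℝ)/2) *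
          Real.exp (-(τ * (v/(1+v)) * ‖x‖^2))) := by
  have hb : 0 < τ * (1 + v) := by positivity
  have h := GaussianFourier.integral_rexp_neg_mul_sq_norm (V := Euc n) hb
  have hi : Integrable (fun ξ : Euc n => Real.exp (-(τ * (1+v)) * ‖ξ‖^2)) := by
    by_contra hcon
    rw [integral_undef hcon] at h
    have : 0 < (Real.pi / (τ * (1 + v))) ^ ((Module.finrank ℝ (Euc n) : ℝ) / 2) := by positivity
    linarith
  have h3 : ∀ ξ : Euc n, ENNReal.ofReal (Real.exp (-(τ * (v * ‖ξ‖^2 + ‖x - ξ‖^2)))) =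
      ENNReal.ofReal (Real.exp (-(τ * (v/(1+v)) * ‖x‖^2))) *
      ENNReal.ofReal (Real.exp (-(τ * (1+v)) * ‖ξ - (1+v)⁻¹ • x‖^2)) := by
    intro ξ
    rw [← ENNReal.ofReal_mul (by positivity), ← Real.exp_add]
    congr 2
    rw [norm_sub_sq_real, norm_sub_sq_real, norm_smul, inner_smul_right, real_inner_comm x ξ]
    rw [Real.norm_of_nonneg (by positivity)]
    field_simp
    ring
  simp_rw [h3]
  rw [lintegral_const_mul' _ _ ENNReal.ofReal_ne_top,
    lintegral_sub_right_eq_self (fun ξ : Euc n => ENNReal.ofReal (Real.exp (-(τ * (1+v)) * ‖ξ‖^2))),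
    ← ofReal_integral_eq_lintegral_ofReal hi (ae_of_all _ fun _ => by positivity), h,
    ← ENNReal.ofReal_mul (by positivity)]
  congr 1
  simp [mul_comm]

/-- Weight in the double Gaussian representation. -/
def gw (n : ℕ) (a y τ v : ℝ) : ℝ :=
  τ ^ ((n:ℝ) - 1) * v ^ (a - 1) * (Real.pi / (τ * (1 + v))) ^ ((n:ℝ)/2) *
    Real.exp (-(τ * (v + y^2)))

/-- Profile of the extension as a function of `|x|^2`. -/
def Jf (n : ℕ) (a y p : ℝ) : ENNReal :=
  ∫⁻ τ in Ioi (0:ℝ), ∫⁻ v in Ioi (0:ℝ),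
    ENNReal.ofReal (gw n a y τ v * Real.exp (-(τ * (v/(1+v)) * p)))

lemma rep (n : ℕ) (a b y : ℝ) (ha : 0 < a) (hb : 0 < b) (hab : a + b = n) (hy : 0 < y)
    (x : Euc n) :
    ∫⁻ ξ : Euc n, ENNReal.ofReal ((1 + ‖ξ‖^2) ^ (-a) * (‖x - ξ‖^2 + y^2) ^ (-b)) =
    ENNReal.ofReal ((Real.Gamma a * Real.Gamma b)⁻¹) * Jf n a y (‖x‖^2) := by
  have hGa := Real.Gamma_pos_of_pos ha
  have hGb := Real.Gamma_pos_of_pos hb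
  have h1 : ∀ ξ : Euc n, ENNReal.ofReal ((1 + ‖ξ‖^2) ^ (-a) * (‖x - ξ‖^2 + y^2) ^ (-b)) =
      ENNReal.ofReal ((Real.Gamma a * Real.Gamma b)⁻¹) *
      ∫⁻ τ in Ioi (0:ℝ), ∫⁻ v in Ioi (0:ℝ), ENNReal.ofReal (τ ^ ((n:ℝ) - 1) * v ^ (a-1) *
        Real.exp (-(τ * (v * (1 + ‖ξ‖^2) + ‖x - ξ‖^2 + y^2)))) := by
    intro ξ
    have h2 : ∀ τ ∈ Ioi (0:ℝ), ∫⁻ v in Ioi (0:ℝ), ENNReal.ofReal (τ ^ ((n:ℝ) - 1) * v ^ (a-1) *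
        Real.exp (-(τ * (v * (1 + ‖ξ‖^2) + ‖x - ξ‖^2 + y^2)))) =
        ENNReal.ofReal (Real.Gamma a * (1 + ‖ξ‖^2) ^ (-a)) *
        ENNReal.ofReal (τ ^ (b - 1) * Real.exp (-((‖x - ξ‖^2 + y^2) * τ))) := by
      intro τ hτ
      have hτ : 0 < τ := hτ
      have h3 := gam a (τ * (1 + ‖ξ‖^2)) ha (by positivity)
      calc _ = ∫⁻ v in Ioi (0:ℝ), ENNReal.ofReal (τ ^ ((n:ℝ) - 1) *
            Real.exp (-((‖x - ξ‖^2 + y^2) * τ))) *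
            ENNReal.ofReal (v ^ (a - 1) * Real.exp (-(τ * (1 + ‖ξ‖^2) * v))) := by
            refine lintegral_congr fun v => ?_
            rw [← ENNReal.ofReal_mul (by positivity)]
            congr 1
            rw [show -(τ * (v * (1 + ‖ξ‖^2) + ‖x - ξ‖^2 + y^2)) =
              -((‖x - ξ‖^2 + y^2) * τ) + -(τ * (1 + ‖ξ‖^2) * v) by ring, Real.exp_add]
            ring
        _ = _ := by
            rw [lintegral_const_mul' _ _ ENNReal.ofReal_ne_top, h3,
              ← ENNReal.ofReal_mul (by positivity), ← ENNReal.ofReal_mul (by positivity)]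
            congr 1
            rw [Real.mul_rpow hτ.le (by positivity),
              show b - 1 = ((n:ℝ) - 1) + (-a) by linarith, Real.rpow_add hτ]
            ring
    rw [setLIntegral_congr_fun measurableSet_Ioi h2,
      lintegral_const_mul' _ _ ENNReal.ofReal_ne_top, gam _ _ hb (by positivity),
      ← ENNReal.ofReal_mul (by positivity), ← ENNReal.ofReal_mul (by positivity)]
    congr 1
    field_simp
  have hmeas : Measurable (fun q : (Euc n × ℝ) × ℝ =>
      ENNReal.ofReal (q.1.2 ^ ((n:ℝ) - 1) * q.2 ^ (a-1) *
        Real.exp (-(q.1.2 * (q.2 * (1 + ‖q.1.1‖^2) + ‖x - q.1.1‖^2 + y^2))))) := by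
    fun_prop
  simp_rw [h1]
  rw [lintegral_const_mul' _ _ ENNReal.ofReal_ne_top]
  congr 1
  rw [lintegral_lintegral_swap (hmeas.lintegral_prod_right'.aemeasurable)]
  refine setLIntegral_congr_fun measurableSet_Ioi fun τ hτ => ?_
  have hτ : 0 < τ := hτ
  rw [lintegral_lintegral_swap]
  swap
  · apply Measurable.aemeasurable; fun_prop
  refine setLIntegral_congr_fun measurableSet_Ioi fun v hv => ?_
  have hv : 0 < v := hv
  have h4 := gconv n τ v hτ hv x
  calc _ = ∫⁻ ξ : Euc n, ENNReal.ofReal (τ ^ ((n:ℝ) - 1) * v ^ (a - 1) *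
            Real.exp (-(τ * (v + y^2)))) *
            ENNReal.ofReal (Real.exp (-(τ * (v * ‖ξ‖^2 + ‖x - ξ‖^2)))) := by
          refine lintegral_congr fun ξ => ?_
          rw [← ENNReal.ofReal_mul (by positivity)]
          congr 1
          rw [mul_assoc _ (Real.exp _), ← Real.exp_add]
          congr 2
          ring
    _ = _ := by
          rw [lintegral_const_mul' _ _ ENNReal.ofReal_ne_top, h4,
            ← ENNReal.ofReal_mul (by positivity)]
          congr 1
          unfold gw
          ring

lemma gw_nonneg (n : ℕ) (a y τ v : ℝ) (hτ : 0 < τ) (hv : 0 < v) : 0 ≤ gw n a y τ v := by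
  unfold gw; positivity

lemma Jf_anti (n : ℕ) (a y p q : ℝ) (hpq : p ≤ q) : Jf n a y q ≤ Jf n a y p := by
  refine setLIntegral_mono' measurableSet_Ioi fun τ hτ => ?_
  refine setLIntegral_mono' measurableSet_Ioi fun v hv => ?_
  have hτ : 0 < τ := hτ
  have hv : 0 < v := hv
  have := gw_nonneg n a y τ v hτ hv
  gcongr

lemma Jf_lip (n : ℕ) (a y p q : ℝ) (ha : 0 < a) (han : a < n / 2) (hy : 0 < y)
    (hp : 0 ≤ p) (hpq : p ≤ q) :
    Jf n a y p ≤ Jf n a y q + ENNReal.ofReal ((q - p) * (Real.pi ^ ((n:ℝ)/2) *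
      (Real.Gamma (a + 1) * Real.Gamma (n/2 - a)) * (y^2) ^ (a - n/2) * (p + y^2) ^ (-a-1))) := by
  have hGa := Real.Gamma_pos_of_pos (show 0 < a + 1 by linarith)
  have hGb := Real.Gamma_pos_of_pos (show 0 < (n:ℝ)/2 - a by linarith)
  have hGn := Real.Gamma_pos_of_pos (show 0 < (n:ℝ)/2 + 1 by positivity)
  have hqp : 0 ≤ q - p := by linarith
  set F : ℝ → ℝ → ℝ := fun τ v => (q - p) * Real.pi ^ ((n:ℝ)/2) * v ^ a *
    (1 + v) ^ (-((n:ℝ)/2 + 1)) * (τ ^ ((n:ℝ)/2 + 1 - 1) *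
      Real.exp (-((y^2 + v/(1+v)*p) * τ))) with hF
  have hFm : Measurable (Function.uncurry F) := by
    simp only [hF]; unfold Function.uncurry; fun_prop
  have hgm : Measurable (Function.uncurry fun τ v => 
      gw n a y τ v * Real.exp (-(τ * (v/(1+v)) * q))) := by
    unfold gw Function.uncurry; fun_prop
  have key : ∀ τ > 0, ∀ v > 0, gw n a y τ v * Real.exp (-(τ * (v/(1+v)) * p)) ≤
      gw n a y τ v * Real.exp (-(τ * (v/(1+v)) * q)) + F τ v := by
    intro τ hτ v hv
    have hg := gw_nonneg n a y τ v hτ hv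
    have e1 : Real.exp (-(τ * (v/(1+v)) * p)) ≤ Real.exp (-(τ * (v/(1+v)) * q)) +
        (q - p) * (τ * (v/(1+v))) * Real.exp (-(τ * (v/(1+v)) * p)) := by
      have : Real.exp (-(τ * (v/(1+v)) * q)) =
        Real.exp (-(τ * (v/(1+v)) * p)) * Real.exp (-(τ * (v/(1+v)) * (q - p))) := by
        rw [← Real.exp_add]; ring_nf
      rw [this]
      have h2 := Real.add_one_le_exp (-(τ * (v/(1+v)) * (q - p)))
      have h3 := Real.exp_pos (-(τ * (v/(1+v)) * p))
      nlinarith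
    have e2 : gw n a y τ v * ((q - p) * (τ * (v/(1+v))) * Real.exp (-(τ * (v/(1+v)) * p)))
        ≤ F τ v := by
      have t1 : gw n a y τ v * ((q - p) * (τ * (v/(1+v))) * Real.exp (-(τ * (v/(1+v)) * p)))
          = F τ v * Real.exp (-(τ * v)) := by
        simp only [hF, gw]
        rw [Real.div_rpow Real.pi_pos.le (by positivity), Real.mul_rpow hτ.le (by positivity),
          Real.rpow_neg (by positivity), Real.rpow_add (by positivity) ((n:ℝ)/2) 1, Real.rpow_one,
          show τ ^ ((n:ℝ)/2 + 1 - 1) = τ ^ ((n:ℝ) - 1) * τ / τ ^ ((n:ℝ)/2) by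
            rw [← Real.rpow_add_one hτ.ne', ← Real.rpow_sub hτ]; ring_nf,
          show (-(τ * (v + y^2))) = -(τ * v) + -(τ * y^2) by ring, Real.exp_add,
          show (-((y^2 + v/(1+v)*p) * τ)) = -(τ * y^2) + -(τ * (v/(1+v)) * p) by ring,
          Real.exp_add, show v ^ a = v ^ (a - 1) * v by
            rw [← Real.rpow_add_one hv.ne']; ring_nf]
        field_simp
      rw [t1]
      have : Real.exp (-(τ * v)) ≤ 1 := Real.exp_le_one_iff.2 (by have := mul_pos hτ hv; linarith)
      have hF0 : 0 ≤ F τ v := by simp only [hF]; positivity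
      exact mul_le_of_le_one_right hF0 this
    calc _ ≤ gw n a y τ v * (Real.exp (-(τ * (v/(1+v)) * q)) +
        (q - p) * (τ * (v/(1+v))) * Real.exp (-(τ * (v/(1+v)) * p))) := by gcongr
      _ ≤ _ := by rw [mul_add]; gcongr
  have hFint : ∫⁻ τ in Ioi (0:ℝ), ∫⁻ v in Ioi (0:ℝ), ENNReal.ofReal (F τ v) =
      ENNReal.ofReal ((q - p) * (Real.pi ^ ((n:ℝ)/2) *
      (Real.Gamma (a + 1) * Real.Gamma (n/2 - a)) * (y^2) ^ (a - n/2) *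
        (p + y^2) ^ (-a-1))) := by
    rw [lintegral_lintegral_swap (hFm.ennreal_ofReal.aemeasurable)]
    have h2 : ∀ v ∈ Ioi (0:ℝ), ∫⁻ τ in Ioi (0:ℝ), ENNReal.ofReal (F τ v) =
        ENNReal.ofReal ((q - p) * Real.pi ^ ((n:ℝ)/2) * Real.Gamma ((n:ℝ)/2 + 1)) *
        ENNReal.ofReal (v ^ a * (y^2 + v * (p + y^2)) ^ (-((n:ℝ)/2 + 1))) := by
      intro v hv
      have hv : 0 < v := hv
      have h3 := gam ((n:ℝ)/2 + 1) (y^2 + v/(1+v)*p) (by positivity) (by positivity)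
      calc _ = ∫⁻ τ in Ioi (0:ℝ), ENNReal.ofReal ((q - p) * Real.pi ^ ((n:ℝ)/2) * v ^ a *
            (1 + v) ^ (-((n:ℝ)/2 + 1))) * ENNReal.ofReal ((τ ^ ((n:ℝ)/2 + 1 - 1) *
            Real.exp (-((y^2 + v/(1+v)*p) * τ)))) := by
            refine lintegral_congr fun τ => ?_
            rw [← ENNReal.ofReal_mul (by positivity)]
        _ = _ := by
            rw [lintegral_const_mul' _ _ ENNReal.ofReal_ne_top, h3,
              ← ENNReal.ofReal_mul (by positivity), ← ENNReal.ofReal_mul (by positivity)]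
            congr 1
            rw [show y^2 + v * (p + y^2) = (1 + v) * (y^2 + v/(1+v)*p) by field_simp; ring,
              Real.mul_rpow (by positivity) (by positivity)]
            ring
    rw [setLIntegral_congr_fun measurableSet_Ioi h2,
      lintegral_const_mul' _ _ ENNReal.ofReal_ne_top,
      beta a ((n:ℝ)/2 + 1) (y^2) (p + y^2) (by linarith) (by linarith) (by positivity)
        (by positivity), ← ENNReal.ofReal_mul (by positivity)]
    congr 1
    rw [show (n:ℝ)/2 + 1 - a - 1 = n/2 - a by ring, show a + 1 - ((n:ℝ)/2 + 1) = a - n/2 by ring]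
    field_simp
  rw [← hFint]
  calc Jf n a y p ≤ ∫⁻ τ in Ioi (0:ℝ), ∫⁻ v in Ioi (0:ℝ),
      (ENNReal.ofReal (gw n a y τ v * Real.exp (-(τ * (v/(1+v)) * q))) +
        ENNReal.ofReal (F τ v)) := by
        refine setLIntegral_mono' measurableSet_Ioi fun τ hτ => ?_
        refine setLIntegral_mono' measurableSet_Ioi fun v hv => ?_
        exact (ENNReal.ofReal_le_ofReal (key τ hτ v hv)).trans ENNReal.ofReal_add_le
    _ = ∫⁻ τ in Ioi (0:ℝ), ((∫⁻ v in Ioi (0:ℝ),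
      (ENNReal.ofReal (gw n a y τ v * Real.exp (-(τ * (v/(1+v)) * q))))) +
        ∫⁻ v in Ioi (0:ℝ), ENNReal.ofReal (F τ v)) := by
        refine lintegral_congr fun τ => ?_
        rw [lintegral_add_right]
        exact (hFm.comp measurable_prodMk_left).ennreal_ofReal
    _ = _ := by
        rw [lintegral_add_right]
        · rfl
        · exact (hFm.ennreal_ofReal).lintegral_prod_right'

lemma Jf_lip_real (n : ℕ) (a y p q : ℝ) (ha : 0 < a) (han : a < n / 2) (hy : 0 < y)
    (hp : 0 ≤ p) (hpq : p ≤ q) :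
    |(Jf n a y p).toReal - (Jf n a y q).toReal| ≤ (q - p) * (Real.pi ^ ((n:ℝ)/2) *
      (Real.Gamma (a + 1) * Real.Gamma (n/2 - a)) * (y^2) ^ (a - n/2) * (p + y^2) ^ (-a-1)) := by
  have hGa := Real.Gamma_pos_of_pos (show 0 < a + 1 by linarith)
  have hGb := Real.Gamma_pos_of_pos (show 0 < (n:ℝ)/2 - a by linarith)
  have hqp : 0 ≤ q - p := by linarith
  have h1 := Jf_anti n a y p q hpq
  have h2 := Jf_lip n a y p q ha han hy hp hpq
  set Δ := (q - p) * (Real.pi ^ ((n:ℝ)/2) *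
      (Real.Gamma (a + 1) * Real.Gamma (n/2 - a)) * (y^2) ^ (a - n/2) * (p + y^2) ^ (-a-1))
  have hΔ : 0 ≤ Δ := by positivity
  by_cases hq : Jf n a y q = ⊤
  · have hp' : Jf n a y p = ⊤ := top_le_iff.1 (hq ▸ h1)
    simp [hq, hp', hΔ]
  · have hfin : Jf n a y q + ENNReal.ofReal Δ ≠ ⊤ := by simp [hq]
    have hpt : Jf n a y p ≠ ⊤ := ne_top_of_le_ne_top hfin h2
    have h3 := ENNReal.toReal_mono hpt h1
    have h4 := ENNReal.toReal_mono hfin h2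
    rw [ENNReal.toReal_add hq ENNReal.ofReal_ne_top, ENNReal.toReal_ofReal hΔ] at h4
    rw [abs_of_nonneg (by linarith)]; linarith

lemma radial (n : ℕ) (hn : 1 ≤ n) : ∃ C > (0:ℝ), ∀ R : ℝ, 2 ≤ R →
    ∫⁻ x in {x : Euc n | 1 ≤ ‖x‖ ∧ ‖x‖ ≤ R}, ENNReal.ofReal (‖x‖ ^ (-(n:ℝ))) =
      ENNReal.ofReal (C * Real.log R) := by
  have : Nonempty (Fin n) := ⟨⟨0, hn⟩⟩
  have : Nontrivial (Euc n) := inferInstance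
  refine ⟨n * volume.real (Metric.ball (0 : Euc n) 1), ?_, fun R hR => ?_⟩
  · have : 0 < volume.real (Metric.ball (0 : Euc n) 1) :=
      ENNReal.toReal_pos (Metric.measure_ball_pos _ _ one_pos).ne' measure_ball_lt_top.ne
    positivity
  set f : ℝ → ℝ := (Icc 1 R).indicator (fun r => r ^ (-(n:ℝ))) with hf
  have hms : MeasurableSet {x : Euc n | 1 ≤ ‖x‖ ∧ ‖x‖ ≤ R} :=
    (measurableSet_le measurable_const measurable_norm).inter
      (measurableSet_le measurable_norm measurable_const)
  have e1 : ∀ y : ℝ, y ^ (Module.finrank ℝ (Euc n) - 1) • f y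
      = (Icc 1 R).indicator (fun r => r⁻¹) y := by
    intro y
    by_cases hy : y ∈ Icc 1 R
    · have hy0 : 0 < y := by linarith [hy.1]
      simp only [hf, indicator_of_mem hy, finrank_euclideanSpace, Fintype.card_fin, smul_eq_mul]
      rw [← Real.rpow_natCast, ← Real.rpow_add hy0, Nat.cast_sub hn, ← Real.rpow_neg_one]
      congr 1; push_cast; ring
    · simp [hf, indicator_of_notMem hy]
  have hint0 : IntegrableOn (fun r : ℝ => r⁻¹) (Icc 1 R) := by
    apply ContinuousOn.integrableOn_Icc
    intro r hr
    exact (continuousAt_inv₀ (by linarith [hr.1])).continuousWithinAt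
  have hint : Integrable (fun x : Euc n => f ‖x‖) := by
    rw [integrable_fun_norm_addHaar volume]
    simp_rw [e1]
    exact ((integrable_indicator_iff measurableSet_Icc).2 hint0).integrableOn
  have hval : ∫ x : Euc n, f ‖x‖ = n * volume.real (Metric.ball (0 : Euc n) 1) * Real.log R := by
    rw [integral_fun_norm_addHaar volume f]
    simp_rw [e1]
    rw [setIntegral_indicator measurableSet_Icc,
      show Ioi (0:ℝ) ∩ Icc 1 R = Icc 1 R from inter_eq_right.2 fun r hr => by
        have := hr.1; simp only [mem_Ioi]; linarith,
      integral_Icc_eq_integral_Ioc, ← intervalIntegral.integral_of_le (by linarith),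
      integral_inv_of_pos one_pos (by linarith)]
    simp [mul_assoc]
  rw [← hval, ofReal_integral_eq_lintegral_ofReal hint, ← lintegral_indicator hms]
  · refine lintegral_congr fun x => ?_
    by_cases hx : x ∈ {x : Euc n | 1 ≤ ‖x‖ ∧ ‖x‖ ≤ R}
    · rw [indicator_of_mem hx, hf, indicator_of_mem (show ‖x‖ ∈ Icc 1 R from hx)]
    · rw [indicator_of_notMem hx, hf, indicator_of_notMem (show ‖x‖ ∉ Icc 1 R from hx)]; simp
  · refine ae_of_all _ fun x => ?_
    refine indicator_nonneg (fun r hr => ?_) _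
    have : 0 ≤ r := by linarith [hr.1]
    positivity

lemma Jf_lip_sym (n : ℕ) (a y m p q : ℝ) (ha : 0 < a) (han : a < n / 2) (hy : 0 < y)
    (hm : 0 ≤ m) (hp : m ≤ p) (hq : m ≤ q) :
    |(Jf n a y p).toReal - (Jf n a y q).toReal| ≤ |p - q| * (Real.pi ^ ((n:ℝ)/2) *
      (Real.Gamma (a + 1) * Real.Gamma (n/2 - a)) * (y^2) ^ (a - n/2) * (m + y^2) ^ (-a-1)) := by
  have hGa := Real.Gamma_pos_of_pos (show 0 < a + 1 by linarith)
  have hGb := Real.Gamma_pos_of_pos (show 0 < (n:ℝ)/2 - a by linarith)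
  have hmono : ∀ t, m ≤ t → (t + y^2) ^ (-a-1) ≤ (m + y^2) ^ (-a-1) := fun t ht =>
    Real.rpow_le_rpow_of_nonpos (by positivity) (by linarith) (by linarith)
  rcases le_total p q with h | h
  · refine (Jf_lip_real n a y p q ha han hy (by linarith) h).trans ?_
    rw [abs_of_nonpos (by linarith : p - q ≤ 0), neg_sub]
    have := hmono p hp
    have h0 : 0 ≤ q - p := by linarith
    gcongr
  · rw [abs_sub_comm]
    refine (Jf_lip_real n a y q p ha han hy (by linarith) h).trans ?_
    have h0 : 0 ≤ p - q := by linarith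
    rw [abs_of_nonneg h0]
    have := hmono q hq
    gcongr

lemma w1_eq (n : ℕ) (s cns : ℝ) (hs : s ∈ Ioo (0:ℝ) 1) (hns : 2 * s < (n:ℝ)) (y : ℝ) (hy : 0 < y)
    (x : Euc n) : w1 n s cns x y = cns * y ^ (2*s) *
      ((Real.Gamma (((n:ℝ) - 2*s)/2) * Real.Gamma (((n:ℝ) + 2*s)/2))⁻¹ *
        (Jf n (((n:ℝ) - 2*s)/2) y (‖x‖^2)).toReal) := by
  have hs0 := hs.1
  have ha : 0 < ((n:ℝ) - 2*s)/2 := by linarith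
  have hb : 0 < ((n:ℝ) + 2*s)/2 := by positivity
  have hGa := Real.Gamma_pos_of_pos ha
  have hGb := Real.Gamma_pos_of_pos hb
  unfold w1 u1
  congr 1
  rw [integral_eq_lintegral_of_nonneg_ae, rep n _ _ y ha hb (by ring) hy x, ENNReal.toReal_mul,
    ENNReal.toReal_ofReal (by positivity)]
  · exact ae_of_all _ fun ξ => by simp only [Pi.zero_apply]; positivity
  · apply Measurable.aestronglyMeasurable; fun_prop

lemma grad_bound_s9 (n : ℕ) (s : ℝ) (hs : s ∈ Ioo (0:ℝ) 1) (hns : 2 * s < (n:ℝ))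
    (cns : ℝ) (hcns : 0 < cns) : ∃ K > (0:ℝ), ∀ (x : Euc n) (y : ℝ), 1 ≤ ‖x‖ → 0 < y →
      ‖fderiv ℝ (fun x' => w1 n s cns x' y) x‖ ≤
        K * ‖x‖ * (‖x‖^2 + y^2) ^ (-(((n:ℝ) - 2*s)/2) - 1) := by
  have hs0 := hs.1
  set a := ((n:ℝ) - 2*s)/2 with ha_def
  have ha : 0 < a := by simp only [ha_def]; linarith
  have hb : 0 < ((n:ℝ) + 2*s)/2 := by positivity
  have han : a < n / 2 := by simp only [ha_def]; linarith
  have hG1 := Real.Gamma_pos_of_pos ha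
  have hG2 := Real.Gamma_pos_of_pos hb
  have hGa := Real.Gamma_pos_of_pos (show 0 < a + 1 by linarith)
  have hGb := Real.Gamma_pos_of_pos (show 0 < (n:ℝ)/2 - a by linarith)
  set c1 := (Real.Gamma a * Real.Gamma (((n:ℝ) + 2*s)/2))⁻¹ with hc1
  have hc1p : 0 < c1 := by positivity
  set c2 := Real.pi ^ ((n:ℝ)/2) * (Real.Gamma (a + 1) * Real.Gamma (n/2 - a)) with hc2
  have hc2p : 0 < c2 := by positivity
  refine ⟨cns * c1 * c2 * 3 * 2 ^ (a+1), by positivity, fun x y hx hy => ?_⟩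
  refine norm_fderiv_le_of_lip' ℝ (by positivity) ?_
  have hx0 : 0 < ‖x‖ := by linarith
  filter_upwards [Metric.ball_mem_nhds x (show 0 < ‖x‖/4 by positivity)] with x' hx'
  rw [Metric.mem_ball, dist_eq_norm] at hx'
  have t1 : ‖x'‖ ≤ ‖x‖ + ‖x' - x‖ := norm_le_norm_add_norm_sub' _ _
  have t2 : ‖x‖ ≤ ‖x'‖ + ‖x' - x‖ := by
    rw [norm_sub_rev]; exact norm_le_norm_add_norm_sub' _ _
  have t3 : |‖x'‖ - ‖x‖| ≤ ‖x' - x‖ := abs_norm_sub_norm_le _ _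
  rw [w1_eq n s cns hs hns y hy x, w1_eq n s cns hs hns y hy x', ← ha_def, ← hc1]
  rw [← mul_sub, ← mul_sub, Real.norm_eq_abs, abs_mul, abs_mul c1, abs_of_pos hc1p,
    abs_of_pos (by positivity : 0 < cns * y ^ (2*s))]
  have hJ := Jf_lip_sym n a y (‖x‖^2/2) (‖x'‖^2) (‖x‖^2) ha han hy (by positivity)
    (by nlinarith) (by nlinarith)
  rw [← hc2] at hJ
  have h5 : |‖x'‖^2 - ‖x‖^2| ≤ 3 * ‖x‖ * ‖x' - x‖ := by
    rw [show ‖x'‖^2 - ‖x‖^2 = (‖x'‖ + ‖x‖) * (‖x'‖ - ‖x‖) by ring, abs_mul,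
      abs_of_nonneg (by positivity : 0 ≤ ‖x'‖ + ‖x‖)]
    have : ‖x'‖ + ‖x‖ ≤ 3 * ‖x‖ := by linarith
    gcongr
  have h6 : (‖x‖^2/2 + y^2) ^ (-a-1) ≤ 2 ^ (a+1) * (‖x‖^2 + y^2) ^ (-a-1) := by
    calc (‖x‖^2/2 + y^2) ^ (-a-1) ≤ ((‖x‖^2 + y^2)/2) ^ (-a-1) :=
          Real.rpow_le_rpow_of_nonpos (by positivity) (by nlinarith) (by linarith)
      _ = _ := by
          rw [Real.div_rpow (by positivity) (by positivity), show -a-1 = -(a+1) by ring,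
            Real.rpow_neg (by norm_num : (0:ℝ) ≤ 2), div_inv_eq_mul, mul_comm]
  have h7 : y ^ (2*s) * (y^2) ^ (a - n/2) = 1 := by
    rw [← Real.rpow_natCast, ← Real.rpow_mul hy.le, ← Real.rpow_add hy, ha_def]
    rw [show 2 * s + ((2:ℕ):ℝ) * (((n:ℝ) - 2 * s) / 2 - n / 2) = 0 by push_cast; ring,
      Real.rpow_zero]
  calc cns * y ^ (2*s) * (c1 * |(Jf n a y (‖x'‖^2)).toReal - (Jf n a y (‖x‖^2)).toReal|)
      ≤ cns * y ^ (2*s) * (c1 * ((3 * ‖x‖ * ‖x' - x‖) * (c2 * (y^2) ^ (a - n/2) *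
        (2 ^ (a+1) * (‖x‖^2 + y^2) ^ (-a-1))))) := by
        have := hJ.trans (mul_le_mul h5 (mul_le_mul_of_nonneg_left h6
          (by positivity)) (by positivity) (by positivity))
        gcongr
    _ = (y ^ (2*s) * (y^2) ^ (a - n/2)) * (cns * c1 * c2 * 3 * 2 ^ (a+1) * ‖x‖ *
        (‖x‖^2 + y^2) ^ (-a-1) * ‖x' - x‖) := by ring
    _ = _ := by rw [h7, one_mul]

/-- Weighted gradient integrability of the standard bubble, critical weight
(inequality (3.6), case `σ = n - 2s`). -/
theorem bubble_weighted_integrable_critical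
    (n : ℕ) (hn : 1 ≤ n) (s : ℝ) (hs : s ∈ Ioo (0:ℝ) 1) (hns : 2 * s < (n:ℝ))
    (cns : ℝ) (hcns : 0 < cns)
    (hnorm : ∀ y : ℝ, 0 < y →
      cns * (∫ x : Euc n, y ^ (2*s) * (‖x‖ ^ 2 + y ^ 2) ^ (-(((n:ℝ) + 2*s) / 2))) = 1)
    (σ : ℝ) (hσ : σ = (n:ℝ) - 2*s) :
    ∃ C > (0:ℝ), ∀ R : ℝ, 2 ≤ R →
      (∫⁻ p in {p : Euc n × ℝ | 1 ≤ ‖p.1‖ ∧ 0 < p.2 ∧ ‖p.1‖ ^ 2 + p.2 ^ 2 ≤ R ^ 2},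
          ENNReal.ofReal (p.2 ^ (1 - 2*s) * ‖p.1‖ ^ σ *
            ∑ i, (pdX n (w1 n s cns) i p.1 p.2) ^ 2))
        ≤ ENNReal.ofReal (C * Real.log R) := by
  have hs0 := hs.1
  have hs1 := hs.2
  obtain ⟨K, hK, hgrad⟩ := grad_bound_s9 n s hs hns cns hcns
  obtain ⟨C0, hC0, hrad⟩ := radial n hn
  set a := ((n:ℝ) - 2*s)/2 with ha_def
  have ha : 0 < a := by simp only [ha_def]; linarith
  have h2a : σ = 2 * a := by rw [hσ, ha_def]; ring
  have hG1 := Real.Gamma_pos_of_pos (show 0 < 1 - 2*s + 1 by linarith)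
  have hG2 := Real.Gamma_pos_of_pos (show 0 < (2*a+2) - (1 - 2*s) - 1 by linarith)
  have hG3 := Real.Gamma_pos_of_pos (show 0 < 2*a+2 by linarith)
  have hn0 : (0:ℝ) < n := by exact_mod_cast hn
  set B := Real.Gamma (1 - 2*s + 1) * Real.Gamma ((2*a+2) - (1 - 2*s) - 1) / Real.Gamma (2*a+2)
    with hB
  have hBp : 0 < B := by positivity
  set D := (n:ℝ) * K^2 * 2 ^ (a+1) with hD
  have hDp : 0 < D := by positivity
  refine ⟨D * B * C0, by positivity, fun R hR => ?_⟩
  have hms : MeasurableSet {x : Euc n | 1 ≤ ‖x‖ ∧ ‖x‖ ≤ R} :=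
    (measurableSet_le measurable_const measurable_norm).inter
      (measurableSet_le measurable_norm measurable_const)
  set T : Set (Euc n × ℝ) := {x : Euc n | 1 ≤ ‖x‖ ∧ ‖x‖ ≤ R} ×ˢ Ioi (0:ℝ) with hT
  have hTm : MeasurableSet T := hms.prod measurableSet_Ioi
  have hsub : {p : Euc n × ℝ | 1 ≤ ‖p.1‖ ∧ 0 < p.2 ∧ ‖p.1‖ ^ 2 + p.2 ^ 2 ≤ R ^ 2} ⊆ T := by
    rintro p ⟨h1, h2, h3⟩
    exact ⟨⟨h1, abs_le_of_sq_le_sq' (by nlinarith) (by linarith) |>.2⟩, h2⟩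
  have hpt : ∀ p ∈ T, ENNReal.ofReal (p.2 ^ (1 - 2*s) * ‖p.1‖ ^ σ *
      ∑ i, (pdX n (w1 n s cns) i p.1 p.2) ^ 2) ≤
      ENNReal.ofReal (D * (p.2 ^ (1 - 2*s) * (‖p.1‖ + p.2 * 1) ^ (-(2*a+2)))) := by
    rintro ⟨x, y⟩ ⟨⟨hx, -⟩, hy⟩
    have hy : 0 < y := hy
    dsimp only at hx ⊢
    have hx0 : 0 < ‖x‖ := by linarith
    have hg := hgrad x y hx hy
    set G := K * ‖x‖ * (‖x‖^2 + y^2) ^ (-a-1) with hGdef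
    have hsum : ∑ i, (pdX n (w1 n s cns) i x y) ^ 2 ≤ n * G^2 := by
      calc _ ≤ ∑ _i : Fin n, G^2 := by
            refine Finset.sum_le_sum fun i _ => ?_
            have : |pdX n (w1 n s cns) i x y| ≤ G := by
              have h := (fderiv ℝ (fun x' => w1 n s cns x' y) x).le_opNorm
                (EuclideanSpace.single i (1:ℝ))
              rw [EuclideanSpace.norm_single, norm_one, mul_one] at h
              exact h.trans hg
            exact sq_le_sq' (abs_le.1 this).1 (abs_le.1 this).2
        _ = _ := by simp
    apply ENNReal.ofReal_le_ofReal
    set Q := ‖x‖^2 + y^2 with hQ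
    have hQp : 0 < Q := by positivity
    have e1 : ‖x‖ ^ σ * ‖x‖^2 ≤ Q ^ (a+1) := by
      calc ‖x‖ ^ σ * ‖x‖^2 = (‖x‖^2) ^ (a+1) := by
            rw [← Real.rpow_natCast, ← Real.rpow_mul hx0.le, ← Real.rpow_add hx0, h2a]
            congr 1; push_cast; ring
        _ ≤ _ := Real.rpow_le_rpow (by positivity) (by nlinarith) (by linarith)
    have e2 : Q ^ (-a-1) ≤ 2 ^ (a+1) * (‖x‖ + y * 1) ^ (-(2*a+2)) := by
      calc Q ^ (-a-1) ≤ ((‖x‖ + y)^2/2) ^ (-a-1) :=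
            Real.rpow_le_rpow_of_nonpos (by positivity)
              (by nlinarith [sq_nonneg (‖x‖ - y)]) (by linarith)
        _ = _ := by
            rw [Real.div_rpow (by positivity) (by positivity), show -a-1 = -(a+1) by ring,
              Real.rpow_neg (by norm_num : (0:ℝ) ≤ 2), div_inv_eq_mul, mul_comm,
              ← Real.rpow_natCast, ← Real.rpow_mul (by positivity), mul_one]
            congr 2; push_cast; ring
    have e3 : Q ^ (a+1) * Q ^ (-a-1) = 1 := by
      rw [← Real.rpow_add hQp, show a + 1 + (-a-1) = 0 by ring, Real.rpow_zero]
    calc y ^ (1 - 2*s) * ‖x‖ ^ σ * ∑ i, (pdX n (w1 n s cns) i x y) ^ 2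
        ≤ y ^ (1 - 2*s) * ‖x‖ ^ σ * (n * G^2) := by gcongr
      _ = n * K^2 * y ^ (1 - 2*s) * ((‖x‖ ^ σ * ‖x‖^2) * (Q ^ (-a-1) * Q ^ (-a-1))) := by
          rw [hGdef]; ring
      _ ≤ n * K^2 * y ^ (1 - 2*s) * (Q ^ (a+1) * (Q ^ (-a-1) * Q ^ (-a-1))) := by gcongr
      _ = n * K^2 * y ^ (1 - 2*s) * Q ^ (-a-1) := by rw [← mul_assoc (Q ^ (a+1)), e3, one_mul]
      _ ≤ n * K^2 * y ^ (1 - 2*s) * (2 ^ (a+1) * (‖x‖ + y * 1) ^ (-(2*a+2))) := by gcongr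
      _ = _ := by rw [hD]; ring
  have hmeas : Measurable (fun p : Euc n × ℝ =>
      ENNReal.ofReal (D * (p.2 ^ (1 - 2*s) * (‖p.1‖ + p.2 * 1) ^ (-(2*a+2))))) := by fun_prop
  calc _ ≤ ∫⁻ p in T, ENNReal.ofReal (p.2 ^ (1 - 2*s) * ‖p.1‖ ^ σ *
            ∑ i, (pdX n (w1 n s cns) i p.1 p.2) ^ 2) := lintegral_mono_set hsub
    _ ≤ ∫⁻ p in T, ENNReal.ofReal (D * (p.2 ^ (1 - 2*s) * (‖p.1‖ + p.2 * 1) ^ (-(2*a+2)))) :=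
        setLIntegral_mono' hTm hpt
    _ = ∫⁻ x in {x : Euc n | 1 ≤ ‖x‖ ∧ ‖x‖ ≤ R}, ∫⁻ y in Ioi (0:ℝ),
          ENNReal.ofReal (D * (y ^ (1 - 2*s) * (‖x‖ + y * 1) ^ (-(2*a+2)))) := by
        rw [Measure.volume_eq_prod, hT, ← Measure.prod_restrict, lintegral_prod _ hmeas.aemeasurable]
    _ = ∫⁻ x in {x : Euc n | 1 ≤ ‖x‖ ∧ ‖x‖ ≤ R},
          ENNReal.ofReal (D * B) * ENNReal.ofReal (‖x‖ ^ (-(n:ℝ))) := by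
        refine setLIntegral_congr_fun hms fun x hx => ?_
        have hx0 : 0 < ‖x‖ := by linarith [hx.1]
        simp_rw [ENNReal.ofReal_mul hDp.le]
        rw [lintegral_const_mul' _ _ ENNReal.ofReal_ne_top,
          beta (1-2*s) (2*a+2) ‖x‖ 1 (by linarith) (by linarith) hx0 one_pos, ← hB,
          Real.one_rpow, mul_one, ENNReal.ofReal_mul hBp.le, mul_assoc]
        congr 4
        rw [ha_def]; ring
    _ = _ := by
        rw [lintegral_const_mul' _ _ ENNReal.ofReal_ne_top, hrad R hR,
          ← ENNReal.ofReal_mul (by positivity)]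
        congr 1; ring
end
end
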